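/- Let d be a natural number and p, q real numbers with 1 < p < d and p−1 < q < q_c, where q_c = pd/(d−p) − 1. Then there is no function u : ℝ^d → ℝ which is continuously differentiable, satisfies u(x) > 0 for all x ∈ ℝ^d, and is a weak solution of −Δ_p u = u^q on ℝ^d, i.e. for every infinitely differentiable compactly supported φ : ℝ^d → ℝ one has ∫_{ℝ^d} ‖∇u(x)‖^{p−2} ⟨∇u(x), ∇φ(x)⟩ dx = ∫_{ℝ^d} u(x)^q φ(x) dx (integrals with respect to Lebesgue measure, ∇ the Euclidean gradient and ⟨·,·⟩ the Euclidean inner product). -/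

import Mathlib

section part1
open scoped RealInnerProductSpace ContDiff Convolution Topology
open MeasureTheory Filter Set Metric

abbrev Eu (d : ℕ) := EuclideanSpace ℝ (Fin d)

theorem grad_cont {d : ℕ} {u : Eu d → ℝ} (hu : ContDiff ℝ 1 u) : Continuous (gradient u) := by
  have h := hu.continuous_fderiv (by norm_num)
  unfold gradient
  exact (InnerProductSpace.toDual ℝ (Eu d)).symm.continuous.comp h

theorem inner_grad {d : ℕ} (φ : Eu d → ℝ) (x v : Eu d) : ⟪v, gradient φ x⟫ = fderiv ℝ φ x v := by
  rw [inner_gradient_right]; simp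

theorem norm_grad {d : ℕ} (φ : Eu d → ℝ) (x : Eu d) : ‖gradient φ x‖ = ‖fderiv ℝ φ x‖ := by
  unfold gradient; simp

theorem moll_exists (d : ℕ) : ∃ C : ℝ, 0 ≤ C ∧ ∀ ε > 0, ∃ ρ : Eu d → ℝ, ContDiff ℝ ∞ ρ ∧ (∀ x, 0 ≤ ρ x) ∧
    Function.support ρ ⊆ ball 0 ε ∧ HasCompactSupport ρ ∧ ∫ x, ρ x = 1 ∧
    ∫ x, ‖fderiv ℝ ρ x‖ ≤ C / ε := by
  let b : ContDiffBump (0 : Eu d) := ⟨1/2, 1, by norm_num, by norm_num⟩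
  set ρ0 : Eu d → ℝ := b.normed volume with hρ0
  have hs0 : ContDiff ℝ ∞ ρ0 := b.contDiff_normed
  have hc0 : HasCompactSupport ρ0 := b.hasCompactSupport_normed
  refine ⟨∫ x, ‖fderiv ℝ ρ0 x‖, integral_nonneg fun _ => norm_nonneg _, fun ε hε => ?_⟩
  have hfr : Module.finrank ℝ (Eu d) = d := by simp
  refine ⟨fun x => (ε ^ d)⁻¹ * ρ0 (ε⁻¹ • x), ?_, ?_, ?_, ?_, ?_, ?_⟩
  · exact contDiff_const.mul (hs0.comp (contDiff_const_smul _))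
  · intro x; exact mul_nonneg (by positivity) (b.nonneg_normed _)
  · intro x hx
    have : ρ0 (ε⁻¹ • x) ≠ 0 := by
      intro h; apply hx; simp [h]
    have h2 : ε⁻¹ • x ∈ ball (0 : Eu d) 1 := by
      rw [← b.support_normed_eq (μ := volume)]; exact this
    simp only [mem_ball, dist_zero_right, norm_smul, norm_inv, Real.norm_eq_abs, abs_of_pos hε] at h2 ⊢
    rwa [inv_mul_lt_iff₀ hε, mul_one] at h2
  · have := (hc0.comp_homeomorph (Homeomorph.smulOfNeZero (ε⁻¹) (inv_ne_zero hε.ne'))).mul_left (f := fun _ : Eu d => (ε ^ d)⁻¹)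
    exact this
  · rw [integral_const_mul, Measure.integral_comp_smul, hfr, b.integral_normed]
    simp only [smul_eq_mul, mul_one, inv_pow, inv_inv]
    rw [abs_of_pos (by positivity)]
    field_simp
  · have hder : ∀ x, ‖fderiv ℝ (fun x => (ε ^ d)⁻¹ * ρ0 (ε⁻¹ • x)) x‖ = (ε ^ d)⁻¹ * ε⁻¹ * ‖fderiv ℝ ρ0 (ε⁻¹ • x)‖ := by
      intro x
      have hd : DifferentiableAt ℝ ρ0 (ε⁻¹ • x) := (hs0.differentiable (by simp)) _
      have h1 : HasFDerivAt (fun x => (ε ^ d)⁻¹ * ρ0 (ε⁻¹ • x)) ((ε ^ d)⁻¹ • ((fderiv ℝ ρ0 (ε⁻¹ • x)).comp (ε⁻¹ • ContinuousLinearMap.id ℝ (Eu d)))) x := by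
        apply HasFDerivAt.const_mul
        exact hd.hasFDerivAt.comp x (show HasFDerivAt (fun y : Eu d => ε⁻¹ • y) _ x from (hasFDerivAt_id x).const_smul ε⁻¹)
      rw [h1.fderiv, ContinuousLinearMap.comp_smul, ContinuousLinearMap.comp_id, norm_smul, norm_smul]
      simp [abs_of_pos hε, mul_assoc]
    simp_rw [hder]
    rw [integral_const_mul, Measure.integral_comp_smul (volume : Measure (Eu d)) (fun y => ‖fderiv ℝ ρ0 y‖), hfr]
    simp only [smul_eq_mul, inv_pow, inv_inv]
    rw [abs_of_pos (by positivity)]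
    apply le_of_eq
    field_simp

/-- mollification -/
noncomputable def mol {d : ℕ} {F : Type*} [NormedAddCommGroup F] [NormedSpace ℝ F] (ρ : Eu d → ℝ) (g : Eu d → F) (x : Eu d) : F :=
  ∫ z, ρ z • g (x - z)

theorem mol_eq_conv {d : ℕ} {F : Type*} [NormedAddCommGroup F] [NormedSpace ℝ F] (ρ : Eu d → ℝ) (g : Eu d → F) :
    mol ρ g = (ρ ⋆[ContinuousLinearMap.lsmul ℝ ℝ, volume] g) := rfl

theorem mol_smooth {d : ℕ} {F : Type*} [NormedAddCommGroup F] [NormedSpace ℝ F] [CompleteSpace F] {ρ : Eu d → ℝ} {g : Eu d → F}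
    (hρ : ContDiff ℝ ∞ ρ) (hc : HasCompactSupport ρ) (hg : Continuous g) : ContDiff ℝ ∞ (mol ρ g) := by
  rw [mol_eq_conv]
  exact hc.contDiff_convolution_left _ hρ hg.locallyIntegrable

theorem mol_dist {d : ℕ} {F : Type*} [NormedAddCommGroup F] [NormedSpace ℝ F] [CompleteSpace F] {ρ : Eu d → ℝ} {g : Eu d → F} {ε κ : ℝ} (hκ : 0 ≤ κ)
    (h0 : ∀ x, 0 ≤ ρ x) (hsup : Function.support ρ ⊆ ball 0 ε) (h1 : ∫ x, ρ x = 1) (hg : Continuous g) (x : Eu d)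
    (h : ∀ y ∈ ball x ε, dist (g y) (g x) ≤ κ) : dist (mol ρ g x) (g x) ≤ κ := by
  rw [mol_eq_conv]
  exact dist_convolution_le hκ hsup h0 h1 hg.aestronglyMeasurable h

theorem mol_fderiv_left {d : ℕ} {F : Type*} [NormedAddCommGroup F] [NormedSpace ℝ F] [CompleteSpace F] {ρ : Eu d → ℝ} {g : Eu d → F}
    (hρ : ContDiff ℝ ∞ ρ) (hc : HasCompactSupport ρ) (hg : Continuous g) (x v : Eu d) :
    fderiv ℝ (mol ρ g) x v = ∫ z, (fderiv ℝ ρ z v) • g (x - z) := by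
  have h := hc.hasFDerivAt_convolution_left (ContinuousLinearMap.lsmul ℝ ℝ) (μ := volume) (hρ.of_le (by norm_cast)) hg.locallyIntegrable x
  rw [mol_eq_conv, h.fderiv]
  have hce := (hc.fderiv ℝ).convolutionExists_left (L := ContinuousLinearMap.precompL (Eu d) (ContinuousLinearMap.lsmul ℝ ℝ : ℝ →L[ℝ] F →L[ℝ] F)) (μ := volume) (hρ.continuous_fderiv (by simp)) hg.locallyIntegrable x
  unfold convolution
  rw [ContinuousLinearMap.integral_apply hce]
  rfl

theorem mol_fderiv_right {d : ℕ} {ρ : Eu d → ℝ} {g : Eu d → ℝ}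
    (hρ : Continuous ρ) (hc : HasCompactSupport ρ) (hg : ContDiff ℝ 1 g) (x : Eu d) :
    HasFDerivAt (mol ρ g) (mol ρ (fderiv ℝ g) x) x := by
  have hgd := hg.continuous_fderiv (by norm_num)
  have hK : IsCompact ((fun a : Eu d × Eu d => a.1 - a.2) '' (closedBall x 1 ×ˢ tsupport ρ)) :=
    ((isCompact_closedBall x 1).prod hc).image (by fun_prop)
  obtain ⟨M, hM⟩ := hK.exists_bound_of_continuousOn (f := fderiv ℝ g) hgd.continuousOn
  have hint : Integrable ρ := hρ.integrable_of_hasCompactSupport hc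
  unfold mol
  refine hasFDerivAt_integral_of_dominated_of_fderiv_le (F' := fun y z => ρ z • fderiv ℝ g (y - z))
    (bound := fun z => |ρ z| * M) (ball_mem_nhds x one_pos) ?_ ?_ ?_ ?_ ?_ ?_
  · filter_upwards with y
    exact (hρ.smul (hg.continuous.comp (by fun_prop))).aestronglyMeasurable
  · refine (hρ.smul (hg.continuous.comp (by fun_prop : Continuous fun z => x - z))).integrable_of_hasCompactSupport ?_
    exact hc.smul_right
  · exact (hρ.smul (hgd.comp (by fun_prop))).aestronglyMeasurable
  · filter_upwards with z y hy
    rw [norm_smul, Real.norm_eq_abs]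
    by_cases hz : z ∈ tsupport ρ
    · exact mul_le_mul_of_nonneg_left (hM _ ⟨(y, z), ⟨ball_subset_closedBall hy, hz⟩, rfl⟩) (abs_nonneg _)
    · rw [image_eq_zero_of_notMem_tsupport hz]; simp
  · exact hint.abs.mul_const M
  · filter_upwards with z y hy
    have h1 : HasFDerivAt g (fderiv ℝ g (y - z)) (y - z) := (hg.differentiable (by norm_num) _).hasFDerivAt
    have h2 : HasFDerivAt (fun y => g (y - z)) (fderiv ℝ g (y - z)) y := by
      have h3 := h1.comp y ((hasFDerivAt_id y).sub_const z)
      rw [ContinuousLinearMap.comp_id] at h3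
      exact h3
    exact h2.const_smul (ρ z)
end part1

section part2
open scoped RealInnerProductSpace ContDiff Convolution Topology
open MeasureTheory Filter Set Metric

noncomputable def Fp {d : ℕ} (p : ℝ) (ξ : Eu d) : Eu d := ‖ξ‖ ^ (p - 2) • ξ

theorem norm_Fp {d : ℕ} {p : ℝ} (hp : 1 < p) (ξ : Eu d) : ‖Fp p ξ‖ = ‖ξ‖ ^ (p - 1) := by
  unfold Fp
  rw [norm_smul, Real.norm_eq_abs, abs_of_nonneg (by positivity)]
  rcases eq_or_ne ξ 0 with rfl | h
  · simp [Real.zero_rpow (by linarith : p - 1 ≠ 0)]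
  · have : 0 < ‖ξ‖ := norm_pos_iff.2 h
    rw [← Real.rpow_add_one this.ne']; ring_nf

theorem Fp_inner {d : ℕ} {p : ℝ} (hp : 1 < p) (ξ : Eu d) : ⟪Fp p ξ, ξ⟫ = ‖ξ‖ ^ p := by
  unfold Fp
  rw [real_inner_smul_left, real_inner_self_eq_norm_sq]
  rcases eq_or_ne ξ 0 with rfl | h
  · simp [Real.zero_rpow (by linarith : p ≠ 0)]
  · have : 0 < ‖ξ‖ := norm_pos_iff.2 h
    rw [← Real.rpow_natCast, ← Real.rpow_add this]; norm_num

theorem Fp_cont {d : ℕ} {p : ℝ} (hp : 1 < p) : Continuous (Fp (d := d) p) := by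
  rw [continuous_iff_continuousAt]
  intro ξ
  rcases eq_or_ne ξ 0 with rfl | h
  · have h0 : Fp p (0 : Eu d) = 0 := by simp [Fp]
    rw [ContinuousAt, h0]
    apply squeeze_zero_norm (a := fun ξ : Eu d => ‖ξ‖ ^ (p - 1)) (fun ξ => (norm_Fp hp ξ).le)
    have : Continuous (fun ξ : Eu d => ‖ξ‖ ^ (p - 1)) :=
      continuous_norm.rpow_const (fun _ => Or.inr (by linarith))
    have h := this.tendsto 0
    simpa [Real.zero_rpow (by linarith : p - 1 ≠ 0)] using h
  · unfold Fp
    exact (continuousAt_id.norm.rpow_const (Or.inl (by simpa using h))).smul continuousAt_id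

theorem Fp_mono {d : ℕ} {p : ℝ} (hp : 1 < p) (a b : Eu d) : 0 ≤ ⟪Fp p a - Fp p b, a - b⟫ := by
  have h1 : ⟪Fp p a, b⟫ ≤ ‖a‖ ^ (p - 1) * ‖b‖ := by
    rw [← norm_Fp hp]; exact real_inner_le_norm _ _
  have h2 : ⟪Fp p b, a⟫ ≤ ‖b‖ ^ (p - 1) * ‖a‖ := by
    rw [← norm_Fp hp]; exact real_inner_le_norm _ _
  have h3 : ∀ c : Eu d, ‖c‖ ^ p = ‖c‖ ^ (p - 1) * ‖c‖ := by
    intro c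
    rw [← Fp_inner hp c]
    rcases eq_or_ne c 0 with rfl | h
    · simp [Fp]
    · have : 0 < ‖c‖ := norm_pos_iff.2 h
      rw [Fp_inner hp, ← Real.rpow_add_one this.ne']; ring_nf
  rw [inner_sub_left, inner_sub_right, inner_sub_right, Fp_inner hp, Fp_inner hp, h3 a, h3 b]
  have h4 : 0 ≤ (‖a‖ ^ (p - 1) - ‖b‖ ^ (p - 1)) * (‖a‖ - ‖b‖) := by
    rcases le_total ‖a‖ ‖b‖ with h | h
    · exact mul_nonneg_of_nonpos_of_nonpos (sub_nonpos.2 (Real.rpow_le_rpow (norm_nonneg _) h (by linarith))) (by linarith)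
    · exact mul_nonneg (sub_nonneg.2 (Real.rpow_le_rpow (norm_nonneg _) h (by linarith))) (by linarith)
  nlinarith

theorem mol_zero {d : ℕ} {F : Type*} [NormedAddCommGroup F] [NormedSpace ℝ F] {ρ : Eu d → ℝ} {g : Eu d → F} {T : Set (Eu d)}
    (hsup : Function.support ρ ⊆ ball 0 1) (hg : ∀ x ∉ T, g x = 0) (x : Eu d) (hx : x ∉ cthickening 1 T) :
    mol ρ g x = 0 := by
  unfold mol
  have : ∀ z, ρ z • g (x - z) = 0 := by
    intro z
    by_cases hz : ρ z = 0
    · simp [hz]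
    · have hz1 : z ∈ ball (0 : Eu d) 1 := hsup hz
      have : x - z ∉ T := by
        intro h
        apply hx
        apply mem_cthickening_of_dist_le x (x - z) 1 T h
        simp only [mem_ball, dist_zero_right] at hz1
        simpa [dist_eq_norm] using hz1.le
      rw [hg _ this, smul_zero]
  simp [this]

/-- weak solution tested with `C^1` functions -/
def Weak1 {d : ℕ} (p q : ℝ) (u : Eu d → ℝ) : Prop :=
  ∀ φ : Eu d → ℝ, ContDiff ℝ 1 φ → HasCompactSupport φ →
    ∫ x, ⟪Fp p (gradient u x), gradient φ x⟫ = ∫ x, u x ^ q * φ x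

theorem weak_ext {d : ℕ} {p q : ℝ} (hp : 1 < p) {u : Eu d → ℝ} (hu : ContDiff ℝ 1 u) (hpos : ∀ x, 0 < u x)
    (hw : ∀ φ : Eu d → ℝ, ContDiff ℝ (⊤ : ℕ∞) φ → HasCompactSupport φ →
          ∫ x, ‖gradient u x‖ ^ (p - 2) * ⟪gradient u x, gradient φ x⟫
            = ∫ x, u x ^ q * φ x) : Weak1 p q u := by
  intro φ hφ hc
  obtain ⟨C, -, hmol⟩ := moll_exists d
  set V : Eu d → Eu d := fun x => Fp p (gradient u x) with hV
  have hVc : Continuous V := (Fp_cont hp).comp (grad_cont hu)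
  have hgc : Continuous (fun x => u x ^ q) := hu.continuous.rpow_const (fun x => Or.inl (hpos x).ne')
  set K := cthickening 1 (tsupport φ) with hK
  have hKc : IsCompact K := hc.isCompact.cthickening
  have hφ' : Continuous (fderiv ℝ φ) := hφ.continuous_fderiv (by norm_num)
  have huc1 : UniformContinuous φ := hc.uniformContinuous_of_continuous hφ.continuous
  have huc2 : UniformContinuous (fderiv ℝ φ) := (hc.fderiv ℝ).uniformContinuous_of_continuous hφ'
  have hzero : ∀ x ∉ tsupport φ, φ x = 0 := fun x hx => image_eq_zero_of_notMem_tsupport hx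
  have hzero' : ∀ x ∉ tsupport φ, fderiv ℝ φ x = 0 := fun x hx => by
    by_contra h
    exact hx (support_fderiv_subset ℝ h)
  have hsubK : tsupport φ ⊆ K := self_subset_cthickening _
  set M := (∫ x in K, ‖V x‖) + ∫ x in K, |u x ^ q| with hM
  have hiV : IntegrableOn (fun x => ‖V x‖) K := hVc.norm.continuousOn.integrableOn_compact hKc
  have hig : IntegrableOn (fun x => |u x ^ q|) K := hgc.abs.continuousOn.integrableOn_compact hKc
  have hM0 : 0 ≤ M := by
    apply add_nonneg <;> apply integral_nonneg <;> intro x <;> positivity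
  have key : ∀ κ > 0, |(∫ x, ⟪V x, gradient φ x⟫) - ∫ x, u x ^ q * φ x| ≤ κ * M := by
    intro κ hκ
    obtain ⟨δ1, hδ1, h1⟩ := Metric.uniformContinuous_iff.1 huc1 κ hκ
    obtain ⟨δ2, hδ2, h2⟩ := Metric.uniformContinuous_iff.1 huc2 κ hκ
    set ε := min 1 (min δ1 δ2) with hε
    have hεpos : 0 < ε := lt_min one_pos (lt_min hδ1 hδ2)
    obtain ⟨ρ, hρs, hρ0, hρsup, hρc, hρ1, -⟩ := hmol ε hεpos
    have hsup1 : Function.support ρ ⊆ ball 0 1 := hρsup.trans (ball_subset_ball (min_le_left _ _))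
    set ψ := mol ρ φ with hψ
    have hψs : ContDiff ℝ ∞ ψ := mol_smooth hρs hρc hφ.continuous
    have hψ0 : ∀ x ∉ K, ψ x = 0 := fun x hx => mol_zero hsup1 hzero x hx
    have hψc : HasCompactSupport ψ := HasCompactSupport.intro hKc hψ0
    have hψd : ∀ x, fderiv ℝ ψ x = mol ρ (fderiv ℝ φ) x := fun x => (mol_fderiv_right hρs.continuous hρc hφ x).fderiv
    have hψd0 : ∀ x ∉ K, fderiv ℝ ψ x = 0 := fun x hx => by
      rw [hψd]; exact mol_zero hsup1 hzero' x hx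
    have e1 : ∀ x, |ψ x - φ x| ≤ κ := fun x => by
      have := mol_dist hκ.le hρ0 hρsup hρ1 hφ.continuous x (fun y hy => (h1 (lt_of_lt_of_le hy (by simp [hε]))).le)
      simpa [Real.dist_eq] using this
    have e2 : ∀ x, ‖gradient ψ x - gradient φ x‖ ≤ κ := fun x => by
      have := mol_dist hκ.le hρ0 hρsup hρ1 hφ' x (fun y hy => (h2 (lt_of_lt_of_le hy (by simp [hε]))).le)
      rw [← hψd, dist_eq_norm] at this
      unfold gradient
      rw [← map_sub, LinearIsometryEquiv.norm_map]
      exact this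
    have hw' := hw ψ hψs hψc
    have hw2 : ∫ x, ⟪V x, gradient ψ x⟫ = ∫ x, u x ^ q * ψ x := by
      rw [← hw']; congr 1; ext x; simp [hV, Fp, real_inner_smul_left]
    have hgψ : Continuous (gradient ψ) := grad_cont (hψs.of_le (by norm_cast))
    have hgφ : Continuous (gradient φ) := grad_cont hφ
    have g0 : ∀ x ∉ K, gradient φ x = 0 := fun x hx => by
      unfold gradient; rw [hzero' x (fun h => hx (hsubK h))]; simp
    have g0' : ∀ x ∉ K, gradient ψ x = 0 := fun x hx => by
      unfold gradient; rw [hψd0 x hx]; simp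
    have i1 : Integrable (fun x => ⟪V x, gradient φ x⟫) :=
      (hVc.inner hgφ).integrable_of_hasCompactSupport (HasCompactSupport.intro hKc (fun x hx => by simp [g0 x hx]))
    have i2 : Integrable (fun x => ⟪V x, gradient ψ x⟫) :=
      (hVc.inner hgψ).integrable_of_hasCompactSupport (HasCompactSupport.intro hKc (fun x hx => by simp [g0' x hx]))
    have i3 : Integrable (fun x => u x ^ q * φ x) :=
      (hgc.mul hφ.continuous).integrable_of_hasCompactSupport hc.mul_left
    have i4 : Integrable (fun x => u x ^ q * ψ x) :=
      (hgc.mul hψs.continuous).integrable_of_hasCompactSupport hψc.mul_left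
    have b1 : |(∫ x, ⟪V x, gradient φ x⟫) - ∫ x, ⟪V x, gradient ψ x⟫| ≤ κ * ∫ x in K, ‖V x‖ := by
      rw [← integral_sub i1 i2, ← setIntegral_eq_integral_of_forall_compl_eq_zero (s := K), ← integral_const_mul]
      · rw [← Real.norm_eq_abs]; apply norm_integral_le_of_norm_le (hiV.const_mul κ)
        filter_upwards with x
        rw [← inner_sub_right, mul_comm]
        refine (norm_inner_le_norm _ _).trans ?_
        apply mul_le_mul_of_nonneg_left _ (norm_nonneg _)
        rw [norm_sub_rev]; exact e2 x
      · intro x hx; simp [g0 x hx, g0' x hx]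
    have b2 : |(∫ x, u x ^ q * ψ x) - ∫ x, u x ^ q * φ x| ≤ κ * ∫ x in K, |u x ^ q| := by
      rw [← integral_sub i4 i3, ← setIntegral_eq_integral_of_forall_compl_eq_zero (s := K), ← integral_const_mul]
      · rw [← Real.norm_eq_abs]; apply norm_integral_le_of_norm_le (hig.const_mul κ)
        filter_upwards with x
        rw [← mul_sub, mul_comm, Real.norm_eq_abs, abs_mul]
        exact mul_le_mul_of_nonneg_right (e1 x) (abs_nonneg _)
      · intro x hx; simp [hψ0 x hx, hzero x (fun h => hx (hsubK h))]
    rw [hM, mul_add]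
    calc _ = |((∫ x, ⟪V x, gradient φ x⟫) - ∫ x, ⟪V x, gradient ψ x⟫) + ((∫ x, u x ^ q * ψ x) - ∫ x, u x ^ q * φ x)| := by
          rw [hw2]; ring_nf
      _ ≤ _ := (abs_add_le _ _).trans (add_le_add b1 b2)
  have : |(∫ x, ⟪V x, gradient φ x⟫) - ∫ x, u x ^ q * φ x| ≤ 0 := by
    apply le_of_forall_pos_le_add
    intro e he
    refine (key (e / (M + 1)) (by positivity)).trans ?_
    rw [zero_add, div_mul_eq_mul_div, div_le_iff₀ (by positivity)]
    nlinarith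
  have := abs_nonpos_iff.1 this
  linarith
end part2

section part3
open scoped RealInnerProductSpace ContDiff Convolution Topology
open MeasureTheory Filter Set Metric

noncomputable def DF {d : ℕ} (p : ℝ) (ξ : Eu d) : Eu d →L[ℝ] Eu d :=
  ‖ξ‖ ^ (p - 2) • ContinuousLinearMap.id ℝ (Eu d) + ((p - 2) * ‖ξ‖ ^ (p - 4)) • (innerSL ℝ ξ).smulRight ξ

theorem DF_apply {d : ℕ} (p : ℝ) (ξ η : Eu d) : DF p ξ η = ‖ξ‖ ^ (p - 2) • η + ((p - 2) * ‖ξ‖ ^ (p - 4) * ⟪ξ, η⟫) • ξ := by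
  simp [DF, smul_smul]

theorem norm_rpow_hasFDerivAt {d : ℕ} (e : ℝ) {ξ : Eu d} (h : ξ ≠ 0) :
    HasFDerivAt (fun x : Eu d => ‖x‖ ^ e) ((e * ‖ξ‖ ^ (e - 2)) • innerSL ℝ ξ) ξ := by
  have hpos : 0 < ‖ξ‖ := norm_pos_iff.2 h
  have h1 : HasFDerivAt (fun x : Eu d => ‖x‖ ^ 2) (2 • innerSL ℝ ξ) ξ := (hasStrictFDerivAt_norm_sq ξ).hasFDerivAt
  have h2 := h1.rpow_const (p := e / 2) (Or.inl (by positivity))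
  have e1 : (fun x : Eu d => (‖x‖ ^ 2) ^ (e / 2)) = fun x : Eu d => ‖x‖ ^ e := by
    funext x
    rw [← Real.rpow_natCast, ← Real.rpow_mul (norm_nonneg _)]; congr 1; push_cast; ring
  rw [e1] at h2
  refine h2.congr_fderiv ?_
  ext1 v
  rw [← Real.rpow_natCast, ← Real.rpow_mul (norm_nonneg _)]
  have : ((2 : ℕ) : ℝ) * (e / 2 - 1) = e - 2 := by push_cast; ring
  rw [this]; simp; ring

theorem Fp_hasFDerivAt {d : ℕ} (p : ℝ) {ξ : Eu d} (h : ξ ≠ 0) : HasFDerivAt (Fp p) (DF p ξ) ξ := by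
  have h1 := (norm_rpow_hasFDerivAt (p - 2) h).smul (hasFDerivAt_id ξ)
  refine h1.congr_fderiv ?_
  ext1 v
  rw [DF_apply]
  have : p - 2 - 2 = p - 4 := by ring
  simp [this]

theorem DF_contOn {d : ℕ} (p : ℝ) : ContinuousOn (DF (d := d) p) {0}ᶜ := by
  intro ξ h
  have h0 : ‖ξ‖ ≠ 0 := norm_ne_zero_iff.2 h
  apply ContinuousAt.continuousWithinAt
  unfold DF
  apply ContinuousAt.add
  · exact (continuous_norm.continuousAt.rpow_const (Or.inl h0)).smul continuousAt_const
  · apply ContinuousAt.fun_smul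
    · exact continuousAt_const.mul (continuous_norm.continuousAt.rpow_const (Or.inl h0))
    · have : Continuous fun ξ : Eu d => (innerSL ℝ ξ).smulRight ξ := by
        have := (ContinuousLinearMap.smulRightL ℝ (Eu d) (Eu d)).continuous₂
        exact this.comp ((innerSL ℝ (E := Eu d)).continuous.prodMk continuous_id)
      exact this.continuousAt

theorem DF_coer {d : ℕ} {p : ℝ} (hp : 1 < p) {ξ : Eu d} (h : ξ ≠ 0) (η : Eu d) :
    min 1 (p - 1) * ‖ξ‖ ^ (p - 2) * ‖η‖ ^ 2 ≤ ⟪DF p ξ η, η⟫ := by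
  have hpos : 0 < ‖ξ‖ := norm_pos_iff.2 h
  rw [DF_apply, inner_add_left, real_inner_smul_left, real_inner_smul_left, real_inner_self_eq_norm_sq]
  have h4 : ‖ξ‖ ^ (p - 2) = ‖ξ‖ ^ (p - 4) * ‖ξ‖ ^ 2 := by
    rw [← Real.rpow_natCast, ← Real.rpow_add hpos]; congr 1; push_cast; ring
  have h5 : 0 < ‖ξ‖ ^ (p - 4) := by positivity
  have cs : ⟪ξ, η⟫ ^ 2 ≤ ‖ξ‖ ^ 2 * ‖η‖ ^ 2 := by
    rw [← mul_pow]; exact sq_le_sq' (by linarith [neg_le_of_abs_le (abs_real_inner_le_norm ξ η)]) (real_inner_le_norm ξ η)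
  rw [h4]
  generalize ‖ξ‖ ^ (p - 4) = A at *
  have : min 1 (p-1) * (‖ξ‖ ^ 2 * ‖η‖ ^ 2) ≤ ‖ξ‖ ^ 2 * ‖η‖ ^ 2 + (p - 2) * ⟪ξ, η⟫ ^ 2 := by
    rcases le_total p 2 with h | h
    · have := min_le_right 1 (p-1)
      nlinarith [mul_nonneg (sq_nonneg ‖ξ‖) (sq_nonneg ‖η‖)]
    · have := min_le_left 1 (p-1)
      nlinarith [mul_nonneg (sq_nonneg ‖ξ‖) (sq_nonneg ‖η‖), sq_nonneg ⟪ξ, η⟫]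
  nlinarith

theorem seg_norm {d : ℕ} {δ M : ℝ} {a b x : Eu d} (h1 : 2 * δ ≤ ‖a‖) (h2 : ‖b - a‖ < δ) (h3 : ‖a‖ ≤ M) (h4 : ‖b‖ ≤ M)
    (hx : x ∈ segment ℝ a b) : δ ≤ ‖x‖ ∧ ‖x‖ ≤ M := by
  have hδ : 0 < δ := lt_of_le_of_lt (norm_nonneg _) h2
  constructor
  · have : x ∈ ball a δ := (convex_ball a δ).segment_subset (mem_ball_self hδ) (by rwa [mem_ball, dist_eq_norm]) hx
    rw [mem_ball, dist_eq_norm] at this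
    have := norm_sub_norm_le a x
    rw [norm_sub_rev] at this; linarith
  · have : x ∈ closedBall (0 : Eu d) M := (convex_closedBall _ _).segment_subset (by simpa using h3) (by simpa using h4) hx
    simpa using this

theorem Fp_loc {d : ℕ} {p : ℝ} (hp : 1 < p) {δ M : ℝ} (hδ : 0 < δ) (hδM : δ ≤ M) : ∃ c C : ℝ, 0 < c ∧ 0 ≤ C ∧ ∀ a b : Eu d, 2 * δ ≤ ‖a‖ → ‖b - a‖ < δ → ‖a‖ ≤ M → ‖b‖ ≤ M →
    ‖Fp p b - Fp p a‖ ≤ C * ‖b - a‖ ∧ c * ‖b - a‖ ^ 2 ≤ ⟪Fp p b - Fp p a, b - a⟫ := by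
  have hM : 0 < M := hδ.trans_le hδM
  set K : Set (Eu d) := closedBall 0 M \ ball 0 δ with hK
  have hKc : IsCompact K := (isCompact_closedBall _ _).diff isOpen_ball
  have hKm : ∀ x : Eu d, δ ≤ ‖x‖ ∧ ‖x‖ ≤ M → x ∈ K := by
    intro x hx; simp [hK]; exact ⟨hx.2, hx.1⟩
  have hK0 : K ⊆ {0}ᶜ := by
    intro x hx h; simp at h; subst h; simp [hK] at hx; linarith [hx.2]
  obtain ⟨C, hC⟩ := hKc.exists_bound_of_continuousOn ((DF_contOn p).mono hK0)
  set c0 := min (δ ^ (p - 2)) (M ^ (p - 2)) with hc0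
  have hc0p : 0 < c0 := lt_min (by positivity) (by positivity)
  have hc0l : ∀ x : Eu d, δ ≤ ‖x‖ ∧ ‖x‖ ≤ M → c0 ≤ ‖x‖ ^ (p - 2) := by
    intro x hx
    rcases le_total p 2 with h | h
    · exact (min_le_right _ _).trans (Real.rpow_le_rpow_of_nonpos (by linarith) hx.2 (by linarith))
    · exact (min_le_left _ _).trans (Real.rpow_le_rpow hδ.le hx.1 (by linarith))
  refine ⟨min 1 (p-1) * c0, max C 0, mul_pos (lt_min one_pos (by linarith)) hc0p, le_max_right _ _, ?_⟩
  intro a b h1 h2 h3 h4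
  have hs := fun x hx => seg_norm (x := x) h1 h2 h3 h4 hx
  constructor
  · refine (Convex.norm_image_sub_le_of_norm_hasFDerivWithin_le (s := segment ℝ a b) (f' := DF p) (C := C) ?_ ?_ (convex_segment _ _) (left_mem_segment _ _ _) (right_mem_segment _ _ _)).trans ?_
    · intro x hx
      exact (Fp_hasFDerivAt p (hK0 (hKm x (hs x hx)))).hasFDerivWithinAt
    · intro x hx
      exact hC x (hKm x (hs x hx))
    · gcongr; exact le_max_left _ _
  · set g : ℝ → ℝ := fun t => ⟪Fp p (a + t • (b - a)), b - a⟫ with hg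
    have hseg : ∀ t ∈ Icc (0:ℝ) 1, a + t • (b - a) ∈ segment ℝ a b := by
      intro t ht; rw [segment_eq_image']; exact ⟨t, ht, rfl⟩
    have hd : ∀ t ∈ Icc (0:ℝ) 1, HasDerivAt g ⟪DF p (a + t • (b - a)) (b - a), b - a⟫ t := by
      intro t ht
      have e1 : HasDerivAt (fun t : ℝ => a + t • (b - a)) (b - a) t := by
        simpa using ((hasDerivAt_id t).smul_const (b - a)).const_add a
      have e2 := (Fp_hasFDerivAt p (hK0 (hKm _ (hs _ (hseg t ht))))).comp_hasDerivAt t e1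
      simpa using e2.inner ℝ (hasDerivAt_const t (b - a))
    have := Convex.mul_sub_le_image_sub_of_le_deriv (convex_Icc (0:ℝ) 1) (f := g) (fun t ht => (hd t ht).continuousAt.continuousWithinAt)
      (fun t ht => (hd t (interior_subset ht)).differentiableAt.differentiableWithinAt) (C := min 1 (p-1) * c0 * ‖b - a‖^2) ?_ 0 (by simp) 1 (by simp) zero_le_one
    · simpa [hg, inner_sub_left] using this
    · intro t ht
      have ht' := interior_subset ht
      rw [(hd t ht').deriv]
      refine le_trans ?_ (DF_coer hp (hK0 (hKm _ (hs _ (hseg t ht')))) _)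
      have := hc0l _ (hs _ (hseg t ht'))
      have : 0 ≤ min 1 (p-1) := le_min one_pos.le (by linarith)
      gcongr
end part3

section part4
open scoped RealInnerProductSpace ContDiff Convolution Topology
open MeasureTheory Filter Set Metric

theorem cs_int {d : ℕ} {F : Type*} [NormedAddCommGroup F] {f : Eu d → ℝ} {g : Eu d → F} (hf : Continuous f)
    (hc : HasCompactSupport g) (h0 : ∀ x, g x = 0 → f x = 0) : Integrable f :=
  hf.integrable_of_hasCompactSupport (hc.mono fun x hx h => hx (h0 x h))

theorem lip_ball {d : ℕ} {f : Eu d → ℝ} (hf : ContDiff ℝ 1 f) (R : ℝ) : ∃ L, 0 ≤ L ∧ ∀ x ∈ closedBall (0 : Eu d) R, ∀ y ∈ closedBall (0 : Eu d) R,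
    |f x - f y| ≤ L * ‖x - y‖ := by
  obtain ⟨C, hC⟩ := (isCompact_closedBall (0 : Eu d) R).exists_bound_of_continuousOn (hf.continuous_fderiv one_ne_zero).continuousOn
  refine ⟨max C 0, le_max_right _ _, fun x hx y hy => ?_⟩
  refine (Convex.norm_image_sub_le_of_norm_fderiv_le (fun z _ => hf.differentiable one_ne_zero z) (fun z hz => (hC z hz).trans (le_max_left _ _)) (convex_closedBall _ _) hy hx)

set_option maxHeartbeats 1000000 in
theorem DQ {d : ℕ} {p q : ℝ} (hp : 1 < p) {u : Eu d → ℝ} (hu : ContDiff ℝ 1 u) (hpos : ∀ x, 0 < u x)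
    (hw : Weak1 p q u) {χ : Eu d → ℝ} (hχ : ContDiff ℝ 1 χ) (hχc : HasCompactSupport χ)
    (hχs : tsupport χ ⊆ {x | gradient u x ≠ 0}) :
    ∃ C h0 : ℝ, 0 ≤ C ∧ 0 < h0 ∧ ∀ h : Eu d, ‖h‖ < h0 →
      ∫ x, χ x ^ 2 * ‖gradient u (x + h) - gradient u x‖ ^ 2 ≤ C * ‖h‖ ^ 2 := by
  have hgc := grad_cont hu
  obtain ⟨δ, hδ, hKδ⟩ : ∃ δ : ℝ, 0 < δ ∧ ∀ x ∈ tsupport χ, 2 * δ ≤ ‖gradient u x‖ := by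
    obtain ⟨a, ha, h⟩ := hχc.isCompact.exists_forall_le' (f := fun x => ‖gradient u x‖) hgc.norm.continuousOn (a := 0) (fun x hx => norm_pos_iff.2 (hχs hx))
    exact ⟨a / 2, by positivity, fun x hx => by linarith [h x hx]⟩
  obtain ⟨R, hR⟩ := hχc.isCompact.isBounded.subset_closedBall (0 : Eu d)
  have hB := isCompact_closedBall (0 : Eu d) (R + 1)
  have hin : ∀ x ∈ tsupport χ, ∀ h : Eu d, ‖h‖ ≤ 1 → x + h ∈ closedBall (0 : Eu d) (R + 1) := by
    intro x hx h hh
    have := hR hx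
    simp only [mem_closedBall, dist_zero_right] at *
    linarith [norm_add_le x h]
  have hin0 : ∀ x ∈ tsupport χ, x ∈ closedBall (0 : Eu d) (R + 1) := by
    intro x hx; simpa using hin x hx 0 (by simp)
  obtain ⟨M0, hM0⟩ := hB.exists_bound_of_continuousOn hgc.continuousOn
  obtain ⟨M, hM, hδM⟩ : ∃ M, (∀ x ∈ closedBall (0 : Eu d) (R + 1), ‖gradient u x‖ ≤ M) ∧ δ ≤ M :=
    ⟨max M0 δ, fun x hx => (hM0 x hx).trans (le_max_left _ _), le_max_right _ _⟩
  obtain ⟨c, C1, hc, hC1, hFp⟩ := Fp_loc (d := d) hp hδ hδM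
  obtain ⟨h1, hh1, hunif⟩ := Metric.uniformContinuousOn_iff.1 (hB.uniformContinuousOn_of_continuous hgc.continuousOn) δ hδ
  obtain ⟨Lu, hLu, hLip⟩ := lip_ball hu (R + 1)
  have huq : ContDiff ℝ 1 (fun x => u x ^ q) := hu.rpow_const_of_ne (fun x => (hpos x).ne')
  obtain ⟨Lq, hLq, hLipq⟩ := lip_ball huq (R + 1)
  set I1 := ∫ x, χ x ^ 2
  set I2 := ∫ x, ‖fderiv ℝ χ x‖ ^ 2
  have hfc : HasCompactSupport (fderiv ℝ χ) := hχc.fderiv ℝ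
  have hfcont := hχ.continuous_fderiv one_ne_zero
  have ii1 : Integrable (fun x => χ x ^ 2) :=
    cs_int (hχ.continuous.pow 2) hχc (fun x h => by rw [h]; simp)
  have ii2 : Integrable (fun x => ‖fderiv ℝ χ x‖ ^ 2) :=
    cs_int (hfcont.norm.pow 2) hfc (fun x h => by rw [h]; simp)
  have hI1 : 0 ≤ I1 := integral_nonneg fun x => by positivity
  have hI2 : 0 ≤ I2 := integral_nonneg fun x => by positivity
  refine ⟨2 / c * (Lq * Lu * I1 + 2 * (Lu * C1) ^ 2 / c * I2), min h1 1, by positivity, lt_min hh1 one_pos, ?_⟩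
  intro h hh
  have hh' : ‖h‖ < h1 := hh.trans_le (min_le_left _ _)
  have hh1' : ‖h‖ ≤ 1 := hh.le.trans (min_le_right _ _)
  set V : Eu d → Eu d := fun x => Fp p (gradient u x) with hV
  have hVc : Continuous V := (Fp_cont hp).comp hgc
  set φ : Eu d → ℝ := fun x => χ x ^ 2 * (u (x + h) - u x) with hφ
  have hus : ContDiff ℝ 1 (fun x => u (x + h)) := hu.comp (contDiff_id.add contDiff_const)
  have hφd : ContDiff ℝ 1 φ := (hχ.pow 2).mul (hus.sub hu)
  have hφc : HasCompactSupport φ := (hχc.comp_left (g := fun t : ℝ => t ^ 2) (by simp)).mul_right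
  have w1 := hw φ hφd hφc
  have hφs : ContDiff ℝ 1 (fun x => φ (x - h)) := hφd.comp (contDiff_id.sub contDiff_const)
  have hφsc : HasCompactSupport (fun x => φ (x - h)) := by
    have := hφc.comp_homeomorph (Homeomorph.addRight (-h))
    simpa [Function.comp_def, sub_eq_add_neg] using this
  have w2 := hw _ hφs hφsc
  have fds : ∀ x, gradient (fun x => φ (x - h)) x = gradient φ (x - h) := by
    intro x; unfold gradient; rw [show (fun x => φ (x - h)) = fun x => φ (x + -h) from by simp [sub_eq_add_neg], fderiv_comp_add_right, sub_eq_add_neg]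
  simp only [fds] at w2
  rw [← integral_add_right_eq_self _ h, ← integral_add_right_eq_self (fun x => u x ^ q * φ (x - h)) h] at w2
  simp only [add_sub_cancel_right] at w2
  have hgφ : Continuous (gradient φ) := grad_cont hφd
  have hgφc : HasCompactSupport (gradient φ) := by
    have := (hφc.fderiv ℝ).comp_left (g := (InnerProductSpace.toDual ℝ (Eu d)).symm) (by simp)
    exact this
  have hVs : Continuous (fun x => V (x + h)) := hVc.comp (continuous_id.add continuous_const)
  have i1 : Integrable (fun x => ⟪V x, gradient φ x⟫) := by
    apply (hVc.inner hgφ).integrable_of_hasCompactSupport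
    exact hgφc.mono (fun x hx h => hx (by simp [h]))
  have i2 : Integrable (fun x => ⟪V (x + h), gradient φ x⟫) := by
    apply (hVs.inner hgφ).integrable_of_hasCompactSupport
    exact hgφc.mono (fun x hx h => hx (by simp [h]))
  have i3 : Integrable (fun x => u x ^ q * φ x) := by
    apply (huq.continuous.mul hφd.continuous).integrable_of_hasCompactSupport hφc.mul_left
  have i4 : Integrable (fun x => u (x + h) ^ q * φ x) := by
    apply Continuous.integrable_of_hasCompactSupport _ hφc.mul_left
    exact (huq.continuous.comp (continuous_id.add continuous_const)).mul hφd.continuous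
  have w3 : ∫ x, ⟪V (x + h) - V x, gradient φ x⟫ = ∫ x, (u (x + h) ^ q - u x ^ q) * φ x := by
    simp only [inner_sub_left, sub_mul]
    rw [integral_sub i2 i1, integral_sub i4 i3, ← w1, ← w2]
  have i5 : Integrable (fun x => ⟪V (x + h) - V x, gradient φ x⟫) := by
    simp only [inner_sub_left]; exact i2.sub i1
  have i6 : Integrable (fun x => (u (x + h) ^ q - u x ^ q) * φ x) := by
    simp only [sub_mul]; exact i4.sub i3
  have pw : ∀ x, c / 2 * (χ x ^ 2 * ‖gradient u (x + h) - gradient u x‖ ^ 2) ≤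
      ⟪V (x + h) - V x, gradient φ x⟫ + 2 * (Lu * C1) ^ 2 / c * ‖h‖ ^ 2 * ‖fderiv ℝ χ x‖ ^ 2 := by
    intro x
    have hfd : ⟪V (x + h) - V x, gradient φ x⟫ = χ x ^ 2 * ⟪V (x + h) - V x, gradient u (x + h) - gradient u x⟫ +
        2 * χ x * (u (x + h) - u x) * fderiv ℝ χ x (V (x + h) - V x) := by
      have e1 : HasFDerivAt χ (fderiv ℝ χ x) x := (hχ.differentiable one_ne_zero x).hasFDerivAt
      have e2 : HasFDerivAt u (fderiv ℝ u x) x := (hu.differentiable one_ne_zero x).hasFDerivAt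
      have e3 : HasFDerivAt (fun y => u (y + h)) (fderiv ℝ u (x + h)) x := by
        rw [hasFDerivAt_comp_add_right]
        exact (hu.differentiable one_ne_zero (x + h)).hasFDerivAt
      have e4 := (e1.pow 2).mul (e3.sub e2)
      have e5 : fderiv ℝ φ x = _ := e4.fderiv
      rw [inner_grad, inner_sub_right, inner_grad, inner_grad, e5]
      simp
      ring
    by_cases hx : x ∈ tsupport χ
    · have hd : ‖gradient u (x + h) - gradient u x‖ < δ := by
        rw [← dist_eq_norm]; exact hunif _ (hin x hx h hh1') _ (hin0 x hx) (by simpa [dist_eq_norm] using hh')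
      obtain ⟨f1, f2⟩ := hFp _ _ (hKδ x hx) hd (hM _ (hin0 x hx)) (hM _ (hin x hx h hh1'))
      have f3 := hLip _ (hin x hx h hh1') _ (hin0 x hx)
      rw [add_sub_cancel_left] at f3
      have f4 := (fderiv ℝ χ x).le_opNorm (V (x + h) - V x)
      rw [Real.norm_eq_abs] at f4
      rw [hfd]
      set D := ‖gradient u (x + h) - gradient u x‖ with hD
      set W := ⟪V (x + h) - V x, gradient u (x + h) - gradient u x⟫ with hW
      have f5 : |(u (x + h) - u x) * fderiv ℝ χ x (V (x + h) - V x)| ≤ (Lu * ‖h‖) * (‖fderiv ℝ χ x‖ * (C1 * D)) := by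
        rw [abs_mul]
        apply mul_le_mul f3 (f4.trans _) (abs_nonneg _) (by positivity)
        gcongr
      set E := (u (x + h) - u x) * fderiv ℝ χ x (V (x + h) - V x) with hE
      set F := ‖fderiv ℝ χ x‖
      have f6 : -(|χ x| * ((Lu * ‖h‖) * (F * (C1 * D)))) ≤ χ x * E := by
        have : |χ x * E| ≤ |χ x| * ((Lu * ‖h‖) * (F * (C1 * D))) := by
          rw [abs_mul]; gcongr
        linarith [neg_abs_le (χ x * E)]
      have f7 : χ x ^ 2 * (c * D ^ 2) ≤ χ x ^ 2 * W := by gcongr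
      have f8 : 2 * (|χ x| * ((Lu * ‖h‖) * (F * (C1 * D)))) ≤ c / 2 * (χ x ^ 2 * D ^ 2) + 2 * (Lu * C1) ^ 2 / c * ‖h‖ ^ 2 * F ^ 2 := by
        rw [← sq_abs (χ x)]
        have : 0 ≤ (c * (|χ x| * D) - 2 * (Lu * C1 * ‖h‖ * F)) ^ 2 / (2 * c) := by positivity
        have e : (c * (|χ x| * D) - 2 * (Lu * C1 * ‖h‖ * F)) ^ 2 / (2 * c) = c / 2 * (|χ x| ^ 2 * D ^ 2) + 2 * (Lu * C1) ^ 2 / c * ‖h‖ ^ 2 * F ^ 2 - 2 * (|χ x| * ((Lu * ‖h‖) * (F * (C1 * D)))) := by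
          field_simp; ring
        linarith
      have : 2 * χ x * (u (x + h) - u x) * fderiv ℝ χ x (V (x + h) - V x) = 2 * (χ x * E) := by rw [hE]; ring
      rw [this]; nlinarith
    · have : χ x = 0 := image_eq_zero_of_notMem_tsupport hx
      rw [hfd, this]; simp; positivity
  have pw2 : ∀ x, (u (x + h) ^ q - u x ^ q) * φ x ≤ Lq * Lu * ‖h‖ ^ 2 * χ x ^ 2 := by
    intro x
    by_cases hx : x ∈ tsupport χ
    · have f3 := hLip _ (hin x hx h hh1') _ (hin0 x hx)
      have f4 := hLipq _ (hin x hx h hh1') _ (hin0 x hx)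
      rw [add_sub_cancel_left] at f3 f4
      have : (u (x + h) ^ q - u x ^ q) * (u (x + h) - u x) ≤ (Lq * ‖h‖) * (Lu * ‖h‖) := by
        refine (le_abs_self _).trans ?_
        rw [abs_mul]
        exact mul_le_mul f4 f3 (abs_nonneg _) (by positivity)
      calc _ = χ x ^ 2 * ((u (x + h) ^ q - u x ^ q) * (u (x + h) - u x)) := by rw [hφ]; ring
        _ ≤ χ x ^ 2 * ((Lq * ‖h‖) * (Lu * ‖h‖)) := by gcongr
        _ = _ := by ring
    · have : χ x = 0 := image_eq_zero_of_notMem_tsupport hx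
      simp [hφ, this]
  have i7 : Integrable (fun x => χ x ^ 2 * ‖gradient u (x + h) - gradient u x‖ ^ 2) := by
    apply Continuous.integrable_of_hasCompactSupport
    · exact (hχ.continuous.pow 2).mul (((hgc.comp (continuous_id.add continuous_const)).sub hgc).norm.pow 2)
    · exact (hχc.comp_left (g := fun t : ℝ => t ^ 2) (by simp)).mul_right
  have s1 := integral_mono (i7.const_mul (c / 2)) (i5.add (ii2.const_mul (2 * (Lu * C1) ^ 2 / c * ‖h‖ ^ 2))) pw
  have s2 := integral_mono i6 (ii1.const_mul (Lq * Lu * ‖h‖ ^ 2)) pw2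
  simp only [Pi.add_apply] at s1
  rw [integral_const_mul, integral_add i5 (ii2.const_mul _), integral_const_mul, w3] at s1
  rw [integral_const_mul] at s2
  set J := ∫ x, χ x ^ 2 * ‖gradient u (x + h) - gradient u x‖ ^ 2
  have : c / 2 * J ≤ (Lq * Lu * I1 + 2 * (Lu * C1) ^ 2 / c * I2) * ‖h‖ ^ 2 := by
    nlinarith
  calc J = 2 / c * (c / 2 * J) := by field_simp
    _ ≤ 2 / c * ((Lq * Lu * I1 + 2 * (Lu * C1) ^ 2 / c * I2) * ‖h‖ ^ 2) := by gcongr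
    _ = _ := by ring
end part4

section part5
open scoped RealInnerProductSpace ContDiff Convolution Topology
open MeasureTheory Filter Set Metric

theorem int_fderiv_zero {d : ℕ} {f : Eu d → ℝ} (hf : ContDiff ℝ 1 f) (hc : HasCompactSupport f) (v : Eu d) :
    ∫ x, fderiv ℝ f x v = 0 := by
  have hfc := hf.continuous_fderiv one_ne_zero
  have h := integral_mul_fderiv_eq_neg_fderiv_mul_of_integrable (μ := (volume : Measure (Eu d))) (f := fun _ => (1:ℝ)) (g := f) (v := v)
    (by simp) ?_ ?_ (by simp) (fun x _ => hf.differentiable one_ne_zero x)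
  · simpa using h
  · refine cs_int (continuous_const.mul (hfc.clm_apply continuous_const)) (hc.fderiv ℝ) (fun x h => by simp [h])
  · exact cs_int (continuous_const.mul hf.continuous) hc (fun x h => by simp [h])

theorem cs_weight {d : ℕ} {w f : Eu d → ℝ} (hw : Continuous w) (hc : HasCompactSupport w) (h0 : ∀ x, 0 ≤ w x)
    (hf : Continuous f) : (∫ x, w x * f x) ^ 2 ≤ (∫ x, w x) * ∫ x, w x * f x ^ 2 := by
  have i1 : Integrable w := cs_int hw hc (fun x h => h)
  have i2 : Integrable (fun x => w x * f x) := cs_int (hw.mul hf) hc (fun x h => by simp [h])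
  have i3 : Integrable (fun x => w x * f x ^ 2) := cs_int (hw.mul (hf.pow 2)) hc (fun x h => by simp [h])
  have := discrim_le_zero (a := ∫ x, w x) (b := -2 * ∫ x, w x * f x) (c := ∫ x, w x * f x ^ 2) (fun t => ?_)
  · unfold discrim at this; nlinarith
  · have e : (∫ x, w x) * (t * t) + (-2 * ∫ x, w x * f x) * t + ∫ x, w x * f x ^ 2 = ∫ x, w x * (f x - t) ^ 2 := by
      have e1 : (fun x => w x * (f x - t) ^ 2) = fun x => (w x * (t * t) + (w x * f x) * (-2 * t)) + w x * f x ^ 2 := by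
        funext x; ring
      rw [e1, integral_add ((i1.mul_const _).fun_add (i2.mul_const _)) i3, integral_add (i1.mul_const _) (i2.mul_const _),
        integral_mul_const, integral_mul_const]; ring
    rw [e]; exact integral_nonneg fun x => mul_nonneg (h0 x) (sq_nonneg _)

theorem cs_int' {d : ℕ} {E F : Type*} [NormedAddCommGroup F] [NormedAddCommGroup E] {f : Eu d → E} {g : Eu d → F} (hf : Continuous f)
    (hc : HasCompactSupport g) (h0 : ∀ x, g x = 0 → f x = 0) : Integrable f :=
  hf.integrable_of_hasCompactSupport (hc.mono fun x hx h => hx (h0 x h))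

theorem grad_mol {d : ℕ} {ρ u : Eu d → ℝ} (hρ : Continuous ρ) (hc : HasCompactSupport ρ) (hu : ContDiff ℝ 1 u) :
    gradient (mol ρ u) = mol ρ (gradient u) := by
  funext x
  apply ext_inner_left ℝ
  intro v
  have hud := hu.continuous_fderiv one_ne_zero
  have hsub : Continuous fun z : Eu d => x - z := continuous_const.sub continuous_id
  rw [inner_grad, (mol_fderiv_right hρ hc hu x).fderiv]
  unfold mol
  rw [← integral_inner, ContinuousLinearMap.integral_apply]
  · congr 1; funext z
    rw [inner_smul_right, inner_grad]; simp
  · exact cs_int' (hρ.smul (hud.comp hsub)) hc (fun z h => by simp [h])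
  · exact cs_int' (hρ.smul ((grad_cont hu).comp hsub)) hc (fun z h => by simp [h])

theorem sum_single {d : ℕ} (L : Eu d →L[ℝ] ℝ) (w : Eu d) : ∑ i, L (EuclideanSpace.single i 1) * w i = L w := by
  conv_rhs => rw [← (EuclideanSpace.basisFun (Fin d) ℝ).sum_repr w]
  simp [mul_comm]

theorem div_formula {d : ℕ} {ρ : Eu d → ℝ} {g : Eu d → Eu d} (hρ : ContDiff ℝ ∞ ρ) (hc : HasCompactSupport ρ) (hg : Continuous g)
    (A : Eu d →L[ℝ] Eu d) (x : Eu d) :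
    ∑ i, (A (fderiv ℝ (mol ρ g) x (EuclideanSpace.single i 1))) i = ∫ z, fderiv ℝ ρ z (A (g (x - z))) := by
  have hsub : Continuous fun z : Eu d => x - z := continuous_const.sub continuous_id
  have hd : Continuous (fderiv ℝ ρ) := hρ.continuous_fderiv (by simp)
  have e : ∀ i : Fin d, (A (fderiv ℝ (mol ρ g) x (EuclideanSpace.single i 1))) i = ∫ z, fderiv ℝ ρ z (EuclideanSpace.single i 1) * (A (g (x - z))) i := by
    intro i
    rw [mol_fderiv_left hρ hc hg]
    have := ContinuousLinearMap.integral_comp_comm (μ := (volume : Measure (Eu d))) ((EuclideanSpace.proj (𝕜 := ℝ) i : Eu d →L[ℝ] ℝ).comp A) (φ := fun z => (fderiv ℝ ρ z (EuclideanSpace.single i 1)) • g (x - z))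
      (cs_int' ((hd.clm_apply continuous_const).smul (hg.comp hsub)) (hc.fderiv ℝ) (fun z h => by simp [h]))
    simpa using this.symm
  simp only [e]
  rw [← integral_finset_sum]
  · simp only [sum_single]
  · intro i _
    refine cs_int ((hd.clm_apply continuous_const).mul ?_) (hc.fderiv ℝ) (fun z h => by simp [h])
    exact (EuclideanSpace.proj (𝕜 := ℝ) i).continuous.comp (A.continuous.comp (hg.comp hsub))

theorem weak_at {d : ℕ} {p q : ℝ} {u : Eu d → ℝ} (hw : Weak1 p q u) {ρ : Eu d → ℝ} (hρ : ContDiff ℝ ∞ ρ) (hc : HasCompactSupport ρ) (x : Eu d) :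
    ∫ z, fderiv ℝ ρ z (Fp p (gradient u (x - z))) = - mol ρ (fun y => u y ^ q) x := by
  have h1 : ContDiff ℝ 1 (fun y => ρ (x - y)) := (hρ.of_le (by norm_cast)).comp (contDiff_const.sub contDiff_id)
  have h2 : HasCompactSupport (fun y => ρ (x - y)) := hc.comp_homeomorph (Homeomorph.subLeft x)
  have h := hw _ h1 h2
  have e : ∀ y, ⟪Fp p (gradient u y), gradient (fun y => ρ (x - y)) y⟫ = - fderiv ℝ ρ (x - y) (Fp p (gradient u y)) := by
    intro y
    rw [inner_grad]
    have := ((hρ.differentiable (by simp) (x - y)).hasFDerivAt).comp y ((hasFDerivAt_id y).const_sub x)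
    have e2 : fderiv ℝ (fun y => ρ (x - y)) y = _ := this.fderiv
    rw [e2]; simp
  simp only [e] at h
  rw [integral_neg] at h
  rw [← integral_sub_left_eq_self _ volume x] at h
  rw [← integral_sub_left_eq_self (fun y => u y ^ q * ρ (x - y)) volume x] at h
  simp only [sub_sub_cancel] at h
  unfold mol
  rw [← neg_eq_iff_eq_neg, h]
  congr 1; funext z; simp [mul_comm]

noncomputable def divF {d : ℕ} (p : ℝ) (U : Eu d → ℝ) (x : Eu d) : ℝ :=
  ∑ i, (DF p (gradient U x) (fderiv ℝ (gradient U) x (EuclideanSpace.single i 1))) i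

theorem divF_bound {d : ℕ} {p q : ℝ} (hp : 1 < p) {u : Eu d → ℝ} (hu : ContDiff ℝ 1 u) (hw : Weak1 p q u) {ρ : Eu d → ℝ} (hρ : ContDiff ℝ ∞ ρ) (hc : HasCompactSupport ρ) (x : Eu d)
    {om δ : ℝ} (hom : 0 ≤ om) (h0 : ∀ ξ ∈ ball (gradient u x) δ, ξ ≠ 0 ∧ ‖DF p (gradient (mol ρ u) x) - DF p ξ‖ ≤ om)
    (hδ : ∀ z ∈ tsupport ρ, gradient u (x - z) ∈ ball (gradient u x) δ) (hδ0 : 0 < δ) :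
    |divF p (mol ρ u) x + mol ρ (fun y => u y ^ q) x| ≤ om * ∫ z, ‖fderiv ℝ ρ z‖ * ‖gradient u (x - z) - gradient u x‖ := by
  have hgc := grad_cont hu
  have hsub : Continuous fun z : Eu d => x - z := continuous_const.sub continuous_id
  have hd : Continuous (fderiv ℝ ρ) := hρ.continuous_fderiv (by simp)
  have hdc : HasCompactSupport (fderiv ℝ ρ) := hc.fderiv ℝ
  set A := DF p (gradient (mol ρ u) x) with hA
  have e1 : divF p (mol ρ u) x = ∫ z, fderiv ℝ ρ z (A (gradient u (x - z))) := by
    unfold divF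
    rw [← hA, grad_mol hρ.continuous hc hu, div_formula hρ hc hgc]
  set B : Eu d → Eu d := fun ξ => A ξ - Fp p ξ with hB
  have hBc : Continuous B := A.continuous.sub (Fp_cont hp)
  have i1 : Integrable fun z => fderiv ℝ ρ z (A (gradient u (x - z))) :=
    cs_int (hd.clm_apply (A.continuous.comp (hgc.comp hsub))) hdc (fun z h => by simp [h])
  have i2 : Integrable fun z => fderiv ℝ ρ z (Fp p (gradient u (x - z))) :=
    cs_int (hd.clm_apply ((Fp_cont hp).comp (hgc.comp hsub))) hdc (fun z h => by simp [h])
  have i3 : Integrable fun z => fderiv ℝ ρ z (B (gradient u (x - z))) :=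
    cs_int (hd.clm_apply (hBc.comp (hgc.comp hsub))) hdc (fun z h => by simp [h])
  have i4 : Integrable fun z => fderiv ℝ ρ z (B (gradient u x)) :=
    cs_int (hd.clm_apply continuous_const) hdc (fun z h => by simp [h])
  have e2 : divF p (mol ρ u) x + mol ρ (fun y => u y ^ q) x = ∫ z, fderiv ℝ ρ z (B (gradient u (x - z)) - B (gradient u x)) := by
    rw [← sub_neg_eq_add, ← weak_at hw hρ hc x, e1, ← integral_sub i1 i2]
    simp only [map_sub]
    rw [integral_sub i3 i4, int_fderiv_zero (hρ.of_le (by norm_cast)) hc, sub_zero]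
    simp only [hB, map_sub]
  rw [e2, ← Real.norm_eq_abs, ← integral_const_mul]
  apply norm_integral_le_of_norm_le
  · exact (cs_int (hd.norm.mul ((hgc.comp hsub).sub continuous_const).norm) hdc (fun z h => by simp [h])).const_mul om
  · filter_upwards with z
    by_cases hz : z ∈ tsupport ρ
    · refine ((fderiv ℝ ρ z).le_opNorm _).trans ?_
      have : ‖B (gradient u (x - z)) - B (gradient u x)‖ ≤ om * ‖gradient u (x - z) - gradient u x‖ := by
        refine Convex.norm_image_sub_le_of_norm_hasFDerivWithin_le (s := ball (gradient u x) δ) (f' := fun ξ => A - DF p ξ) ?_ ?_ (convex_ball _ _) (mem_ball_self hδ0) (hδ z hz)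
        · intro ξ hξ
          exact (A.hasFDerivAt.sub (Fp_hasFDerivAt p (h0 ξ hξ).1)).hasFDerivWithinAt
        · intro ξ hξ; exact (h0 ξ hξ).2
      calc _ ≤ ‖fderiv ℝ ρ z‖ * (om * ‖gradient u (x - z) - gradient u x‖) := by gcongr
        _ = _ := by ring
    · have : fderiv ℝ ρ z = 0 := by
        by_contra h
        exact hz (support_fderiv_subset ℝ h)
      simp [this]
end part5

section part6
open scoped RealInnerProductSpace ContDiff Convolution Topology
open MeasureTheory Filter Set Metric

theorem small_sq {X κ : ℝ} (hX : 0 ≤ X) (hκ : 0 < κ) : ∃ s : ℝ, 0 < s ∧ 2 * s ^ 2 * X ≤ κ / 2 := by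
  refine ⟨Real.sqrt (κ / (4 * (X + 1))), Real.sqrt_pos.2 (by positivity), ?_⟩
  rw [Real.sq_sqrt (by positivity)]
  have : 2 * (κ / (4 * (X + 1))) * X = κ / 2 * (X / (X + 1)) := by field_simp; ring
  rw [this]
  have : X / (X + 1) ≤ 1 := by rw [div_le_one (by positivity)]; linarith
  nlinarith

theorem mol_pos {d : ℕ} {ρ u : Eu d → ℝ} (hρ : Continuous ρ) (hc : HasCompactSupport ρ) (h0 : ∀ x, 0 ≤ ρ x) (h1 : ∫ x, ρ x = 1)
    (hu : Continuous u) (hpos : ∀ x, 0 < u x) (x : Eu d) : 0 < mol ρ u x := by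
  have hsub : Continuous fun z : Eu d => x - z := continuous_const.sub continuous_id
  have hi : Integrable ρ := cs_int hρ hc (fun _ h => h)
  have a1 : 0 < ∫ x, ρ x := by rw [h1]; exact one_pos
  rw [integral_pos_iff_support_of_nonneg h0 hi] at a1
  unfold mol
  rw [integral_pos_iff_support_of_nonneg]
  · convert a1 using 2
    ext z; simp [(hpos (x - z)).ne']
  · intro z; exact mul_nonneg (h0 z) (hpos _).le
  · exact cs_int (hρ.mul (hu.comp hsub)) hc (fun z h => by simp [h])

theorem double_int {d : ℕ} {χ W : Eu d → ℝ} {g : Eu d → Eu d} (hχ : Continuous χ) (hχc : HasCompactSupport χ)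
    (hW : Continuous W) (hWc : HasCompactSupport W) (h0 : ∀ z, 0 ≤ W z) (hg : Continuous g) {c : ℝ}
    (hb : ∀ z, W z ≠ 0 → ∫ x, χ x ^ 2 * ‖g (x + -z) - g x‖ ^ 2 ≤ c) :
    Integrable (fun x => χ x ^ 2 * ∫ z, W z * ‖g (x - z) - g x‖ ^ 2) ∧
      ∫ x, χ x ^ 2 * (∫ z, W z * ‖g (x - z) - g x‖ ^ 2) ≤ (∫ z, W z) * c := by
  have hfc : Continuous (Function.uncurry fun x z : Eu d => χ x ^ 2 * (W z * ‖g (x - z) - g x‖ ^ 2)) := by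
    unfold Function.uncurry
    exact ((hχ.comp continuous_fst).pow 2).mul ((hW.comp continuous_snd).mul
      (((hg.comp (continuous_fst.sub continuous_snd)).sub (hg.comp continuous_fst)).norm.pow 2))
  have hcs : HasCompactSupport (Function.uncurry fun x z : Eu d => χ x ^ 2 * (W z * ‖g (x - z) - g x‖ ^ 2)) := by
    apply HasCompactSupport.intro (hχc.isCompact.prod hWc.isCompact)
    rintro ⟨x, z⟩ h
    simp only [mem_prod, not_and_or] at h
    simp only [Function.uncurry_apply_pair]
    rcases h with h | h
    · rw [image_eq_zero_of_notMem_tsupport h]; simp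
    · rw [image_eq_zero_of_notMem_tsupport h]; simp
  have hint : Integrable (Function.uncurry fun x z : Eu d => χ x ^ 2 * (W z * ‖g (x - z) - g x‖ ^ 2)) (volume.prod volume) :=
    hfc.integrable_of_hasCompactSupport hcs
  have h1 := hint.integral_prod_left
  have h2 := hint.integral_prod_right
  simp only [Function.uncurry_apply_pair, integral_const_mul] at h1 h2
  refine ⟨h1, ?_⟩
  have h3 := integral_integral_swap hint
  simp only [integral_const_mul] at h3
  rw [h3, ← integral_mul_const]
  refine integral_mono h2 ((cs_int hW hWc (fun _ h => h)).mul_const c) ?_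
  intro z
  have e : (∫ x, χ x ^ 2 * (W z * ‖g (x - z) - g x‖ ^ 2)) = W z * ∫ x, χ x ^ 2 * ‖g (x + -z) - g x‖ ^ 2 := by
    rw [← integral_const_mul]; congr 1; funext x; rw [sub_eq_add_neg x z]; ring
  simp only [e]
  by_cases hz : W z = 0
  · simp [hz]
  · exact mul_le_mul_of_nonneg_left (hb z hz) (h0 z)

set_option maxHeartbeats 1000000 in
theorem approx {d : ℕ} {p q : ℝ} (hp : 1 < p) {u : Eu d → ℝ} (hu : ContDiff ℝ 1 u) (hpos : ∀ x, 0 < u x)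
    (hw : Weak1 p q u) {χ : Eu d → ℝ} (hχ : ContDiff ℝ 1 χ) (hχc : HasCompactSupport χ)
    (hχs : tsupport χ ⊆ {x | gradient u x ≠ 0}) {B : Set (Eu d)} (hB : IsCompact B) {κ : ℝ} (hκ : 0 < κ) :
    ∃ U : Eu d → ℝ, ContDiff ℝ ∞ U ∧ (∀ x, 0 < U x) ∧ (∀ x ∈ B, |U x - u x| ≤ κ ∧ ‖gradient U x - gradient u x‖ ≤ κ) ∧
      Integrable (fun x => χ x ^ 2 * (divF p U x + U x ^ q) ^ 2) ∧
      ∫ x, χ x ^ 2 * (divF p U x + U x ^ q) ^ 2 ≤ κ := by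
  have hgc := grad_cont hu
  obtain ⟨C, h0, hC, hh0, hDQ⟩ := DQ hp hu hpos hw hχ hχc hχs
  obtain ⟨C0, hC0, hmoll⟩ := moll_exists d
  obtain ⟨δ, hδ, hKδ⟩ : ∃ δ : ℝ, 0 < δ ∧ ∀ x ∈ tsupport χ, 2 * δ ≤ ‖gradient u x‖ := by
    obtain ⟨a, ha, h⟩ := hχc.isCompact.exists_forall_le' (f := fun x => ‖gradient u x‖) hgc.norm.continuousOn (a := 0) (fun x hx => norm_pos_iff.2 (hχs hx))
    exact ⟨a / 2, by positivity, fun x hx => by linarith [h x hx]⟩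
  obtain ⟨R, hR⟩ := (hB.union hχc.isCompact).isBounded.subset_closedBall (0 : Eu d)
  have hBb := isCompact_closedBall (0 : Eu d) (R + 1)
  obtain ⟨M, hM⟩ := hBb.exists_bound_of_continuousOn hgc.continuousOn
  obtain ⟨m, hm, hmu⟩ := hBb.exists_forall_le' (f := u) hu.continuous.continuousOn (a := 0) (fun x _ => hpos x)
  obtain ⟨Mu, hMu⟩ := hBb.exists_bound_of_continuousOn hu.continuous.continuousOn
  set I := ∫ x, χ x ^ 2 with hI
  have hI0 : 0 ≤ I := integral_nonneg fun x => by positivity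
  have iχ : Integrable (fun x => χ x ^ 2) :=
    cs_int (hχ.continuous.pow 2) hχc (fun x h => by rw [h]; simp)
  obtain ⟨om, hom, hom2⟩ := small_sq (X := C * C0 ^ 2) (by positivity) hκ
  obtain ⟨e, he, he2⟩ := small_sq hI0 hκ
  -- DF uniform continuity
  set K : Set (Eu d) := closedBall 0 (M + δ) \ ball 0 δ with hK
  have hKc : IsCompact K := (isCompact_closedBall _ _).diff isOpen_ball
  have hKm : ∀ x : Eu d, δ ≤ ‖x‖ → ‖x‖ ≤ M + δ → x ∈ K := by
    intro x h1 h2; simp [hK]; exact ⟨h2, h1⟩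
  have hK0 : K ⊆ {0}ᶜ := by
    intro x hx h; simp at h; subst h; simp [hK] at hx; linarith [hx.2]
  obtain ⟨δ', hδ', hDFu⟩ := Metric.uniformContinuousOn_iff.1 (hKc.uniformContinuousOn_of_continuous ((DF_contOn p).mono hK0)) om hom
  set δ1 := min (δ' / 2) δ with hδ1
  have hδ1p : 0 < δ1 := lt_min (by positivity) hδ
  obtain ⟨ε1, hε1, hu1⟩ := Metric.uniformContinuousOn_iff.1 (hBb.uniformContinuousOn_of_continuous hgc.continuousOn) (min (δ1 / 2) κ) (lt_min (by positivity) hκ)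
  -- power
  have hpw : ContinuousOn (fun t : ℝ => t ^ q) (Icc (m / 2) (Mu + 1)) := by
    intro t ht
    exact (Real.continuousAt_rpow_const t q (Or.inl (by have := ht.1; linarith))).continuousWithinAt
  obtain ⟨e', he', hpu⟩ := Metric.uniformContinuousOn_iff.1 (isCompact_Icc.uniformContinuousOn_of_continuous hpw) (e / 2) (by positivity)
  set e1 := min (min (m / 2) 1) (min (e' / 2) κ) with he1
  have he1p : 0 < e1 := lt_min (lt_min (by positivity) one_pos) (lt_min (by positivity) hκ)
  obtain ⟨ε2, hε2, hu2⟩ := Metric.uniformContinuousOn_iff.1 (hBb.uniformContinuousOn_of_continuous hu.continuous.continuousOn) e1 he1p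
  have huq : ContDiff ℝ 1 (fun x => u x ^ q) := hu.rpow_const_of_ne (fun x => (hpos x).ne')
  obtain ⟨ε3, hε3, hu3⟩ := Metric.uniformContinuousOn_iff.1 (hBb.uniformContinuousOn_of_continuous huq.continuous.continuousOn) (e / 2) (by positivity)
  set ε := min (min ε1 ε2) (min (min ε3 h0) 1) / 2 with hε
  have hmpos : 0 < min (min ε1 ε2) (min (min ε3 h0) 1) := lt_min (lt_min hε1 hε2) (lt_min (lt_min hε3 hh0) one_pos)
  have hεp : 0 < ε := by positivity
  have hlt : ε < min (min ε1 ε2) (min (min ε3 h0) 1) := by rw [hε]; linarith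
  simp only [lt_min_iff] at hlt
  obtain ⟨⟨l1, l2⟩, ⟨l3, l4⟩, l5⟩ := hlt
  obtain ⟨ρ, hρ, hρ0, hρs, hρc, hρ1, hρW⟩ := hmoll ε hεp
  have hρts : ∀ z ∈ tsupport ρ, ‖z‖ ≤ ε := by
    intro z hz
    have : z ∈ closedBall (0 : Eu d) ε := closure_minimal (hρs.trans ball_subset_closedBall) isClosed_closedBall hz
    simpa using this
  have hin0 : ∀ x, x ∈ B ∨ x ∈ tsupport χ → x ∈ closedBall (0 : Eu d) (R + 1) := by
    intro x hx; exact closedBall_subset_closedBall (by linarith) (hR hx)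
  have hin : ∀ x, x ∈ B ∨ x ∈ tsupport χ → ∀ y, dist y x ≤ ε → y ∈ closedBall (0 : Eu d) (R + 1) := by
    intro x hx y hy
    have h1 := hR hx
    simp only [mem_closedBall] at h1 ⊢
    linarith [dist_triangle y x 0]
  set U := mol ρ u with hU
  have hUs : ContDiff ℝ ∞ U := mol_smooth hρ hρc hu.continuous
  have hUg : gradient U = mol ρ (gradient u) := grad_mol hρ.continuous hρc hu
  have hUgs : ContDiff ℝ ∞ (gradient U) := by rw [hUg]; exact mol_smooth hρ hρc hgc
  have hUp : ∀ x, 0 < U x := mol_pos hρ.continuous hρc hρ0 hρ1 hu.continuous hpos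
  have d1 : ∀ x, x ∈ B ∨ x ∈ tsupport χ → |U x - u x| ≤ e1 := by
    intro x hx
    rw [← Real.dist_eq]
    apply mol_dist he1p.le hρ0 hρs hρ1 hu.continuous
    intro y hy; rw [mem_ball] at hy
    exact (hu2 _ (hin x hx y hy.le) _ (hin0 x hx) (hy.trans l2)).le
  have d2 : ∀ x, x ∈ B ∨ x ∈ tsupport χ → ‖gradient U x - gradient u x‖ ≤ min (δ1 / 2) κ := by
    intro x hx
    rw [← dist_eq_norm, hUg]
    apply mol_dist (by positivity) hρ0 hρs hρ1 hgc
    intro y hy; rw [mem_ball] at hy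
    exact (hu1 _ (hin x hx y hy.le) _ (hin0 x hx) (hy.trans l1)).le
  have d3 : ∀ x, x ∈ B ∨ x ∈ tsupport χ → |mol ρ (fun y => u y ^ q) x - u x ^ q| ≤ e / 2 := by
    intro x hx
    rw [← Real.dist_eq]
    apply mol_dist (by positivity) hρ0 hρs hρ1 huq.continuous
    intro y hy; rw [mem_ball] at hy
    exact (hu3 _ (hin x hx y hy.le) _ (hin0 x hx) (hy.trans l3)).le
  have ballK : ∀ x ∈ tsupport χ, ∀ ξ ∈ ball (gradient u x) δ1, ξ ∈ K := by
    intro x hx ξ hξ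
    rw [mem_ball, dist_eq_norm] at hξ
    have a1 := hKδ x hx
    have a2 := hM x (hin0 x (Or.inr hx))
    have a3 : δ1 ≤ δ := min_le_right _ _
    have a4 := norm_sub_norm_le (gradient u x) ξ
    have a5 := norm_sub_norm_le ξ (gradient u x)
    rw [norm_sub_rev] at a4
    exact hKm _ (by linarith) (by linarith)
  have hUball : ∀ x ∈ tsupport χ, gradient U x ∈ ball (gradient u x) δ1 := by
    intro x hx
    rw [mem_ball, dist_eq_norm]
    linarith [(d2 x (Or.inr hx)).trans (min_le_left _ _)]
  have hUne : ∀ x ∈ tsupport χ, gradient U x ≠ 0 := fun x hx => hK0 (ballK x hx _ (hUball x hx))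
  have hd : Continuous (fderiv ℝ ρ) := hρ.continuous_fderiv (by simp)
  have hdc : HasCompactSupport (fderiv ℝ ρ) := hρc.fderiv ℝ
  have hdz : ∀ z, fderiv ℝ ρ z ≠ 0 → z ∈ tsupport ρ := fun z h => support_fderiv_subset ℝ h
  set W := ∫ z, ‖fderiv ℝ ρ z‖ with hW
  have hW0 : 0 ≤ W := integral_nonneg fun z => norm_nonneg _
  have key : ∀ x ∈ tsupport χ, (divF p U x + U x ^ q) ^ 2 ≤ 2 * om ^ 2 * W * (∫ z, ‖fderiv ℝ ρ z‖ * ‖gradient u (x - z) - gradient u x‖ ^ 2) + 2 * e ^ 2 := by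
    intro x hx
    have b1 := divF_bound hp hu hw hρ hρc x hom.le (δ := δ1) ?_ ?_ hδ1p
    · have hsub : Continuous fun z : Eu d => x - z := continuous_const.sub continuous_id
      have b2 := cs_weight hd.norm hdc.norm (fun z => norm_nonneg _) ((hgc.comp hsub).sub continuous_const).norm (f := fun z => ‖gradient u (x - z) - gradient u x‖)
      have b3 : |U x ^ q - u x ^ q| ≤ e / 2 := by
        have c1 := d1 x (Or.inr hx)
        have c2 : e1 ≤ m / 2 := (min_le_left _ _).trans (min_le_left _ _)
        have c3 : e1 ≤ 1 := (min_le_left _ _).trans (min_le_right _ _)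
        have c4 : e1 ≤ e' / 2 := (min_le_right _ _).trans (min_le_left _ _)
        have c5 := hmu x (hin0 x (Or.inr hx))
        have c6 := hMu x (hin0 x (Or.inr hx))
        rw [Real.norm_eq_abs, abs_of_pos (hpos x)] at c6
        have c7 := abs_le.1 c1
        have := hpu (U x) ⟨by linarith, by linarith⟩ (u x) ⟨by linarith, by linarith⟩ (by rw [Real.dist_eq]; linarith)
        rw [Real.dist_eq] at this; exact this.le
      have b4 := d3 x (Or.inr hx)
      rw [← hU] at b1
      set J := ∫ z, ‖fderiv ℝ ρ z‖ * ‖gradient u (x - z) - gradient u x‖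
      have hJ : 0 ≤ J := integral_nonneg fun z => by positivity
      have b5 : |divF p U x + U x ^ q| ≤ om * J + e := by
        have : divF p U x + U x ^ q = (divF p U x + mol ρ (fun y => u y ^ q) x) - (mol ρ (fun y => u y ^ q) x - u x ^ q) + (U x ^ q - u x ^ q) := by ring
        rw [this]
        refine (abs_add_le _ _).trans ?_
        have := abs_sub (divF p U x + mol ρ (fun y => u y ^ q) x) (mol ρ (fun y => u y ^ q) x - u x ^ q)
        linarith
      calc (divF p U x + U x ^ q) ^ 2 ≤ (om * J + e) ^ 2 := sq_le_sq' (by linarith [neg_le_of_abs_le b5]) (le_of_abs_le b5)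
        _ ≤ 2 * om ^ 2 * J ^ 2 + 2 * e ^ 2 := by nlinarith [sq_nonneg (om * J - e)]
        _ ≤ 2 * om ^ 2 * (W * ∫ z, ‖fderiv ℝ ρ z‖ * ‖gradient u (x - z) - gradient u x‖ ^ 2) + 2 * e ^ 2 := by
          gcongr
        _ = _ := by ring
    · intro ξ hξ
      refine ⟨hK0 (ballK x hx ξ hξ), ?_⟩
      rw [← dist_eq_norm]
      apply (hDFu _ (ballK x hx _ (hUball x hx)) _ (ballK x hx ξ hξ) _).le
      have a1 := hUball x hx
      have a3 : δ1 ≤ δ' / 2 := min_le_left _ _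
      rw [mem_ball] at a1 hξ
      rw [dist_comm] at hξ
      linarith [dist_triangle (gradient U x) (gradient u x) ξ]
    · intro z hz
      rw [mem_ball]
      have := hu1 (x - z) (hin x (Or.inr hx) _ (by simpa [dist_eq_norm] using hρts z hz)) x (hin0 x (Or.inr hx)) (by
        have := hρts z hz
        simp [dist_eq_norm]; linarith)
      have := this.trans_le (min_le_left _ _)
      linarith
  have hdbl := double_int (χ := χ) (W := fun z => ‖fderiv ℝ ρ z‖) (g := gradient u) hχ.continuous hχc hd.norm hdc.norm (fun z => norm_nonneg _) hgc (c := C * ε ^ 2) ?_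
  · refine ⟨U, hUs, hUp, ?_, ?_, ?_⟩
    · intro x hx
      exact ⟨(d1 x (Or.inl hx)).trans ((min_le_right _ _).trans (min_le_right _ _)), (d2 x (Or.inl hx)).trans (min_le_right _ _)⟩
    · refine cs_int (continuous_of_tsupport ?_) hχc (fun x h => by simp [h])
      intro x hx
      have hx' : x ∈ tsupport χ := by
        refine closure_mono ?_ hx
        intro y hy h; apply hy; simp [h]
      have hne := hUne x hx'
      refine (hχ.continuous.continuousAt.pow 2).mul (ContinuousAt.pow (ContinuousAt.add ?_ ?_) 2)
      · unfold divF
        refine tendsto_finset_sum _ fun i _ => ?_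
        refine (EuclideanSpace.proj (𝕜 := ℝ) i).continuous.continuousAt.comp (f := fun x => (DF p (gradient U x)) ((fderiv ℝ (gradient U) x) (EuclideanSpace.single i 1))) ?_
        refine ContinuousAt.clm_apply ?_ ?_
        · exact ContinuousAt.comp (f := gradient U) ((DF_contOn p).continuousAt (isOpen_compl_singleton.mem_nhds hne)) hUgs.continuous.continuousAt
        · exact ((hUgs.continuous_fderiv (by simp)).clm_apply continuous_const).continuousAt
      · exact hUs.continuous.continuousAt.rpow_const (Or.inl (hUp x).ne')
    · have hle : ∀ x, χ x ^ 2 * (divF p U x + U x ^ q) ^ 2 ≤ 2 * om ^ 2 * W * (χ x ^ 2 * ∫ z, ‖fderiv ℝ ρ z‖ * ‖gradient u (x - z) - gradient u x‖ ^ 2) + 2 * e ^ 2 * χ x ^ 2 := by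
        intro x
        by_cases hx : x ∈ tsupport χ
        · have := mul_le_mul_of_nonneg_left (key x hx) (sq_nonneg (χ x))
          linarith
        · rw [image_eq_zero_of_notMem_tsupport hx]; simp
      have := integral_mono_of_nonneg (μ := volume) (Eventually.of_forall fun x => by positivity) ((hdbl.1.const_mul (2 * om ^ 2 * W)).add (iχ.const_mul (2 * e ^ 2))) (Eventually.of_forall hle)
      refine this.trans ?_
      simp only [Pi.add_apply]
      rw [integral_add (hdbl.1.const_mul (2 * om ^ 2 * W)) (iχ.const_mul (2 * e ^ 2)), integral_const_mul, integral_const_mul]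
      have hWε : W * ε ≤ C0 := by rwa [le_div_iff₀ hεp] at hρW
      have : 2 * om ^ 2 * W * (W * (C * ε ^ 2)) ≤ 2 * om ^ 2 * (C * C0 ^ 2) := by
        have : (W * ε) ^ 2 ≤ C0 ^ 2 := by gcongr
        calc _ = 2 * om ^ 2 * (C * (W * ε) ^ 2) := by ring
          _ ≤ _ := by gcongr
      have := mul_le_mul_of_nonneg_left hdbl.2 (by positivity : 0 ≤ 2 * om ^ 2 * W)
      linarith
  · intro z hz
    have hz' := hρts z (hdz z (fun h => hz (by simp [h])))
    refine (hDQ (-z) (by rw [norm_neg]; linarith)).trans ?_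
    rw [norm_neg]; gcongr
end part6

section part7
open scoped RealInnerProductSpace ContDiff Convolution Topology
open MeasureTheory Filter Set Metric

theorem quad_low {A B x : ℝ} (hA : 0 ≤ A) (hB : 0 ≤ B) (h : x ^ 2 ≤ 4 * (A * B)) : -(A + B) ≤ x := by
  have : x ^ 2 ≤ (A + B) ^ 2 := by nlinarith [sq_nonneg (A - B)]
  exact (abs_le_of_sq_le_sq' this (by positivity)).1

theorem scal_id {p D t Θ y z η G γ g T h K2 H2 ac kc α m lam q : ℝ} (hp : 1 < p) (hD : 1 < D) (ht : 0 < t) (hy : 0 < y)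
    (hm : m = α + 2 * lam) (f r X s σ e : ℝ)
    (hf : f = Θ * T + 2 * ((p - 2) * Θ / (2 * t)) * (h * t)) (hr : f = -z + r) (hX : X = (p - 1) * Θ * h) (hs : s = Θ * t)
    (hσ : σ = lam * s / y) (he : e = X - σ - (f - σ) / D) :
    η ^ 2 * G * (Θ ^ 2 * H2 + 4 * Θ * ((p - 2) * Θ / (2 * t)) * K2 + 4 * ((p - 2) * Θ / (2 * t)) ^ 2 * (h * t) ^ 2 - f ^ 2)
    + ((2 * η * G) * Θ ^ 2 * kc + (2 * η * G) * (2 * Θ * ((p - 2) * Θ / (2 * t)) * (h * t) - f * Θ) * ac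
      + (α * η ^ 2 * G / y) * Θ ^ 2 * (h * t) + (α * η ^ 2 * G / y) * (2 * Θ * ((p - 2) * Θ / (2 * t)) * (h * t) - f * Θ) * t
      + (2 * η ^ 2 * (p * g / (2 * t))) * Θ ^ 2 * K2 + (2 * η ^ 2 * (p * g / (2 * t))) * (2 * Θ * ((p - 2) * Θ / (2 * t)) * (h * t) - f * Θ) * (h * t))
    + ((-(m * ((p - 1) / p))) * η ^ 2 * (s * γ) / y + (-((D - 1) / D)) * η ^ 2 * z * G) * f
    + Θ * (2 * η * ((-(m * ((p - 1) / p))) * (s * γ) / y + (-((D - 1) / D)) * z * G) * ac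
      + η ^ 2 * ((-(m * ((p - 1) / p))) * (α - 1) * (s * γ) / y ^ 2 + (-((D - 1) / D)) * (α + q) * z * G / y) * t
      + 2 * η ^ 2 * ((-(m * ((p - 1) / p))) * (p * s * G / (2 * t)) / y + (-((D - 1) / D)) * z * (p * g / (2 * t))) * (h * t))
    = η ^ 2 * G * Θ ^ 2 * (H2 - (2 * K2 / t - h ^ 2 + (T - h) ^ 2 / (D - 1)))
      + (η ^ 2 * G * (D / (D - 1)) * e ^ 2 + 2 * η * G * Θ * ac * e)
      + G * Θ ^ 2 * (2 * (p - 1) * η ^ 2 * (K2 / t - h ^ 2) + 2 * η * (kc - h * ac))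
      + 2 * η * G * Θ * ac * ((D - 1) / D) * σ
      + 2 * η * (-(m * ((p - 1) / p))) * (s * γ / y) * Θ * ac
      + η ^ 2 * (((α + 2 * lam / D - (D - 1) / D * (α + q)) * G * s + m * ((p - 1) / p) * (s * γ)) * z / y
        + (-((D - 1) / D) * lam ^ 2 * G * s ^ 2 + m * ((p - 1) / p) * (1 - α) * (s * γ) * s) / y ^ 2)
      + (η ^ 2 * (G * ((D - 1) / D * z * r - (D - 1) / D * r ^ 2 - (α + 2 * lam / D) * r * s / y) - m * ((p - 1) / p) * s * γ * r / y)
        - 2 * η * ((D - 1) / D) * r * G * Θ * ac)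
      + η ^ 2 * g * (p * Θ ^ 2 * (K2 / t - h ^ 2) + p / (p - 1) * (X ^ 2 + z * X / D - r * X)) := by
  have h1 : D - 1 ≠ 0 := by linarith
  have h2 : p - 1 ≠ 0 := by linarith
  have hz : z = r - f := by linarith
  subst hz hm he hσ hX hs
  subst hf
  field_simp
  ring

theorem sl2 {ν η G e Θ ac n2 : ℝ} (hν0 : 0 < ν) (hν1 : ν ≤ 1) (hG0 : 0 ≤ G) (hG1 : G ≤ 1) (hac2 : Θ ^ 2 * ac ^ 2 ≤ n2) :
    -n2 ≤ η ^ 2 * G * (1 / ν) * e ^ 2 + 2 * η * G * Θ * ac * e := by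
  have e1 : η ^ 2 * G * (1 / ν) * e ^ 2 + 2 * η * G * Θ * ac * e = G / ν * (η * e + ν * Θ * ac) ^ 2 - G * ν * (Θ ^ 2 * ac ^ 2) := by
    field_simp; ring
  have e2 : 0 ≤ G / ν * (η * e + ν * Θ * ac) ^ 2 := by positivity
  have e3 : G * ν * (Θ ^ 2 * ac ^ 2) ≤ 1 * n2 := by
    apply mul_le_mul _ hac2 (by positivity) (by norm_num)
    exact mul_le_one₀ hG1 hν0.le hν1
  linarith

theorem sl3 {p η G Θ t c2 o w n2 : ℝ} (hp1 : 0 < p - 1) (hG0 : 0 ≤ G) (hG1 : G ≤ 1) (ht : 0 < t) (hom : 0 ≤ o) (hc2 : 0 ≤ c2)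
    (hwc : w ^ 2 ≤ t * o * c2) (hn2 : n2 = Θ ^ 2 * t * c2) :
    -(1 / (2 * (p - 1)) * n2) ≤ G * Θ ^ 2 * (2 * (p - 1) * η ^ 2 * o + 2 * η * w) := by
  have e1 := quad_low (A := 2 * (p - 1) * η ^ 2 * o) (B := t * c2 / (2 * (p - 1))) (x := 2 * η * w)
    (mul_nonneg (by positivity) hom) (by positivity) (by
      have : 4 * (2 * (p - 1) * η ^ 2 * o * (t * c2 / (2 * (p - 1)))) = 4 * η ^ 2 * (t * o * c2) := by
        field_simp
      rw [this]
      calc (2 * η * w) ^ 2 = 4 * η ^ 2 * w ^ 2 := by ring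
        _ ≤ _ := by gcongr)
  have e2 : G * Θ ^ 2 * (-(t * c2 / (2 * (p - 1)))) ≤ G * Θ ^ 2 * (2 * (p - 1) * η ^ 2 * o + 2 * η * w) := by
    apply mul_le_mul_of_nonneg_left _ (by positivity)
    linarith
  have e3 : G * Θ ^ 2 * (-(t * c2 / (2 * (p - 1)))) = - (G * (1 / (2 * (p - 1)) * n2)) := by rw [hn2]; ring
  have e4 : G * (1 / (2 * (p - 1)) * n2) ≤ 1 / (2 * (p - 1)) * n2 := by
    apply mul_le_of_le_one_left _ hG1
    rw [hn2]; positivity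
  linarith

theorem sl4 {ν η G Θ ac n2 θ s y lam σ : ℝ} (hν0 : 0 < ν) (hν1 : ν ≤ 1) (hG0 : 0 ≤ G) (hG1 : G ≤ 1) (hac2 : Θ ^ 2 * ac ^ 2 ≤ n2)
    (hθ : 0 < θ) (hy : 0 < y) (hσ : σ = lam * s / y) :
    -(η ^ 2 * (θ * G * s ^ 2 / y ^ 2) + lam ^ 2 / θ * n2) ≤ 2 * η * G * Θ * ac * ν * σ := by
  have e1 := quad_low (A := η ^ 2 * (θ * G * s ^ 2 / y ^ 2)) (B := G * (ν ^ 2 * lam ^ 2 / θ * (Θ ^ 2 * ac ^ 2))) (x := 2 * η * G * Θ * ac * ν * σ)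
    (by positivity) (by positivity) (by rw [hσ]; apply le_of_eq; field_simp; ring)
  have e2 : G * (ν ^ 2 * lam ^ 2 / θ * (Θ ^ 2 * ac ^ 2)) ≤ 1 * (1 * lam ^ 2 / θ * n2) := by
    have : ν ^ 2 ≤ 1 := pow_le_one₀ hν0.le hν1
    gcongr
  rw [one_mul, one_mul] at e2
  refine le_trans (neg_le_neg (add_le_add_right e2 _)) e1

theorem sl5 {κ η γ Θ ac n2 θ s y m : ℝ} (hκ0 : 0 < κ) (hκ1 : κ ≤ 1) (hγ0 : 0 ≤ γ) (hγ1 : γ ≤ 1) (hac2 : Θ ^ 2 * ac ^ 2 ≤ n2)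
    (hθ : 0 < θ) (hy : 0 < y) (hs0 : 0 < s) :
    -(η ^ 2 * (θ * (s * γ) * s / y ^ 2) + m ^ 2 / θ * n2) ≤ 2 * η * (-(m * κ)) * (s * γ / y) * Θ * ac := by
  have e1 := quad_low (A := η ^ 2 * (θ * (s * γ) * s / y ^ 2)) (B := γ * (κ ^ 2 * m ^ 2 / θ * (Θ ^ 2 * ac ^ 2))) (x := 2 * η * (-(m * κ)) * (s * γ / y) * Θ * ac)
    (by positivity) (by positivity) (by apply le_of_eq; field_simp; ring)
  have e2 : γ * (κ ^ 2 * m ^ 2 / θ * (Θ ^ 2 * ac ^ 2)) ≤ 1 * (1 * m ^ 2 / θ * n2) := by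
    have : κ ^ 2 ≤ 1 := pow_le_one₀ hκ0.le hκ1
    gcongr
  rw [one_mul, one_mul] at e2
  refine le_trans (neg_le_neg (add_le_add_right e2 _)) e1

theorem sl6 {ν κ η G γ Θ ac n2 s y m r z α lam D : ℝ} (hν0 : 0 < ν) (hν1 : ν ≤ 1) (hκ0 : 0 < κ) (hκ1 : κ ≤ 1)
    (hG0 : 0 ≤ G) (hG1 : G ≤ 1) (hγ0 : 0 ≤ γ) (hγ1 : γ ≤ 1) (hz : 0 ≤ z) (hac2 : Θ ^ 2 * ac ^ 2 ≤ n2) (hn20 : 0 ≤ n2)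
    (hy : 0 < y) (hs0 : 0 < s) : -(η ^ 2 * (|r| * (z + (|α + 2 * lam / D| + |m|) * s / y) + 2 * r ^ 2) + n2) ≤
    (η ^ 2 * (G * (ν * z * r - ν * r ^ 2 - (α + 2 * lam / D) * r * s / y) - m * κ * s * γ * r / y)
      - 2 * η * ν * r * G * Θ * ac) := by
  obtain ⟨A, hA⟩ : ∃ A, A = α + 2 * lam / D := ⟨_, rfl⟩
  rw [← hA]
  have f1 : -(|r| * z) ≤ G * ν * z * r := by
    have : |G * ν * z * r| ≤ 1 * 1 * z * |r| := by
      rw [abs_mul, abs_mul, abs_mul, abs_of_nonneg hG0, abs_of_pos hν0, abs_of_nonneg hz]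
      gcongr
    linarith [neg_abs_le (G * ν * z * r)]
  have f2 : G * ν * r ^ 2 ≤ r ^ 2 := by
    have : G * ν ≤ 1 := mul_le_one₀ hG1 hν0.le hν1
    exact mul_le_of_le_one_left (sq_nonneg r) this
  have f3 : G * (A * r * s / y) ≤ |r| * (|A| * s / y) := by
    have : |G * (A * r * s / y)| ≤ 1 * (|A| * |r| * s / y) := by
      rw [abs_mul, abs_div, abs_mul, abs_mul, abs_of_nonneg hG0, abs_of_pos hs0, abs_of_pos hy]
      gcongr
    calc _ ≤ _ := (le_abs_self _).trans this
      _ = _ := by ring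
  have f4 : m * κ * s * γ * r / y ≤ |r| * (|m| * s / y) := by
    have : |m * κ * s * γ * r / y| ≤ |m| * 1 * s * 1 * |r| / y := by
      rw [abs_div, abs_mul, abs_mul, abs_mul, abs_mul, abs_of_nonneg hγ0, abs_of_pos hs0, abs_of_pos hy, abs_of_pos hκ0]
      gcongr
    calc _ ≤ _ := (le_abs_self _).trans this
      _ = _ := by ring
  have f5 : 2 * η * ν * r * G * Θ * ac ≤ η ^ 2 * r ^ 2 + n2 := by
    have := quad_low (A := η ^ 2 * r ^ 2) (B := n2) (x := - (2 * η * ν * r * G * Θ * ac)) (by positivity) hn20 (by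
      have g1 : (- (2 * η * ν * r * G * Θ * ac)) ^ 2 = 4 * (η ^ 2 * r ^ 2 * ((ν * G) ^ 2 * (Θ ^ 2 * ac ^ 2))) := by ring
      rw [g1]
      have g2 : (ν * G) ^ 2 * (Θ ^ 2 * ac ^ 2) ≤ 1 * n2 := by
        have : ν * G ≤ 1 := mul_le_one₀ hν1 hG0 hG1
        have : (ν * G) ^ 2 ≤ 1 := pow_le_one₀ (mul_nonneg hν0.le hG0) this
        gcongr
      rw [one_mul] at g2
      gcongr)
    linarith
  have f6 : η ^ 2 * (-(|r| * (z + (|A| + |m|) * s / y) + r ^ 2)) ≤ η ^ 2 * (G * (ν * z * r - ν * r ^ 2 - A * r * s / y) - m * κ * s * γ * r / y) := by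
    apply mul_le_mul_of_nonneg_left _ (sq_nonneg _)
    have : |r| * (z + (|A| + |m|) * s / y) = |r| * z + |r| * (|A| * s / y) + |r| * (|m| * s / y) := by ring
    linarith
  linarith

theorem sl7 {κ η g p Θ o X z r D : ℝ} (hκ0 : 0 < κ) (hg0 : 0 ≤ g) (hg1 : g ≤ 1) (hz : 0 ≤ z) (hp0 : 0 < p) (hom : 0 ≤ o)
    (hDi : 1 / D ≤ 1) (hDi0 : 0 < 1 / D) : -(η ^ 2 * (1 / κ * g * z ^ 2) + η ^ 2 * (1 / κ * r ^ 2)) ≤ η ^ 2 * g * (p * Θ ^ 2 * o + 1 / κ * (X ^ 2 + z * X / D - r * X)) := by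
  have e1 : 0 ≤ p * Θ ^ 2 * o := mul_nonneg (by positivity) hom
  have e2 : -(z ^ 2 + r ^ 2) ≤ X ^ 2 + z * X / D - r * X := by
    have : z * X / D = (1 / D) * z * X := by ring
    rw [this]
    have : ((1 / D) * z) ^ 2 ≤ z ^ 2 := by
      have : (1 / D) * z ≤ z := mul_le_of_le_one_left hz hDi
      have h2 : 0 ≤ (1 / D) * z := by positivity
      exact pow_le_pow_left₀ h2 this 2
    nlinarith [sq_nonneg (X + (1 / D) * z), sq_nonneg (X - r), sq_nonneg (X + (1/D)*z - r)]
  have e3 : 1 / κ * (-(z ^ 2 + r ^ 2)) ≤ 1 / κ * (X ^ 2 + z * X / D - r * X) := mul_le_mul_of_nonneg_left e2 (by positivity)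
  have e4 : η ^ 2 * g * (1 / κ * (-(z ^ 2 + r ^ 2))) ≤ η ^ 2 * g * (p * Θ ^ 2 * o + 1 / κ * (X ^ 2 + z * X / D - r * X)) :=
    mul_le_mul_of_nonneg_left (by linarith) (by positivity)
  have e5 : η ^ 2 * g * (1 / κ * r ^ 2) ≤ η ^ 2 * 1 * (1 / κ * r ^ 2) := by gcongr
  nlinarith

set_option maxHeartbeats 4000000 in
/-- lower bound of the right-hand side of `scal_id` -/
theorem scal_low {p D t Θ y z η G γ g T h K2 H2 ac kc c2 α m lam q θ : ℝ} (hp : 1 < p) (hD : 1 < D) (ht : 0 < t) (hΘ : 0 < Θ) (hy : 0 < y)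
    (hz : 0 ≤ z) (hG0 : 0 ≤ G) (hG1 : G ≤ 1) (hγ0 : 0 ≤ γ) (hγ1 : γ ≤ 1) (hg0 : 0 ≤ g) (hg1 : g ≤ 1) (hθ : 0 < θ)
    (hH : 2 * K2 / t - h ^ 2 + (T - h) ^ 2 / (D - 1) ≤ H2) (hom : 0 ≤ K2 / t - h ^ 2) (hc2 : 0 ≤ c2) (hac : ac ^ 2 ≤ t * c2)
    (hwc : (kc - h * ac) ^ 2 ≤ t * (K2 / t - h ^ 2) * c2) (r X s σ e : ℝ) (hs : s = Θ * t) (hσ : σ = lam * s / y) :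
    η ^ 2 * (((α + 2 * lam / D - (D - 1) / D * (α + q)) * G * s + m * ((p - 1) / p) * (s * γ)) * z / y
        + (-((D - 1) / D * lam ^ 2 + θ) * G * s ^ 2 + (m * ((p - 1) / p) * (1 - α) - θ) * (s * γ) * s) / y ^ 2)
      - η ^ 2 * (p / (p - 1) * g * z ^ 2)
      - η ^ 2 * (|r| * (z + (|α + 2 * lam / D| + |m|) * s / y) + (2 + p / (p - 1)) * r ^ 2)
      - (2 + 1 / (2 * (p - 1)) + lam ^ 2 / θ + m ^ 2 / θ) * (Θ ^ 2 * t * c2)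
    ≤ η ^ 2 * G * Θ ^ 2 * (H2 - (2 * K2 / t - h ^ 2 + (T - h) ^ 2 / (D - 1)))
      + (η ^ 2 * G * (D / (D - 1)) * e ^ 2 + 2 * η * G * Θ * ac * e)
      + G * Θ ^ 2 * (2 * (p - 1) * η ^ 2 * (K2 / t - h ^ 2) + 2 * η * (kc - h * ac))
      + 2 * η * G * Θ * ac * ((D - 1) / D) * σ
      + 2 * η * (-(m * ((p - 1) / p))) * (s * γ / y) * Θ * ac
      + η ^ 2 * (((α + 2 * lam / D - (D - 1) / D * (α + q)) * G * s + m * ((p - 1) / p) * (s * γ)) * z / y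
        + (-((D - 1) / D) * lam ^ 2 * G * s ^ 2 + m * ((p - 1) / p) * (1 - α) * (s * γ) * s) / y ^ 2)
      + (η ^ 2 * (G * ((D - 1) / D * z * r - (D - 1) / D * r ^ 2 - (α + 2 * lam / D) * r * s / y) - m * ((p - 1) / p) * s * γ * r / y)
        - 2 * η * ((D - 1) / D) * r * G * Θ * ac)
      + η ^ 2 * g * (p * Θ ^ 2 * (K2 / t - h ^ 2) + p / (p - 1) * (X ^ 2 + z * X / D - r * X)) := by
  have hs0 : 0 < s := by rw [hs]; positivity
  have hD1 : 0 < D - 1 := by linarith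
  have hp1 : 0 < p - 1 := by linarith
  have hD0 : 0 < D := by linarith
  have hp0 : 0 < p := by linarith
  obtain ⟨ν, hν⟩ : ∃ ν, ν = (D - 1) / D := ⟨_, rfl⟩
  obtain ⟨κ, hκ⟩ : ∃ κ, κ = (p - 1) / p := ⟨_, rfl⟩
  have hν0 : 0 < ν := by rw [hν]; positivity
  have hν1 : ν ≤ 1 := by rw [hν, div_le_one hD0]; linarith
  have hκ0 : 0 < κ := by rw [hκ]; positivity
  have hκ1 : κ ≤ 1 := by rw [hκ, div_le_one hp0]; linarith
  have hνi : D / (D - 1) = 1 / ν := by rw [hν]; field_simp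
  have hκi : p / (p - 1) = 1 / κ := by rw [hκ]; field_simp
  have hDi : 1 / D ≤ 1 := by rw [div_le_one hD0]; linarith
  have hDi0 : 0 < 1 / D := by positivity
  rw [← hν, ← hκ, hνi, hκi]
  obtain ⟨n2, hn2⟩ : ∃ n2, n2 = Θ ^ 2 * t * c2 := ⟨_, rfl⟩
  rw [← hn2]
  have hn20 : 0 ≤ n2 := by rw [hn2]; positivity
  have hac2 : Θ ^ 2 * ac ^ 2 ≤ n2 := by rw [hn2, mul_assoc]; exact mul_le_mul_of_nonneg_left hac (sq_nonneg _)
  -- term 1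
  have t1 : 0 ≤ η ^ 2 * G * Θ ^ 2 * (H2 - (2 * K2 / t - h ^ 2 + (T - h) ^ 2 / (D - 1))) :=
    mul_nonneg (by positivity) (by linarith)
  have t2 := sl2 (η := η) (e := e) hν0 hν1 hG0 hG1 hac2
  have t3 := sl3 (η := η) hp1 hG0 hG1 ht hom hc2 hwc hn2
  have t4 := sl4 (η := η) hν0 hν1 hG0 hG1 hac2 hθ hy hσ
  have t5 := sl5 (η := η) (m := m) hκ0 hκ1 hγ0 hγ1 hac2 hθ hy hs0
  have t6 := sl6 (η := η) (m := m) (r := r) (α := α) (lam := lam) (D := D) hν0 hν1 hκ0 hκ1 hG0 hG1 hγ0 hγ1 hz hac2 hn20 hy hs0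
  have t7 := sl7 (η := η) (Θ := Θ) (X := X) (r := r) hκ0 hg0 hg1 hz hp0 hom hDi hDi0
  have split : (-(ν * lam ^ 2 + θ) * G * s ^ 2 + (m * κ * (1 - α) - θ) * (s * γ) * s) / y ^ 2 =
    (-ν * lam ^ 2 * G * s ^ 2 + m * κ * (1 - α) * (s * γ) * s) / y ^ 2 - θ * G * s ^ 2 / y ^ 2 - θ * (s * γ) * s / y ^ 2 := by
    ring
  rw [split]
  linarith
end part7

section part8
open scoped RealInnerProductSpace ContDiff Convolution Topology
open MeasureTheory Filter Set Metric

theorem la_test {d : ℕ} (a b k : Fin d → ℝ) (H : Fin d → Fin d → ℝ) (hsym : ∀ i j, H i j = H j i) (hk : ∀ i, k i = ∑ j, H i j * a j) (μ : ℝ) :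
    2 * (2 * ∑ i, k i * b i + μ * ∑ i, H i i) - (2 * (∑ i, a i ^ 2) * (∑ i, b i ^ 2) + 2 * (∑ i, a i * b i) ^ 2 + μ ^ 2 * d + 4 * μ * ∑ i, a i * b i)
      ≤ ∑ i, ∑ j, H i j ^ 2 := by
  have h0 : 0 ≤ ∑ i, ∑ j, (H i j - (a i * b j + b i * a j + μ * (if i = j then 1 else 0))) ^ 2 :=
    Finset.sum_nonneg fun i _ => Finset.sum_nonneg fun j _ => sq_nonneg _
  have e : ∀ i j, (H i j - (a i * b j + b i * a j + μ * (if i = j then 1 else 0))) ^ 2 =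
      H i j ^ 2 - 2 * (H j i * a i * b j) - 2 * (H i j * a j * b i) - (if i = j then 2 * μ * H i j else 0)
       + a i ^ 2 * b j ^ 2 + b i ^ 2 * a j ^ 2 + 2 * ((a i * b i) * (a j * b j)) + (if i = j then 2 * μ * (a i * b j + b i * a j) + μ ^ 2 else 0) := by
    intro i j
    rw [hsym j i]
    split_ifs <;> ring
  simp_rw [e, Finset.sum_add_distrib, Finset.sum_sub_distrib] at h0
  have k1 : ∑ i, ∑ j, 2 * (H i j * a j * b i) = 2 * ∑ i, k i * b i := by
    simp_rw [hk, Finset.mul_sum, Finset.sum_mul, Finset.mul_sum]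
  have k2 : ∑ i, ∑ j, 2 * (H j i * a i * b j) = 2 * ∑ i, k i * b i := by
    rw [Finset.sum_comm, k1]
  have k3 : ∑ i, ∑ j, (if i = j then 2 * μ * H i j else 0) = 2 * μ * ∑ i, H i i := by
    simp [Finset.mul_sum]
  have k4 : ∑ i, ∑ j, a i ^ 2 * b j ^ 2 = (∑ i, a i ^ 2) * ∑ i, b i ^ 2 := by
    rw [Finset.sum_mul_sum]
  have k5 : ∑ i, ∑ j, b i ^ 2 * a j ^ 2 = (∑ i, a i ^ 2) * ∑ i, b i ^ 2 := by
    rw [mul_comm, Finset.sum_mul_sum]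
  have k6 : ∑ i, ∑ j, 2 * ((a i * b i) * (a j * b j)) = 2 * (∑ i, a i * b i) ^ 2 := by
    rw [sq, Finset.sum_mul_sum]; simp_rw [Finset.mul_sum]
  have k7 : ∑ i, ∑ j, (if i = j then 2 * μ * (a i * b j + b i * a j) + μ ^ 2 else 0) = 4 * μ * (∑ i, a i * b i) + μ ^ 2 * d := by
    simp only [Finset.sum_ite_eq, Finset.mem_univ, if_true, Finset.sum_add_distrib, Finset.sum_const, Finset.card_univ, Fintype.card_fin, nsmul_eq_mul]
    rw [Finset.mul_sum]
    have : ∀ i, 2 * μ * (a i * b i + b i * a i) = 4 * μ * (a i * b i) := fun i => by ring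
    simp_rw [this]; ring
  rw [k1, k2, k3, k4, k5, k6, k7] at h0
  linarith

theorem la_low {d : ℕ} (hd : (1:ℝ) < d) (a k : Fin d → ℝ) (H : Fin d → Fin d → ℝ) (hsym : ∀ i j, H i j = H j i) (hk : ∀ i, k i = ∑ j, H i j * a j)
    (t h K2 T : ℝ) (ht : t = ∑ i, a i ^ 2) (ht0 : 0 < t) (hh : h * t = ∑ i, a i * k i) (hK : K2 = ∑ i, k i ^ 2) (hT : T = ∑ i, H i i) :
    2 * K2 / t - h ^ 2 + (T - h) ^ 2 / (d - 1) ≤ ∑ i, ∑ j, H i j ^ 2 := by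
  have hd1 : (d:ℝ) - 1 ≠ 0 := by linarith
  obtain ⟨μ, hμ⟩ : ∃ μ, μ = (T - h) / (d - 1) := ⟨_, rfl⟩
  obtain ⟨c, hc⟩ : ∃ c, c = -(h + μ) / (2 * t) := ⟨_, rfl⟩
  have := la_test a (fun i => k i / t + c * a i) k H hsym hk μ
  have e1 : ∑ i, k i * (k i / t + c * a i) = K2 / t + c * (h * t) := by
    rw [hh, hK, Finset.sum_div, Finset.mul_sum, ← Finset.sum_add_distrib]
    exact Finset.sum_congr rfl fun i _ => by ring
  have e2 : ∑ i, (k i / t + c * a i) ^ 2 = K2 / t ^ 2 + 2 * c / t * (h * t) + c ^ 2 * t := by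
    rw [hh, hK, Finset.sum_div, Finset.mul_sum]; nth_rw 4 [ht]
    rw [Finset.mul_sum, ← Finset.sum_add_distrib, ← Finset.sum_add_distrib]
    exact Finset.sum_congr rfl fun i _ => by ring
  have e3 : ∑ i, a i * (k i / t + c * a i) = (h * t) / t + c * t := by
    rw [hh, Finset.sum_div]; nth_rw 3 [ht]
    rw [Finset.mul_sum, ← Finset.sum_add_distrib]
    exact Finset.sum_congr rfl fun i _ => by ring
  rw [e1, e2, e3, ← ht, ← hT] at this
  refine le_trans (le_of_eq ?_) this
  rw [hc, hμ]
  field_simp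
  ring

theorem la_cs {d : ℕ} (a k c : Fin d → ℝ) (t h K2 c2 ac kc : ℝ) (ht : t = ∑ i, a i ^ 2) (ht0 : 0 < t) (hh : h * t = ∑ i, a i * k i) (hK : K2 = ∑ i, k i ^ 2)
    (hc2 : c2 = ∑ i, c i ^ 2) (hac : ac = ∑ i, a i * c i) (hkc : kc = ∑ i, k i * c i) :
    0 ≤ K2 / t - h ^ 2 ∧ 0 ≤ c2 ∧ ac ^ 2 ≤ t * c2 ∧ (kc - h * ac) ^ 2 ≤ t * (K2 / t - h ^ 2) * c2 := by
  have e : ∑ i, (k i - h * a i) ^ 2 = t * (K2 / t - h ^ 2) := by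
    have : t * (K2 / t - h ^ 2) = K2 - 2 * h * (h * t) + h ^ 2 * t := by field_simp; ring
    rw [this, hh, hK]; rw [ht]
    rw [Finset.mul_sum, Finset.mul_sum, ← Finset.sum_sub_distrib, ← Finset.sum_add_distrib]
    exact Finset.sum_congr rfl fun i _ => by ring
  refine ⟨?_, ?_, ?_, ?_⟩
  · have : 0 ≤ t * (K2 / t - h ^ 2) := by rw [← e]; positivity
    exact nonneg_of_mul_nonneg_right this ht0
  · rw [hc2]; positivity
  · rw [hac, ht, hc2]; exact Finset.sum_mul_sq_le_sq_mul_sq _ _ _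
  · rw [← e, hc2]
    have : kc - h * ac = ∑ i, (k i - h * a i) * c i := by
      rw [hkc, hac, Finset.mul_sum, ← Finset.sum_sub_distrib]
      exact Finset.sum_congr rfl fun i _ => by ring
    rw [this]; exact Finset.sum_mul_sq_le_sq_mul_sq _ _ _

/-- sums appearing in the divergence identity -/
theorem la_sums {d : ℕ} (a k c : Fin d → ℝ) (H : Fin d → Fin d → ℝ) (hsym : ∀ i j, H i j = H j i) (hk : ∀ i, k i = ∑ j, H i j * a j)
    (t ht K2 T H2 ac kc Θ P : ℝ) (htt : t = ∑ i, a i ^ 2) (hh : ht = ∑ i, a i * k i) (hK : K2 = ∑ i, k i ^ 2) (hT : T = ∑ i, H i i)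
    (hH2 : H2 = ∑ i, ∑ j, H i j ^ 2) (hac : ac = ∑ i, a i * c i) (hkc : kc = ∑ i, k i * c i)
    (DV : Fin d → Fin d → ℝ) (hDV : ∀ i j, DV i j = Θ * H i j + 2 * P * k j * a i) :
    (∑ i, ∑ j, DV i j * DV j i = Θ ^ 2 * H2 + 4 * Θ * P * K2 + 4 * P ^ 2 * ht ^ 2) ∧
    (∑ i, DV i i = Θ * T + 2 * P * ht) ∧
    (∀ i, ∑ j, (Θ * a j) * DV i j = Θ ^ 2 * k i + 2 * Θ * P * ht * a i) := by
  refine ⟨?_, ?_, ?_⟩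
  · have e : ∀ i j, DV i j * DV j i = Θ ^ 2 * H i j ^ 2 + 2 * Θ * P * (k i * (H i j * a j)) + 2 * Θ * P * (k j * (H j i * a i)) + 4 * P ^ 2 * ((a i * k i) * (a j * k j)) := by
      intro i j
      rw [hDV, hDV, hsym j i]; ring
    simp_rw [e, Finset.sum_add_distrib, ← Finset.mul_sum]
    have e2 : ∑ i, ∑ j, k j * (H j i * a i) = K2 := by
      rw [Finset.sum_comm]; simp_rw [← Finset.mul_sum, ← hk, hK, sq]
    rw [e2, ← Finset.sum_mul, ← hH2]
    simp_rw [← hk]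
    rw [← hh, hK]
    simp_rw [sq]; ring
  · simp_rw [hDV, Finset.sum_add_distrib, ← Finset.mul_sum, ← hT, mul_assoc, ← Finset.mul_sum, hh]
    simp_rw [mul_comm (k _)]
  · intro i
    have : ∀ j, (Θ * a j) * DV i j = Θ ^ 2 * (H i j * a j) + 2 * Θ * P * a i * (a j * k j) := fun j => by rw [hDV]; ring
    simp_rw [this, Finset.sum_add_distrib, ← Finset.mul_sum, ← hk, ← hh]; ring
end part8

section part9
open scoped RealInnerProductSpace ContDiff Convolution Topology
open MeasureTheory Filter Set Metric

noncomputable def pd {d : ℕ} (i : Fin d) (f : Eu d → ℝ) (x : Eu d) : ℝ := fderiv ℝ f x (EuclideanSpace.single i 1)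

variable {d : ℕ}

theorem pd_add {i : Fin d} {f g : Eu d → ℝ} {x : Eu d} (hf : DifferentiableAt ℝ f x) (hg : DifferentiableAt ℝ g x) :
    pd i (fun y => f y + g y) x = pd i f x + pd i g x := by
  unfold pd; rw [fderiv_fun_add hf hg]; simp

theorem pd_sub {i : Fin d} {f g : Eu d → ℝ} {x : Eu d} (hf : DifferentiableAt ℝ f x) (hg : DifferentiableAt ℝ g x) :
    pd i (fun y => f y - g y) x = pd i f x - pd i g x := by
  unfold pd; rw [fderiv_fun_sub hf hg]; simp

theorem pd_mul {i : Fin d} {f g : Eu d → ℝ} {x : Eu d} (hf : DifferentiableAt ℝ f x) (hg : DifferentiableAt ℝ g x) :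
    pd i (fun y => f y * g y) x = pd i f x * g x + f x * pd i g x := by
  unfold pd; rw [fderiv_fun_mul hf hg]; simp; ring

theorem pd_sum {ι : Type*} {s : Finset ι} {i : Fin d} {f : ι → Eu d → ℝ} {x : Eu d} (hf : ∀ j ∈ s, DifferentiableAt ℝ (f j) x) :
    pd i (fun y => ∑ j ∈ s, f j y) x = ∑ j ∈ s, pd i (f j) x := by
  unfold pd; rw [fderiv_fun_sum hf]; simp

theorem pd_comp {i : Fin d} {g : ℝ → ℝ} {g' : ℝ} {f : Eu d → ℝ} {x : Eu d} (hg : HasDerivAt g g' (f x)) (hf : DifferentiableAt ℝ f x) :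
    pd i (fun y => g (f y)) x = g' * pd i f x := by
  unfold pd
  have := (hg.comp_hasFDerivAt x hf.hasFDerivAt).fderiv
  rw [show (fun y => g (f y)) = g ∘ f from rfl, this]; simp

theorem pd_contDiff {i : Fin d} {f : Eu d → ℝ} (hf : ContDiff ℝ ∞ f) : ContDiff ℝ ∞ (pd i f) := by
  unfold pd
  exact (hf.fderiv_right (m := ∞) (by simp)).clm_apply contDiff_const

theorem pd_cont {i : Fin d} {f : Eu d → ℝ} (hf : ContDiff ℝ 1 f) : Continuous (pd i f) := by
  unfold pd
  exact (hf.continuous_fderiv (by simp)).clm_apply continuous_const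

theorem pd_comm {i j : Fin d} {f : Eu d → ℝ} (hf : ContDiff ℝ ∞ f) (x : Eu d) : pd i (pd j f) x = pd j (pd i f) x := by
  have hd : DifferentiableAt ℝ (fderiv ℝ f) x := ((hf.fderiv_right (m := ∞) (by simp)).differentiable (by simp)) x
  have e : ∀ i j : Fin d, pd i (pd j f) x = fderiv ℝ (fderiv ℝ f) x (EuclideanSpace.single i 1) (EuclideanSpace.single j 1) := by
    intro i j
    unfold pd
    rw [fderiv_clm_apply hd (differentiableAt_const _)]
    simp
  have hs : IsSymmSndFDerivAt ℝ f x := (hf.contDiffAt).isSymmSndFDerivAt (by simp [minSmoothness]; exact WithTop.coe_le_coe.2 (le_top : (2:ℕ∞) ≤ ⊤))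
  rw [e, e]
  exact hs.eq _ _

theorem smooth_diff {f : Eu d → ℝ} (hf : ContDiff ℝ ∞ f) (x : Eu d) : DifferentiableAt ℝ f x := hf.differentiable (by simp) x
theorem c1_diff {f : Eu d → ℝ} (hf : ContDiff ℝ 1 f) (x : Eu d) : DifferentiableAt ℝ f x := hf.differentiable (by simp) x

theorem int_pd {i : Fin d} {f : Eu d → ℝ} (hf : ContDiff ℝ 1 f) (hc : HasCompactSupport f) :
    Integrable (pd i f) ∧ ∫ x, pd i f x = 0 := by
  refine ⟨?_, int_fderiv_zero hf hc _⟩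
  refine (pd_cont hf).integrable_of_hasCompactSupport ?_
  exact (hc.fderiv ℝ).comp_left (g := fun L : Eu d →L[ℝ] ℝ => L (EuclideanSpace.single i 1)) (by simp)

noncomputable def Zf (V : Fin d → Eu d → ℝ) (Ψ Φ : Eu d → ℝ) (x : Eu d) : ℝ :=
  Ψ x * ((∑ i, ∑ j, pd j (V i) x * pd i (V j) x) - (∑ i, pd i (V i) x) ^ 2)
  + ∑ i, pd i Ψ x * ((∑ j, V j x * pd j (V i) x) - V i x * ∑ j, pd j (V j) x)
  + Φ x * (∑ i, pd i (V i) x) + ∑ i, V i x * pd i Φ x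

theorem Zf_int {V : Fin d → Eu d → ℝ} {Ψ Φ : Eu d → ℝ} (hV : ∀ i, ContDiff ℝ ∞ (V i)) (hΨ : ContDiff ℝ 1 Ψ) (hΨc : HasCompactSupport Ψ)
    (hΦ : ContDiff ℝ 1 Φ) (hΦc : HasCompactSupport Φ) : Integrable (Zf V Ψ Φ) ∧ ∫ x, Zf V Ψ Φ x = 0 := by
  let W : Fin d → Eu d → ℝ := fun i x => (∑ j, V j x * pd j (V i) x) - V i x * ∑ j, pd j (V j) x
  have hVd : ∀ i j, ContDiff ℝ ∞ (pd j (V i)) := fun i j => pd_contDiff (hV i)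
  have hf : ContDiff ℝ ∞ (fun x => ∑ j, pd j (V j) x) := ContDiff.sum fun j _ => hVd j j
  have hW1 : ∀ i, ContDiff ℝ ∞ (fun x => ∑ j, V j x * pd j (V i) x) := fun i => ContDiff.sum fun j _ => (hV j).mul (hVd i j)
  have hW : ∀ i, ContDiff ℝ ∞ (W i) := fun i => (hW1 i).sub ((hV i).mul hf)
  have hX : ∀ i, ContDiff ℝ 1 (fun x => Ψ x * W i x + Φ x * V i x) := fun i =>
    (hΨ.mul ((hW i).of_le (by simp))).add (hΦ.mul ((hV i).of_le (by simp)))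
  have hXc : ∀ i, HasCompactSupport (fun x => Ψ x * W i x + Φ x * V i x) := fun i =>
    (hΨc.mul_right (f' := W i)).add (hΦc.mul_right (f' := V i))
  have key : Zf V Ψ Φ = fun x => ∑ i, pd i (fun x => Ψ x * W i x + Φ x * V i x) x := by
    funext x
    have hWp : ∀ i, pd i (W i) x = (∑ j, (pd i (V j) x * pd j (V i) x + V j x * pd i (pd j (V i)) x))
        - (pd i (V i) x * (∑ j, pd j (V j) x) + V i x * ∑ j, pd i (pd j (V j)) x) := by
      intro i
      show pd i (fun x => (∑ j, V j x * pd j (V i) x) - V i x * ∑ j, pd j (V j) x) x = _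
      rw [pd_sub (smooth_diff (hW1 i) x) (smooth_diff ((hV i).mul hf) x), pd_mul (smooth_diff (hV i) x) (smooth_diff hf x),
        pd_sum fun j _ => smooth_diff (hVd j j) x, pd_sum fun j _ => smooth_diff ((hV j).mul (hVd i j)) x]
      congr 1
      exact Finset.sum_congr rfl fun j _ => pd_mul (smooth_diff (hV j) x) (smooth_diff (hVd i j) x)
    have hXp : ∀ i, pd i (fun x => Ψ x * W i x + Φ x * V i x) x = pd i Ψ x * W i x + Ψ x * pd i (W i) x + (pd i Φ x * V i x + Φ x * pd i (V i) x) := by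
      intro i
      rw [pd_add (f := fun x => Ψ x * W i x) (g := fun x => Φ x * V i x) ((c1_diff hΨ x).mul (smooth_diff (hW i) x)) ((c1_diff hΦ x).mul (smooth_diff (hV i) x)), pd_mul (c1_diff hΨ x) (smooth_diff (hW i) x),
        pd_mul (c1_diff hΦ x) (smooth_diff (hV i) x)]
    have hcan : ∑ i, ∑ j, V j x * pd i (pd j (V i)) x = ∑ i, V i x * ∑ j, pd i (pd j (V j)) x := by
      rw [Finset.sum_comm]
      refine Finset.sum_congr rfl fun j _ => ?_
      rw [Finset.mul_sum]
      exact Finset.sum_congr rfl fun i _ => by rw [pd_comm (hV i)]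
    have hsum : ∑ i, pd i (W i) x = (∑ i, ∑ j, pd j (V i) x * pd i (V j) x) - (∑ i, pd i (V i) x) ^ 2 := by
      simp_rw [hWp, Finset.sum_sub_distrib, Finset.sum_add_distrib]
      rw [hcan, ← Finset.sum_mul]
      simp_rw [mul_comm (pd _ (V _) x) (pd _ (V _) x)]
      ring
    simp_rw [hXp, Finset.sum_add_distrib, ← Finset.mul_sum, hsum]
    unfold Zf
    simp_rw [mul_comm (pd _ Φ x)]
    ring
  rw [key]
  refine ⟨integrable_finset_sum _ fun i _ => (int_pd (hX i) (hXc i)).1, ?_⟩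
  rw [integral_finset_sum _ fun i _ => (int_pd (hX i) (hXc i)).1]
  exact Finset.sum_eq_zero fun i _ => (int_pd (hX i) (hXc i)).2
end part9

section part10
open scoped RealInnerProductSpace ContDiff Convolution Topology
open MeasureTheory Filter Set Metric

noncomputable def xx (p τ t : ℝ) : ℝ := (τ / max t τ) ^ (p / 2)
noncomputable def GG (p τ t : ℝ) : ℝ := (1 - xx p τ t) ^ 2 * (1 + 2 * xx p τ t)
noncomputable def gam (p τ t : ℝ) : ℝ := (1 - xx p τ t) ^ 3
noncomputable def gg (p τ t : ℝ) : ℝ := 6 * xx p τ t ^ 2 * (1 - xx p τ t)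
noncomputable def Gam (p τ t : ℝ) : ℝ := (max t τ) ^ (p / 2) * gam p τ t

theorem xx_pos {p τ : ℝ} (hτ : 0 < τ) (t : ℝ) : 0 < xx p τ t := by
  unfold xx; have : 0 < max t τ := lt_max_of_lt_right hτ
  positivity

theorem xx_le {p τ : ℝ} (hp : 1 < p) (hτ : 0 < τ) (t : ℝ) : xx p τ t ≤ 1 := by
  unfold xx; have : 0 < max t τ := lt_max_of_lt_right hτ
  apply Real.rpow_le_one (by positivity) _ (by linarith)
  rw [div_le_one this]; exact le_max_right _ _

theorem xx_one {p τ t : ℝ} (hτ : 0 < τ) (h : t ≤ τ) : xx p τ t = 1 := by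
  unfold xx; rw [max_eq_right h, div_self hτ.ne', Real.one_rpow]

theorem cut_bounds {p τ : ℝ} (hp : 1 < p) (hτ : 0 < τ) (t : ℝ) :
    0 ≤ GG p τ t ∧ GG p τ t ≤ 1 ∧ 0 ≤ gam p τ t ∧ gam p τ t ≤ 1 ∧ 0 ≤ gg p τ t ∧ gg p τ t ≤ 1 := by
  have h0 := xx_pos (p := p) hτ t
  have h1 := xx_le hp hτ t
  unfold GG gam gg
  generalize xx p τ t = x at *
  have h2 : 0 ≤ 1 - x := by linarith
  refine ⟨by positivity, ?_, by positivity, pow_le_one₀ h2 (by linarith), by positivity, ?_⟩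
  · nlinarith [sq_nonneg x, mul_nonneg (sq_nonneg x) h2]
  · nlinarith [mul_nonneg h0.le (sq_nonneg (3 * x - 2)), sq_nonneg (3 * x - 2)]

theorem cut_zero {p τ t : ℝ} (hτ : 0 < τ) (h : t ≤ τ) : GG p τ t = 0 ∧ gam p τ t = 0 ∧ gg p τ t = 0 ∧ Gam p τ t = 0 := by
  unfold GG Gam gam gg; rw [xx_one hτ h]; norm_num

theorem xx_cont {p τ : ℝ} (hτ : 0 < τ) : Continuous (xx p τ) := by
  unfold xx
  have h : ∀ t, 0 < max t τ := fun t => lt_max_of_lt_right hτ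
  refine Continuous.rpow_const (continuous_const.div (continuous_id.max continuous_const) fun t => (h t).ne') fun t => Or.inl ?_
  have := h t
  positivity

theorem max_rpow_cont {e τ : ℝ} (hτ : 0 < τ) : Continuous (fun t : ℝ => (max t τ) ^ e) := by
  have h : ∀ t, 0 < max t τ := fun t => lt_max_of_lt_right hτ
  exact Continuous.rpow_const (continuous_id.max continuous_const) fun t => Or.inl (h t).ne'

theorem GG_cont {p τ : ℝ} (hτ : 0 < τ) : Continuous (GG p τ) := by
  have := xx_cont (p := p) hτ
  unfold GG; fun_prop
theorem gam_cont {p τ : ℝ} (hτ : 0 < τ) : Continuous (gam p τ) := by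
  have := xx_cont (p := p) hτ
  unfold gam; fun_prop
theorem gg_cont {p τ : ℝ} (hτ : 0 < τ) : Continuous (gg p τ) := by
  have := xx_cont (p := p) hτ
  unfold gg; fun_prop
theorem Gam_cont {p τ : ℝ} (hτ : 0 < τ) : Continuous (Gam p τ) := (max_rpow_cont hτ).mul (gam_cont hτ)

theorem xx_deriv {p τ t : ℝ} (hτ : 0 < τ) (h : τ < t) : HasDerivAt (xx p τ) (-(p / 2) * xx p τ t / t) t := by
  have ht : 0 < t := hτ.trans h
  have e : xx p τ =ᶠ[𝓝 t] fun s => τ ^ (p / 2) * s ^ (-(p / 2)) := by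
    filter_upwards [lt_mem_nhds h] with s hs
    have hs0 : 0 < s := hτ.trans hs
    unfold xx; rw [max_eq_left hs.le, Real.div_rpow hτ.le hs0.le, Real.rpow_neg hs0.le]; rfl
  have := ((Real.hasDerivAt_rpow_const (x := t) (p := -(p / 2)) (Or.inl ht.ne')).const_mul (τ ^ (p / 2))).congr_of_eventuallyEq e
  refine this.congr_deriv ?_
  rw [e.self_of_nhds, Real.rpow_sub_one ht.ne']
  ring

theorem deriv_glue {f g : ℝ → ℝ} {τ : ℝ} (hf : Continuous f) (hg : Continuous g) (h1 : ∀ t, τ < t → HasDerivAt f (g t) t) (h2 : ∀ t, t < τ → HasDerivAt f (g t) t) (t : ℝ) :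
    HasDerivAt f (g t) t := by
  refine hasDerivAt_of_hasDerivAt_of_ne' (x := τ) (fun y hy => ?_) hf.continuousAt hg.continuousAt t
  rcases lt_or_gt_of_ne hy with h | h
  · exact h2 y h
  · exact h1 y h

theorem GG_deriv {p τ : ℝ} (hτ : 0 < τ) (t : ℝ) : HasDerivAt (GG p τ) (p * gg p τ t / (2 * max t τ)) t := by
  have hm : ∀ t, 0 < max t τ := fun t => lt_max_of_lt_right hτ
  refine deriv_glue (τ := τ) (g := fun t => p * gg p τ t / (2 * max t τ)) (GG_cont hτ) ?_ ?_ ?_ t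
  · exact (continuous_const.mul (gg_cont hτ)).div (continuous_const.mul (continuous_id.max continuous_const)) fun t => by have := hm t; positivity
  · intro t ht
    have hx := xx_deriv (p := p) hτ ht
    have ht0 : 0 < t := hτ.trans ht
    have := ((hx.const_sub 1).pow 2).mul ((hx.const_mul 2).const_add 1)
    refine this.congr_deriv ?_
    dsimp only [Pi.pow_apply]
    unfold gg; rw [max_eq_left ht.le]; field_simp; ring
  · intro t ht
    have e : GG p τ =ᶠ[𝓝 t] fun _ => 0 := by
      filter_upwards [gt_mem_nhds ht] with s hs using (cut_zero hτ hs.le).1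
    rw [(cut_zero hτ ht.le).2.2.1]
    simpa using (hasDerivAt_const t (0:ℝ)).congr_of_eventuallyEq e

theorem Gam_deriv {p τ : ℝ} (hτ : 0 < τ) (t : ℝ) : HasDerivAt (Gam p τ) (p * ((max t τ) ^ (p / 2)) * GG p τ t / (2 * max t τ)) t := by
  have hm : ∀ t, 0 < max t τ := fun t => lt_max_of_lt_right hτ
  refine deriv_glue (τ := τ) (g := fun t => p * ((max t τ) ^ (p / 2)) * GG p τ t / (2 * max t τ)) (Gam_cont hτ) ?_ ?_ ?_ t
  · exact ((continuous_const.mul (max_rpow_cont hτ)).mul (GG_cont hτ)).div (continuous_const.mul (continuous_id.max continuous_const)) fun t => by have := hm t; positivity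
  · intro t ht
    have hx := xx_deriv (p := p) hτ ht
    have ht0 : 0 < t := hτ.trans ht
    have e : Gam p τ =ᶠ[𝓝 t] fun s => s ^ (p / 2) * (1 - xx p τ s) ^ 3 := by
      filter_upwards [lt_mem_nhds ht] with s hs
      unfold Gam gam; rw [max_eq_left hs.le]
    have := ((Real.hasDerivAt_rpow_const (x := t) (p := p / 2) (Or.inl ht0.ne')).mul ((hx.const_sub 1).pow 3)).congr_of_eventuallyEq e
    refine this.congr_deriv ?_
    dsimp only [Pi.pow_apply]
    unfold GG; rw [max_eq_left ht.le, Real.rpow_sub_one ht0.ne']; field_simp; ring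
  · intro t ht
    have e : Gam p τ =ᶠ[𝓝 t] fun _ => 0 := by
      filter_upwards [gt_mem_nhds ht] with s hs using (cut_zero hτ hs.le).2.2.2
    rw [(cut_zero hτ ht.le).1]
    simpa using (hasDerivAt_const t (0:ℝ)).congr_of_eventuallyEq e

theorem c1_of_deriv {f g : ℝ → ℝ} (hg : Continuous g) (h : ∀ t, HasDerivAt f (g t) t) : ContDiff ℝ 1 f := by
  rw [contDiff_one_iff_deriv]
  refine ⟨fun t => (h t).differentiableAt, ?_⟩
  rw [show deriv f = g from funext fun t => (h t).deriv]; exact hg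

theorem GG_c1 {p τ : ℝ} (hτ : 0 < τ) : ContDiff ℝ 1 (GG p τ) := by
  have hm : ∀ t, 0 < max t τ := fun t => lt_max_of_lt_right hτ
  exact c1_of_deriv (g := fun t => p * gg p τ t / (2 * max t τ)) ((continuous_const.mul (gg_cont hτ)).div (continuous_const.mul (continuous_id.max continuous_const)) fun t => by have := hm t; positivity) (GG_deriv hτ)

theorem Gam_c1 {p τ : ℝ} (hτ : 0 < τ) : ContDiff ℝ 1 (Gam p τ) := by
  have hm : ∀ t, 0 < max t τ := fun t => lt_max_of_lt_right hτ
  exact c1_of_deriv (g := fun t => p * ((max t τ) ^ (p / 2)) * GG p τ t / (2 * max t τ)) (((continuous_const.mul (max_rpow_cont hτ)).mul (GG_cont hτ)).div (continuous_const.mul (continuous_id.max continuous_const)) fun t => by have := hm t; positivity) (Gam_deriv hτ)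

noncomputable def Th (p τ t : ℝ) : ℝ := Real.smoothTransition (2 * t / τ - 1) * t ^ ((p - 2) / 2)

theorem Th_smooth {p τ : ℝ} (hτ : 0 < τ) : ContDiff ℝ ∞ (Th p τ) := by
  rw [contDiff_iff_contDiffAt]
  intro t
  by_cases ht : 0 < t
  · unfold Th
    refine ContDiffAt.mul ?_ ?_
    · exact (Real.smoothTransition.contDiff.comp (by fun_prop : ContDiff ℝ ∞ (fun t : ℝ => 2 * t / τ - 1))).contDiffAt
    · exact Real.contDiffAt_rpow_const_of_ne ht.ne'
  · have e : Th p τ =ᶠ[𝓝 t] fun _ => 0 := by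
      have : t < τ / 2 := by push Not at ht; linarith [half_pos hτ]
      filter_upwards [gt_mem_nhds this] with s hs
      unfold Th
      rw [Real.smoothTransition.zero_of_nonpos, zero_mul]
      have : 2 * s / τ ≤ 1 := by rw [div_le_one hτ]; linarith
      linarith
    exact contDiffAt_const.congr_of_eventuallyEq e

theorem Th_eq {p τ t : ℝ} (hτ : 0 < τ) (h : τ ≤ t) : Th p τ t = t ^ ((p - 2) / 2) := by
  unfold Th; rw [Real.smoothTransition.one_of_one_le, one_mul]
  have : 2 ≤ 2 * t / τ := by rw [le_div_iff₀ hτ]; linarith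
  linarith

theorem Th_deriv {p τ t : ℝ} (hτ : 0 < τ) (h : τ < t) : HasDerivAt (Th p τ) ((p - 2) * Th p τ t / (2 * t)) t := by
  have ht : 0 < t := hτ.trans h
  have e : Th p τ =ᶠ[𝓝 t] fun s => s ^ ((p - 2) / 2) := by
    filter_upwards [lt_mem_nhds h] with s hs using Th_eq hτ hs.le
  refine ((Real.hasDerivAt_rpow_const (x := t) (p := (p - 2) / 2) (Or.inl ht.ne')).congr_of_eventuallyEq e).congr_deriv ?_
  rw [Th_eq hτ h.le, Real.rpow_sub_one ht.ne']; field_simp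
end part10

section part11
open scoped RealInnerProductSpace ContDiff Convolution Topology
open MeasureTheory Filter Set Metric
variable {d : ℕ}

theorem grad_apply (U : Eu d → ℝ) (x : Eu d) (i : Fin d) : gradient U x i = pd i U x := by
  have := inner_grad U x (EuclideanSpace.single i 1)
  rw [EuclideanSpace.inner_single_left] at this
  simpa [pd] using this

theorem grad_norm_sq (U : Eu d → ℝ) (x : Eu d) : ‖gradient U x‖ ^ 2 = ∑ i, pd i U x ^ 2 := by
  rw [EuclideanSpace.real_norm_sq_eq]; simp_rw [grad_apply]

theorem fderiv_grad_apply {U : Eu d → ℝ} (hU : ContDiff ℝ ∞ U) (x : Eu d) (i j : Fin d) :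
    fderiv ℝ (gradient U) x (EuclideanSpace.single i 1) j = pd i (pd j U) x := by
  have hg : DifferentiableAt ℝ (gradient U) x := by
    rw [differentiableAt_euclidean]
    intro j
    simp_rw [grad_apply]
    exact smooth_diff (pd_contDiff hU) x
  have h := (EuclideanSpace.proj (𝕜 := ℝ) j : Eu d →L[ℝ] ℝ).hasFDerivAt.comp x hg.hasFDerivAt
  have e : (EuclideanSpace.proj (𝕜 := ℝ) j : Eu d →L[ℝ] ℝ) ∘ gradient U = pd j U := funext fun y => grad_apply U y j
  rw [e] at h
  change _ = fderiv ℝ (pd j U) x (EuclideanSpace.single i 1)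
  rw [h.fderiv]; rfl

theorem divF_eq {U : Eu d → ℝ} (hU : ContDiff ℝ ∞ U) (p : ℝ) (x : Eu d) (t : ℝ) (ht : t = ‖gradient U x‖ ^ 2) (ht0 : 0 < t) :
    divF p U x = t ^ ((p - 2) / 2) * (∑ i, pd i (pd i U) x) + 2 * ((p - 2) * t ^ ((p - 2) / 2) / (2 * t)) * ∑ i, pd i U x * ∑ j, pd i (pd j U) x * pd j U x := by
  have hn : 0 < ‖gradient U x‖ := by
    rcases (norm_nonneg (gradient U x)).eq_or_lt with h | h
    · rw [← h] at ht; simp at ht; linarith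
    · exact h
  have e1 : ‖gradient U x‖ ^ (p - 2) = t ^ ((p - 2) / 2) := by
    rw [ht, ← Real.rpow_natCast, ← Real.rpow_mul hn.le]; congr 1; push_cast; ring
  have e2 : ‖gradient U x‖ ^ (p - 4) = t ^ ((p - 2) / 2) / t := by
    rw [← e1, ht, ← Real.rpow_natCast, ← Real.rpow_sub hn]; congr 1; push_cast; ring
  unfold divF
  simp_rw [DF_apply, e1, e2]
  simp only [PiLp.add_apply, PiLp.smul_apply, smul_eq_mul, fderiv_grad_apply hU, grad_apply, Finset.sum_add_distrib, ← Finset.mul_sum]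
  congr 1
  rw [Finset.mul_sum]
  refine Finset.sum_congr rfl fun i _ => ?_
  have : ⟪gradient U x, fderiv ℝ (gradient U) x (EuclideanSpace.single i 1)⟫ = ∑ j, pd i (pd j U) x * pd j U x := by
    rw [PiLp.inner_apply]
    simp only [fderiv_grad_apply hU, grad_apply]
    exact Finset.sum_congr rfl fun j _ => by simp [mul_comm]
  rw [this]
  field_simp
end part11

section part12
open scoped RealInnerProductSpace ContDiff Convolution Topology
open MeasureTheory Filter Set Metric
variable {d : ℕ}

noncomputable def LB (p D q α m lam θ τ y t η c2 : ℝ) : ℝ :=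
  y ^ α * (η ^ 2 * (((α + 2 * lam / D - (D - 1) / D * (α + q)) * GG p τ t * t ^ (p / 2) + m * ((p - 1) / p) * (t ^ (p / 2) * gam p τ t)) * y ^ q / y
        + (-((D - 1) / D * lam ^ 2 + θ) * GG p τ t * (t ^ (p / 2)) ^ 2 + (m * ((p - 1) / p) * (1 - α) - θ) * (t ^ (p / 2) * gam p τ t) * t ^ (p / 2)) / y ^ 2)
      - η ^ 2 * (p / (p - 1) * gg p τ t * (y ^ q) ^ 2)
      - (2 + 1 / (2 * (p - 1)) + lam ^ 2 / θ + m ^ 2 / θ) * (t ^ (p - 1) * c2))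

noncomputable def RB (p D q α m lam y t η r : ℝ) : ℝ :=
  y ^ α * (η ^ 2 * (|r| * (y ^ q + (|α + 2 * lam / D| + |m|) * t ^ (p / 2) / y) + (2 + p / (p - 1)) * r ^ 2))

noncomputable def tq (U : Eu d → ℝ) (x : Eu d) : ℝ := ∑ i, pd i U x ^ 2

theorem tq_smooth {U : Eu d → ℝ} (hU : ContDiff ℝ ∞ U) : ContDiff ℝ ∞ (tq U) := by
  unfold tq; exact ContDiff.sum fun i _ => (pd_contDiff hU).pow 2

theorem pd_tq {U : Eu d → ℝ} (hU : ContDiff ℝ ∞ U) (x : Eu d) (j : Fin d) : pd j (tq U) x = 2 * ∑ i, pd j (pd i U) x * pd i U x := by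
  have : tq U = fun x => ∑ i, pd i U x * pd i U x := by funext x; simp [tq, sq]
  rw [this, pd_sum fun i _ => smooth_diff ((pd_contDiff hU).mul (pd_contDiff hU)) x, Finset.mul_sum]
  refine Finset.sum_congr rfl fun i _ => ?_
  rw [pd_mul (smooth_diff (pd_contDiff hU) x) (smooth_diff (pd_contDiff hU) x)]; ring

theorem pd_rpow {U : Eu d → ℝ} (hU : ContDiff ℝ ∞ U) (hpos : ∀ x, 0 < U x) (e : ℝ) (x : Eu d) (i : Fin d) :
    pd i (fun y => U y ^ e) x = e * (U x ^ e / U x) * pd i U x := by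
  rw [pd_comp (g := fun s => s ^ e) (Real.hasDerivAt_rpow_const (Or.inl (hpos x).ne')) (smooth_diff hU x), Real.rpow_sub_one (hpos x).ne']

theorem rpow_smooth {U : Eu d → ℝ} (hU : ContDiff ℝ ∞ U) (hpos : ∀ x, 0 < U x) (e : ℝ) : ContDiff ℝ ∞ (fun y => U y ^ e) :=
  hU.rpow_const_of_ne fun x => (hpos x).ne'

/-- derivative of a generic weight `η² U^e g(t)` -/
theorem pd_wt {U η : Eu d → ℝ} (hU : ContDiff ℝ ∞ U) (hpos : ∀ x, 0 < U x) (hη : ContDiff ℝ 1 η) (e : ℝ) {g : ℝ → ℝ} {g' : ℝ} (x : Eu d)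
    (hg : HasDerivAt g g' (tq U x)) (i : Fin d) :
    pd i (fun y => η y ^ 2 * U y ^ e * g (tq U y)) x = 2 * η x * U x ^ e * g (tq U x) * pd i η x
      + η x ^ 2 * (e * (U x ^ e / U x)) * g (tq U x) * pd i U x + 2 * η x ^ 2 * U x ^ e * g' * ∑ j, pd i (pd j U) x * pd j U x := by
  have h1 : DifferentiableAt ℝ (fun y => η y ^ 2) x := (c1_diff hη x).pow 2
  have h2 := smooth_diff (rpow_smooth hU hpos e) x
  have h3 : DifferentiableAt ℝ (fun y => g (tq U y)) x := hg.differentiableAt.comp x (smooth_diff (tq_smooth hU) x)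
  have h4 : pd i (fun y => η y ^ 2) x = 2 * η x * pd i η x := by
    have : (fun y => η y ^ 2) = fun y => η y * η y := by funext y; ring
    rw [this, pd_mul (c1_diff hη x) (c1_diff hη x)]; ring
  rw [pd_mul (f := fun y => η y ^ 2 * U y ^ e) (h1.mul h2) h3, pd_mul h1 h2, h4, pd_rpow hU hpos, pd_comp hg (smooth_diff (tq_smooth hU) x), pd_tq hU]
  ring

theorem wt_c1 {U η : Eu d → ℝ} (hU : ContDiff ℝ ∞ U) (hpos : ∀ x, 0 < U x) (hη : ContDiff ℝ 1 η) (hc : HasCompactSupport η) (e : ℝ) {g : ℝ → ℝ} (hg : ContDiff ℝ 1 g) :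
    ContDiff ℝ 1 (fun y => η y ^ 2 * U y ^ e * g (tq U y)) ∧ HasCompactSupport (fun y => η y ^ 2 * U y ^ e * g (tq U y)) := by
  refine ⟨((hη.pow 2).mul ((rpow_smooth hU hpos e).of_le (by simp))).mul (hg.comp ((tq_smooth hU).of_le (by simp))), ?_⟩
  refine hc.mono' ?_
  refine subset_trans ?_ (subset_tsupport η)
  intro x hx h0
  simp [h0] at hx

theorem sum3 (a k c : Fin d → ℝ) (A1 A2 A3 b1 b2 : ℝ) : ∑ i, (A1 * c i + A2 * a i + A3 * k i) * (b1 * k i + b2 * a i) =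
    A1 * b1 * (∑ i, k i * c i) + A1 * b2 * (∑ i, a i * c i) + A2 * b1 * (∑ i, a i * k i) + A2 * b2 * (∑ i, a i ^ 2) + A3 * b1 * (∑ i, k i ^ 2) + A3 * b2 * ∑ i, a i * k i := by
  simp_rw [Finset.mul_sum, ← Finset.sum_add_distrib]
  exact Finset.sum_congr rfl fun i _ => by ring
end part12

section part13
open scoped RealInnerProductSpace ContDiff Convolution Topology
open MeasureTheory Filter Set Metric
variable {d : ℕ}

theorem Z_expand {a k c : Fin d → ℝ} {H DV : Fin d → Fin d → ℝ} {V pΨ pΦ : Fin d → ℝ} {Ψ Φ Θ P A1 A2 A3 B1 B2 B3 t ht K2 T H2 ac kc f : ℝ}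
    (hsym : ∀ i j, H i j = H j i) (hk : ∀ i, k i = ∑ j, H i j * a j)
    (htt : t = ∑ i, a i ^ 2) (hh : ht = ∑ i, a i * k i) (hK : K2 = ∑ i, k i ^ 2) (hT : T = ∑ i, H i i)
    (hH2 : H2 = ∑ i, ∑ j, H i j ^ 2) (hac : ac = ∑ i, a i * c i) (hkc : kc = ∑ i, k i * c i)
    (hDV : ∀ i j, DV i j = Θ * H i j + 2 * P * k j * a i) (hV : ∀ i, V i = Θ * a i)
    (hΨ : ∀ i, pΨ i = A1 * c i + A2 * a i + A3 * k i) (hΦ : ∀ i, pΦ i = B1 * c i + B2 * a i + B3 * k i) (hf : f = Θ * T + 2 * P * ht) :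
    Ψ * ((∑ i, ∑ j, DV i j * DV j i) - (∑ i, DV i i) ^ 2) + ∑ i, pΨ i * ((∑ j, V j * DV i j) - V i * ∑ j, DV j j)
      + Φ * (∑ i, DV i i) + ∑ i, V i * pΦ i =
    Ψ * (Θ ^ 2 * H2 + 4 * Θ * P * K2 + 4 * P ^ 2 * ht ^ 2 - f ^ 2)
      + (A1 * Θ ^ 2 * kc + A1 * (2 * Θ * P * ht - f * Θ) * ac + A2 * Θ ^ 2 * ht + A2 * (2 * Θ * P * ht - f * Θ) * t + A3 * Θ ^ 2 * K2 + A3 * (2 * Θ * P * ht - f * Θ) * ht)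
      + Φ * f + Θ * (B1 * ac + B2 * t + B3 * ht) := by
  obtain ⟨s1, s2, s3⟩ := la_sums a k c H hsym hk t ht K2 T H2 ac kc Θ P htt hh hK hT hH2 hac hkc DV hDV
  rw [s1, s2, ← hf]
  simp_rw [hV, s3]
  have e1 : ∀ i, pΨ i * (Θ ^ 2 * k i + 2 * Θ * P * ht * a i - Θ * a i * f) = (A1 * c i + A2 * a i + A3 * k i) * (Θ ^ 2 * k i + (2 * Θ * P * ht - f * Θ) * a i) :=
    fun i => by rw [hΨ]; ring
  have e2 : ∀ i, Θ * a i * pΦ i = (B1 * c i + B2 * a i + B3 * k i) * (0 * k i + Θ * a i) := fun i => by rw [hΦ]; ring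
  simp_rw [e1, e2, sum3, ← hac, ← hkc, ← hh, ← htt, ← hK]
  ring

set_option maxHeartbeats 1000000 in
theorem key6 {p q α m lam θ τ : ℝ} (hp : 1 < p) (hd : (1:ℝ) < d) (hm : m = α + 2 * lam) (hθ : 0 < θ) (hτ : 0 < τ)
    {U η : Eu d → ℝ} (hU : ContDiff ℝ ∞ U) (hpos : ∀ x, 0 < U x) (hη : ContDiff ℝ 1 η) (hc : HasCompactSupport η) :
    ∃ Z : Eu d → ℝ, Integrable Z ∧ ∫ x, Z x = 0 ∧ ∀ x,
      (‖gradient U x‖ ^ 2 ≤ τ → LB p d q α m lam θ τ (U x) (‖gradient U x‖ ^ 2) (η x) (‖gradient η x‖ ^ 2) ≤ Z x) ∧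
      (τ < ‖gradient U x‖ ^ 2 → LB p d q α m lam θ τ (U x) (‖gradient U x‖ ^ 2) (η x) (‖gradient η x‖ ^ 2) ≤
        Z x + RB p d q α m lam (U x) (‖gradient U x‖ ^ 2) (η x) (divF p U x + U x ^ q)) := by
  have hp1 : 0 < p - 1 := by linarith
  let V : Fin d → Eu d → ℝ := fun i x => Th p τ (tq U x) * pd i U x
  obtain ⟨c1, hc1⟩ : ∃ c1 : ℝ, c1 = -(m * ((p - 1) / p)) := ⟨_, rfl⟩
  obtain ⟨c2, hc2⟩ : ∃ c2 : ℝ, c2 = -(((d:ℝ) - 1) / d) := ⟨_, rfl⟩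
  let Ψ : Eu d → ℝ := fun y => η y ^ 2 * U y ^ α * GG p τ (tq U y)
  let Φ1 : Eu d → ℝ := fun y => η y ^ 2 * U y ^ (α - 1) * Gam p τ (tq U y)
  let Φ2 : Eu d → ℝ := fun y => η y ^ 2 * U y ^ (α + q) * GG p τ (tq U y)
  let Φ : Eu d → ℝ := fun y => c1 * Φ1 y + c2 * Φ2 y
  have hThs : ContDiff ℝ ∞ (fun x => Th p τ (tq U x)) := (Th_smooth hτ).comp (tq_smooth hU)
  have hV : ∀ i, ContDiff ℝ ∞ (V i) := fun i => hThs.mul (pd_contDiff hU)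
  have w0 := wt_c1 hU hpos hη hc α (GG_c1 (p := p) hτ)
  have w1 := wt_c1 hU hpos hη hc (α - 1) (Gam_c1 (p := p) hτ)
  have w2 := wt_c1 hU hpos hη hc (α + q) (GG_c1 (p := p) hτ)
  have hΦ : ContDiff ℝ 1 Φ := (contDiff_const.mul w1.1).add (contDiff_const.mul w2.1)
  have hΦc : HasCompactSupport Φ := (w1.2.mul_left (f := fun _ => c1)).add (w2.2.mul_left (f := fun _ => c2))
  obtain ⟨z1, z2⟩ := Zf_int hV w0.1 w0.2 hΦ hΦc
  refine ⟨Zf V Ψ Φ, z1, z2, fun x => ?_⟩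
  have hpΦ : ∀ i, pd i Φ x = c1 * pd i Φ1 x + c2 * pd i Φ2 x := by
    intro i
    show pd i (fun y => c1 * Φ1 y + c2 * Φ2 y) x = _
    rw [pd_add (f := fun y => c1 * Φ1 y) (g := fun y => c2 * Φ2 y) ((differentiableAt_const _).mul (c1_diff w1.1 x)) ((differentiableAt_const _).mul (c1_diff w2.1 x)),
      pd_mul (differentiableAt_const _) (c1_diff w1.1 x), pd_mul (differentiableAt_const _) (c1_diff w2.1 x)]
    simp [pd, Φ1, Φ2]
  have d0 := pd_wt hU hpos hη α x (GG_deriv (p := p) hτ (tq U x))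
  have d1 := pd_wt hU hpos hη (α - 1) x (Gam_deriv (p := p) hτ (tq U x))
  have d2 := pd_wt hU hpos hη (α + q) x (GG_deriv (p := p) hτ (tq U x))
  rw [grad_norm_sq U, grad_norm_sq η, show ∑ i, pd i U x ^ 2 = tq U x from rfl]
  obtain ⟨y, hy⟩ : ∃ y, y = U x := ⟨_, rfl⟩
  obtain ⟨t, ht⟩ : ∃ t, t = tq U x := ⟨_, rfl⟩
  have hy0 : 0 < y := hy ▸ hpos x
  refine ⟨fun hle => ?_, fun hlt => ?_⟩
  · obtain ⟨g1, g2, g3, g4⟩ := cut_zero (p := p) hτ hle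
    have e0 : ∀ i, pd i Ψ x = 0 := fun i => by rw [show pd i Ψ x = _ from d0 i, g1, g3]; ring
    have e1 : ∀ i, pd i Φ x = 0 := fun i => by
      rw [hpΦ i, show pd i Φ1 x = _ from d1 i, show pd i Φ2 x = _ from d2 i, g1, g3, g4]; ring
    have : Zf V Ψ Φ x = 0 := by
      unfold Zf
      simp_rw [e0, e1]
      have a1 : Ψ x = 0 := by simp only [Ψ, g1, mul_zero]
      have a2 : Φ x = 0 := by simp only [Φ, Φ1, Φ2, g1, g4, mul_zero, add_zero]
      rw [a1, a2]; simp
    rw [this]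
    unfold LB
    rw [g1, g2, g3]
    have h1 : 0 ≤ (2 + 1 / (2 * (p - 1)) + lam ^ 2 / θ + m ^ 2 / θ) * (tq U x ^ (p - 1) * ∑ i, pd i η x ^ 2) := by
      have : 0 ≤ tq U x := by unfold tq; positivity
      positivity
    have h2 : 0 < U x ^ α := Real.rpow_pos_of_pos (hpos x) _
    refine mul_nonpos_of_nonneg_of_nonpos h2.le ?_
    simp only [mul_zero, zero_mul, add_zero, zero_div, sub_zero, zero_sub, sub_self]
    linarith
  · have ht0 : 0 < t := by rw [ht]; exact hτ.trans hlt
    have hmax : max (tq U x) τ = tq U x := max_eq_left hlt.le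
    rw [hmax] at d0 d1 d2
    obtain ⟨Θ, hΘ⟩ : ∃ Θ, Θ = Th p τ t := ⟨_, rfl⟩
    have hΘe : Θ = t ^ ((p - 2) / 2) := by rw [hΘ]; exact Th_eq hτ (ht ▸ hlt.le)
    have hΘ0 : 0 < Θ := by rw [hΘe]; positivity
    have hs : t ^ (p / 2) = Θ * t := by
      rw [hΘe]; nth_rw 3 [← Real.rpow_one t]; rw [← Real.rpow_add ht0]; congr 1; ring
    have hs2 : t ^ (p - 1) = Θ ^ 2 * t := by
      rw [hΘe, ← Real.rpow_natCast, ← Real.rpow_mul ht0.le]; nth_rw 3 [← Real.rpow_one t]; rw [← Real.rpow_add ht0]; congr 1; push_cast; ring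
    obtain ⟨P, hP⟩ : ∃ P, P = (p - 2) * Θ / (2 * t) := ⟨_, rfl⟩
    obtain ⟨k, hk⟩ : ∃ k : Fin d → ℝ, ∀ i, k i = ∑ j, pd i (pd j U) x * pd j U x := ⟨_, fun i => rfl⟩
    have hk' : ∀ i, k i = ∑ j, (fun i j => pd j (pd i U) x) i j * (fun j => pd j U x) j := fun i => by
      rw [hk]; exact Finset.sum_congr rfl fun j _ => by simp only []; rw [pd_comm hU]
    have hsym : ∀ i j : Fin d, (fun i j => pd j (pd i U) x) i j = (fun i j => pd j (pd i U) x) j i := fun i j => pd_comm hU x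
    have hDV : ∀ i j, (fun i j => pd j (V i) x) i j = Θ * (fun i j => pd j (pd i U) x) i j + 2 * P * k j * (fun j => pd j U x) i := by
      intro i j
      show pd j (fun x => Th p τ (tq U x) * pd i U x) x = _
      rw [pd_mul (smooth_diff hThs x) (smooth_diff (pd_contDiff hU) x), pd_comp (Th_deriv hτ hlt) (smooth_diff (tq_smooth hU) x), pd_tq hU, ← hk, ← ht, ← hΘ, ← hP]
      ring
    obtain ⟨h, hh⟩ : ∃ h, h = (∑ i, pd i U x * k i) / t := ⟨_, rfl⟩
    have hht : h * t = ∑ i, (fun j => pd j U x) i * k i := by rw [hh]; field_simp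
    obtain ⟨f, hf⟩ : ∃ f, f = Θ * (∑ i, (fun i j => pd j (pd i U) x) i i) + 2 * P * (h * t) := ⟨_, rfl⟩
    have hfd : divF p U x = f := by
      rw [divF_eq hU p x t (by rw [ht, grad_norm_sq]; rfl) ht0, hf, ← hΘe, ← hP, hht]
      simp_rw [hk]
    obtain ⟨Y, hY⟩ : ∃ Y, Y = y ^ α := ⟨_, rfl⟩
    obtain ⟨z, hz⟩ : ∃ z, z = y ^ q := ⟨_, rfl⟩
    have hY1 : y ^ (α - 1) = Y / y := by rw [hY, Real.rpow_sub_one hy0.ne']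
    have hY2 : y ^ (α + q) = Y * z := by rw [hY, hz, Real.rpow_add hy0]
    have hY0 : 0 < Y := by rw [hY]; positivity
    have hz0 : 0 < z := by rw [hz]; positivity
    have hΨ' : ∀ i, (fun i => pd i Ψ x) i = (Y * (2 * η x * GG p τ t)) * (fun i => pd i η x) i + (Y * (α * η x ^ 2 * GG p τ t / y)) * (fun j => pd j U x) i
        + (Y * (2 * η x ^ 2 * (p * gg p τ t / (2 * t)))) * k i := by
      intro i
      show pd i Ψ x = _
      rw [show pd i Ψ x = _ from d0 i, ← hk, ← ht, ← hy, ← hY]; ring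
    have hGam : Gam p τ t = Θ * t * gam p τ t := by unfold Gam; rw [max_eq_left (ht ▸ hlt.le), hs]
    have hΦ' : ∀ i, (fun i => pd i Φ x) i = (Y * (2 * η x * (c1 * (Θ * t * gam p τ t) / y + c2 * z * GG p τ t))) * (fun i => pd i η x) i
        + (Y * (η x ^ 2 * (c1 * (α - 1) * (Θ * t * gam p τ t) / y ^ 2 + c2 * (α + q) * z * GG p τ t / y))) * (fun j => pd j U x) i
        + (Y * (2 * η x ^ 2 * (c1 * (p * (Θ * t) * GG p τ t / (2 * t)) / y + c2 * z * (p * gg p τ t / (2 * t))))) * k i := by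
      intro i
      show pd i Φ x = _
      rw [hpΦ i, show pd i Φ1 x = _ from d1 i, show pd i Φ2 x = _ from d2 i, ← hk, ← ht, ← hy, hY1, hY2, hs, hGam]; ring
    have hΨx : Ψ x = Y * (η x ^ 2 * GG p τ t) := by
      show η x ^ 2 * U x ^ α * GG p τ (tq U x) = _
      rw [← ht, ← hy, ← hY]; ring
    have hΦx : Φ x = Y * (c1 * η x ^ 2 * (Θ * t * gam p τ t) / y + c2 * η x ^ 2 * z * GG p τ t) := by
      show c1 * (η x ^ 2 * U x ^ (α - 1) * Gam p τ (tq U x)) + c2 * (η x ^ 2 * U x ^ (α + q) * GG p τ (tq U x)) = _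
      rw [← ht, ← hy, hY1, hY2, hGam]; ring
    have hZ := Z_expand (a := fun j => pd j U x) (c := fun i => pd i η x) (H := fun i j => pd j (pd i U) x) (DV := fun i j => pd j (V i) x)
      (V := fun i => V i x) (pΨ := fun i => pd i Ψ x) (pΦ := fun i => pd i Φ x) (Ψ := Ψ x) (Φ := Φ x)
      hsym hk' rfl hht rfl rfl rfl rfl rfl hDV (fun i => by show Th p τ (tq U x) * pd i U x = _; rw [← ht, ← hΘ]) hΨ' hΦ' hf
    have hZf : Zf V Ψ Φ x = _ := hZ
    rw [show (∑ i, (fun j => pd j U x) i ^ 2) = t from ht.symm] at hZf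
    obtain ⟨T, hT⟩ : ∃ T, T = ∑ i, (fun i j => pd j (pd i U) x) i i := ⟨_, rfl⟩
    obtain ⟨K2, hK2⟩ : ∃ K2, K2 = ∑ i, k i ^ 2 := ⟨_, rfl⟩
    obtain ⟨H2, hH2⟩ : ∃ H2, H2 = ∑ i, ∑ j, (fun i j => pd j (pd i U) x) i j ^ 2 := ⟨_, rfl⟩
    obtain ⟨ac, hac⟩ : ∃ ac, ac = ∑ i, (fun j => pd j U x) i * (fun i => pd i η x) i := ⟨_, rfl⟩
    obtain ⟨kc, hkc⟩ : ∃ kc, kc = ∑ i, k i * (fun i => pd i η x) i := ⟨_, rfl⟩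
    obtain ⟨cc, hcc⟩ : ∃ cc, cc = ∑ i, (fun i => pd i η x) i ^ 2 := ⟨_, rfl⟩
    have l1 := la_low hd (fun j => pd j U x) k (fun i j => pd j (pd i U) x) hsym hk' t h K2 T ht ht0 hht hK2 hT
    obtain ⟨l2, l3, l4, l5⟩ := la_cs (fun j => pd j U x) k (fun i => pd i η x) t h K2 cc ac kc ht ht0 hht hK2 hcc hac hkc
    rw [← hH2] at l1
    rw [← hK2, ← hH2, ← hac, ← hkc] at hZf
    rw [← hT] at hf
    obtain ⟨b1, b2, b3, b4, b5, b6⟩ := cut_bounds hp hτ t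
    rw [← ht, show (∑ i, pd i η x ^ 2) = cc from hcc.symm, ← hy, hfd]
    unfold LB RB
    rw [hs, hs2, ← hY, ← hz]
    have id := scal_id (p := p) (D := d) (t := t) (Θ := Θ) (y := y) (z := z) (η := η x) (G := GG p τ t) (γ := gam p τ t) (g := gg p τ t) (T := T) (h := h) (K2 := K2) (H2 := H2)
      (ac := ac) (kc := kc) (α := α) (m := m) (lam := lam) (q := q) hp hd ht0 hy0 hm f (f + z) _ _ _ _ (hP ▸ hf) (by ring) rfl rfl rfl rfl
    have low := scal_low (q := q) (m := m) (α := α) (lam := lam) (η := η x) hp hd ht0 hΘ0 hy0 hz0.le b1 b2 b3 b4 b5 b6 hθ l1 l2 l3 l4 l5 (f + z) ((p - 1) * Θ * h) (Θ * t) (lam * (Θ * t) / y)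
      ((p - 1) * Θ * h - lam * (Θ * t) / y - (f - lam * (Θ * t) / y) / d) rfl rfl
    rw [← id, ← hP, ← hc1, ← hc2] at low
    rw [hZf, hΨx, hΦx]
    have low2 := mul_le_mul_of_nonneg_left low hY0.le
    refine le_trans (le_of_eq ?_) (add_le_add (low2.trans_eq ?_) le_rfl)
    · ring
    · ring
end part13

section part14
open scoped RealInnerProductSpace ContDiff Convolution Topology
open MeasureTheory Filter Set Metric
variable {d : ℕ}

theorem cutoff_exists {K O : Set (Eu d)} (hK : IsCompact K) (hO : IsOpen O) (h : K ⊆ O) :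
    ∃ χ : Eu d → ℝ, ContDiff ℝ ∞ χ ∧ HasCompactSupport χ ∧ tsupport χ ⊆ O ∧ (∀ x ∈ K, χ x = 1) ∧ ∀ x, 0 ≤ χ x ∧ χ x ≤ 1 := by
  obtain ⟨L, hL, h1, h2⟩ := exists_compact_between hK hO h
  obtain ⟨f, f1, f2, f3⟩ := exists_contMDiffMap_one_nhds_of_subset_interior (n := ⊤) (modelWithCornersSelf ℝ (Eu d)) hK.isClosed h1
  have hs : tsupport f ⊆ L := closure_minimal (fun x hx => by by_contra h; exact hx (f2 x h)) hL.isClosed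
  refine ⟨f, f.contMDiff.contDiff, hL.of_isClosed_subset (isClosed_tsupport _) hs, hs.trans h2, fun x hx => f1.self_of_nhdsSet x hx, fun x => f3 x⟩

theorem LB_cont {p D q α m lam θ τ : ℝ} (hp : 1 < p) (hτ : 0 < τ) :
    ContinuousOn (fun v : ℝ × ℝ × ℝ × ℝ => LB p D q α m lam θ τ v.1 v.2.1 v.2.2.1 v.2.2.2) {v | 0 < v.1} := by
  have h1 := GG_cont (p := p) hτ
  have h2 := gam_cont (p := p) hτ
  have h3 := gg_cont (p := p) hτ
  have h4 : Continuous fun t : ℝ => t ^ (p / 2) := Real.continuous_rpow_const (by linarith)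
  have h5 : Continuous fun t : ℝ => t ^ (p - 1) := Real.continuous_rpow_const (by linarith)
  have h6 : ∀ e : ℝ, ContinuousOn (fun v : ℝ × ℝ × ℝ × ℝ => v.1 ^ e) {v | 0 < v.1} := fun e =>
    ContinuousOn.rpow_const continuous_fst.continuousOn fun v hv => Or.inl (ne_of_gt hv)
  have h6α := h6 α
  have h6q := h6 q
  have k1 : Continuous fun v : ℝ × ℝ × ℝ × ℝ => v.2.1 ^ (p / 2) := h4.comp (by fun_prop)
  have k2 : Continuous fun v : ℝ × ℝ × ℝ × ℝ => v.2.1 ^ (p - 1) := h5.comp (by fun_prop)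
  have k3 : Continuous fun v : ℝ × ℝ × ℝ × ℝ => GG p τ v.2.1 := h1.comp (by fun_prop)
  have k4 : Continuous fun v : ℝ × ℝ × ℝ × ℝ => gam p τ v.2.1 := h2.comp (by fun_prop)
  have k5 : Continuous fun v : ℝ × ℝ × ℝ × ℝ => gg p τ v.2.1 := h3.comp (by fun_prop)
  unfold LB
  refine ContinuousOn.mul h6α (ContinuousOn.sub (ContinuousOn.sub (ContinuousOn.mul (by fun_prop) (ContinuousOn.add (ContinuousOn.div ?_ (by fun_prop) fun v hv => ne_of_gt hv) (ContinuousOn.div (by fun_prop) (by fun_prop) fun v hv => pow_ne_zero _ (ne_of_gt hv)))) ?_) (by fun_prop))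
  · exact ContinuousOn.mul (by fun_prop) h6q
  · exact ContinuousOn.mul (by fun_prop) (ContinuousOn.mul (by fun_prop) (h6q.pow 2))

theorem RB_bd {p D q α m lam a b T N : ℝ} (hp : 1 < p) (ha : 0 < a) :
    ∃ M, 0 ≤ M ∧ ∀ y t η r, a ≤ y → y ≤ b → 0 ≤ t → t ≤ T → |η| ≤ N → RB p D q α m lam y t η r ≤ M * (|r| + r ^ 2) := by
  let F : ℝ × ℝ × ℝ → ℝ := fun v => v.1 ^ α * v.2.2 ^ 2 * (v.1 ^ q + (|α + 2 * lam / D| + |m|) * v.2.1 ^ (p / 2) / v.1) + v.1 ^ α * v.2.2 ^ 2 * (2 + p / (p - 1))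
  have h6 : ∀ e : ℝ, ContinuousOn (fun v : ℝ × ℝ × ℝ => v.1 ^ e) {v | 0 < v.1} := fun e =>
    ContinuousOn.rpow_const continuous_fst.continuousOn fun v hv => Or.inl (ne_of_gt hv)
  have h6α := h6 α
  have h6q := h6 q
  have k1 : Continuous fun v : ℝ × ℝ × ℝ => v.2.1 ^ (p / 2) := (Real.continuous_rpow_const (by linarith : 0 ≤ p / 2)).comp (by fun_prop)
  have hF : ContinuousOn F {v | 0 < v.1} := by
    refine ContinuousOn.add (ContinuousOn.mul (h6α.mul (by fun_prop)) (h6q.add (ContinuousOn.div (continuous_const.mul k1).continuousOn (by fun_prop) fun v hv => ne_of_gt hv))) ((h6α.mul (by fun_prop)).mul continuousOn_const)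
  have hK : IsCompact (Icc a b ×ˢ Icc 0 T ×ˢ Icc (-N) N) := isCompact_Icc.prod (isCompact_Icc.prod isCompact_Icc)
  obtain ⟨M, hM⟩ := hK.exists_bound_of_continuousOn (hF.mono fun v hv => lt_of_lt_of_le ha hv.1.1)
  refine ⟨max M 0, le_max_right _ _, fun y t η r h1 h2 h3 h4 h5 => ?_⟩
  have hb := hM (y, t, η) ⟨⟨h1, h2⟩, ⟨h3, h4⟩, abs_le.1 h5⟩
  have hb2 : F (y, t, η) ≤ max M 0 := ((le_abs_self _).trans hb).trans (le_max_left _ _)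
  have hy : 0 < y := lt_of_lt_of_le ha h1
  have hp1 : 0 < p - 1 := by linarith
  have e1 : 0 ≤ y ^ α * η ^ 2 * (y ^ q + (|α + 2 * lam / D| + |m|) * t ^ (p / 2) / y) := by positivity
  have e2 : 0 ≤ y ^ α * η ^ 2 * (2 + p / (p - 1)) := by positivity
  calc RB p D q α m lam y t η r = (y ^ α * η ^ 2 * (y ^ q + (|α + 2 * lam / D| + |m|) * t ^ (p / 2) / y)) * |r| + (y ^ α * η ^ 2 * (2 + p / (p - 1))) * r ^ 2 := by
        unfold RB; ring
    _ ≤ F (y, t, η) * |r| + F (y, t, η) * r ^ 2 := by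
        simp only [F]
        gcongr <;> linarith
    _ = F (y, t, η) * (|r| + r ^ 2) := by ring
    _ ≤ _ := mul_le_mul_of_nonneg_right hb2 (by positivity)

theorem LB_zero {p D q α m lam θ τ y t : ℝ} : LB p D q α m lam θ τ y t 0 0 = 0 := by unfold LB; simp

theorem grad_zero_off {η : Eu d → ℝ} {x : Eu d} (hx : x ∉ tsupport η) : gradient η x = 0 := by
  have h := norm_grad η x
  have : fderiv ℝ η x = 0 := by
    by_contra h0
    exact hx (support_fderiv_subset ℝ h0)
  rw [this, norm_zero] at h
  exact norm_eq_zero.1 h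

/-- one approximation step -/
theorem step9 {p q α m lam θ τ : ℝ} (hp : 1 < p) (hd : (1:ℝ) < d) (hm : m = α + 2 * lam) (hθ : 0 < θ) (hτ : 0 < τ)
    {U η χ : Eu d → ℝ} (hU : ContDiff ℝ ∞ U) (hpos : ∀ x, 0 < U x) (hη : ContDiff ℝ 1 η) (hc : HasCompactSupport η) {M κ : ℝ} (hκ : 0 < κ) (hM : 0 ≤ M)
    (hχ : Continuous χ) (hχc : HasCompactSupport χ)
    (hRB : ∀ x ∈ tsupport η, ∀ r, RB p d q α m lam (U x) (‖gradient U x‖ ^ 2) (η x) r ≤ M * (|r| + r ^ 2))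
    (hχ1 : ∀ x ∈ tsupport η, τ < ‖gradient U x‖ ^ 2 → χ x = 1)
    (hi : Integrable (fun x => χ x ^ 2 * (divF p U x + U x ^ q) ^ 2)) (hle : ∫ x, χ x ^ 2 * (divF p U x + U x ^ q) ^ 2 ≤ κ ^ 2)
    (hLi : Integrable (fun x => LB p d q α m lam θ τ (U x) (‖gradient U x‖ ^ 2) (η x) (‖gradient η x‖ ^ 2))) :
    ∫ x, LB p d q α m lam θ τ (U x) (‖gradient U x‖ ^ 2) (η x) (‖gradient η x‖ ^ 2) ≤ M * (κ * (∫ x, χ x ^ 2) + κ + κ ^ 2) := by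
  obtain ⟨Z, z1, z2, z3⟩ := key6 (q := q) hp hd hm hθ hτ hU hpos hη hc
  have hχi : Integrable (fun x => χ x ^ 2) := cs_int (hχ.pow 2) hχc (fun x h => by simp [h])
  have hr : ∀ r : ℝ, |r| ≤ κ + r ^ 2 / κ := by
    intro r
    rw [← sub_nonneg]
    have : κ + r ^ 2 / κ - |r| = ((κ - |r|) ^ 2 + κ * |r|) / κ := by
      field_simp
      have := sq_abs r
      nlinarith
    rw [this]; positivity
  have hpt : ∀ x, LB p d q α m lam θ τ (U x) (‖gradient U x‖ ^ 2) (η x) (‖gradient η x‖ ^ 2) ≤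
      Z x + (M * κ * χ x ^ 2 + (M / κ + M) * (χ x ^ 2 * (divF p U x + U x ^ q) ^ 2)) := by
    intro x
    have h0 : 0 ≤ M * κ * χ x ^ 2 + (M / κ + M) * (χ x ^ 2 * (divF p U x + U x ^ q) ^ 2) := by positivity
    rcases le_or_gt (‖gradient U x‖ ^ 2) τ with h | h
    · linarith [(z3 x).1 h]
    · have h1 := (z3 x).2 h
      by_cases hx : x ∈ tsupport η
      · have h2 := hRB x hx (divF p U x + U x ^ q)
        rw [hχ1 x hx h] at *
        have h3 := mul_le_mul_of_nonneg_left (hr (divF p U x + U x ^ q)) hM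
        have e : M * (κ + (divF p U x + U x ^ q) ^ 2 / κ) = M * κ + M / κ * (divF p U x + U x ^ q) ^ 2 := by ring
        rw [e] at h3
        linarith
      · have : η x = 0 := image_eq_zero_of_notMem_tsupport hx
        have h2 : RB p d q α m lam (U x) (‖gradient U x‖ ^ 2) (η x) (divF p U x + U x ^ q) = 0 := by
          rw [this]; unfold RB; simp
        linarith
  have i1 : Integrable (fun x => M * κ * χ x ^ 2) := hχi.const_mul _
  have i2 : Integrable (fun x => (M / κ + M) * (χ x ^ 2 * (divF p U x + U x ^ q) ^ 2)) := hi.const_mul _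
  have := integral_mono hLi (z1.fun_add (i1.fun_add i2)) hpt
  rw [integral_add z1 (i1.fun_add i2), integral_add i1 i2, z2, integral_const_mul, integral_const_mul] at this
  have h4 : (M / κ + M) * ∫ x, χ x ^ 2 * (divF p U x + U x ^ q) ^ 2 ≤ (M / κ + M) * κ ^ 2 := by gcongr
  have e : (M / κ + M) * κ ^ 2 = M * κ + M * κ ^ 2 := by field_simp
  linarith

theorem lim9 {p q α m lam θ τ : ℝ} (hp : 1 < p) (hd : (1:ℝ) < d) (hm : m = α + 2 * lam) (hθ : 0 < θ) (hτ : 0 < τ)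
    {u η : Eu d → ℝ} (hu : ContDiff ℝ 1 u) (hpos : ∀ x, 0 < u x) (hw : Weak1 p q u) (hη : ContDiff ℝ 1 η) (hc : HasCompactSupport η) :
    ∫ x, LB p d q α m lam θ τ (u x) (‖gradient u x‖ ^ 2) (η x) (‖gradient η x‖ ^ 2) ≤ 0 := by
  have hB : IsCompact (tsupport η) := hc
  have hgu := grad_cont hu
  obtain ⟨a, ha0, ha⟩ := hB.exists_forall_le' hu.continuous.continuousOn (a := 0) (fun x _ => hpos x)
  obtain ⟨b, hb⟩ := hB.exists_bound_of_continuousOn hu.continuous.continuousOn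
  obtain ⟨N, hN⟩ := hB.exists_bound_of_continuousOn hgu.continuousOn
  obtain ⟨E, hE⟩ := hB.exists_bound_of_continuousOn hη.continuous.continuousOn
  obtain ⟨E2, hE2⟩ := hB.exists_bound_of_continuousOn (grad_cont hη).continuousOn
  obtain ⟨M, hM0, hM⟩ := RB_bd (D := d) (q := q) (α := α) (m := m) (lam := lam) (b := b + 1) (T := (N + 1) ^ 2) (N := E) hp (half_pos ha0)
  -- cutoff
  let K : Set (Eu d) := tsupport η ∩ {x | τ / 2 ≤ ‖gradient u x‖ ^ 2}
  have hK : IsCompact K := hB.inter_right (isClosed_le continuous_const (hgu.norm.pow 2))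
  have hO : IsOpen {x | gradient u x ≠ 0} := isOpen_ne_fun hgu continuous_const
  obtain ⟨χ, c1, c2, c3, c4, c5⟩ := cutoff_exists hK hO (fun x hx h0 => by
    have := hx.2
    simp only [mem_setOf_eq, h0, norm_zero] at this
    linarith)
  -- approximation
  let κ : ℕ → ℝ := fun n => 1 / (n + 1)
  have hκ : ∀ n, 0 < κ n := fun n => by positivity
  have hκlim : Tendsto κ atTop (𝓝 0) := tendsto_one_div_add_atTop_nhds_zero_nat
  choose U U1 U2 U3 U4 U5 using fun n => approx hp hu hpos hw (c1.of_le (by simp) : ContDiff ℝ 1 χ) c2 c3 hB (pow_pos (hκ n) 2)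
  have hκ2 : Tendsto (fun n => κ n ^ 2) atTop (𝓝 0) := by simpa using hκlim.pow 2
  let S : Set (ℝ × ℝ × ℝ × ℝ) := Icc (a / 2) (b + 1) ×ˢ Icc 0 ((N + 1) ^ 2) ×ˢ Icc (-E) E ×ˢ Icc 0 (E2 ^ 2)
  have hS : IsCompact S := isCompact_Icc.prod (isCompact_Icc.prod (isCompact_Icc.prod isCompact_Icc))
  have hLBc := LB_cont (D := d) (q := q) (α := α) (m := m) (lam := lam) (θ := θ) hp hτ
  obtain ⟨CL, hCL⟩ := hS.exists_bound_of_continuousOn (hLBc.mono fun v hv => lt_of_lt_of_le (half_pos ha0) hv.1.1)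
  have hin : ∀ᶠ n in atTop, ∀ x ∈ tsupport η, a / 2 ≤ U n x ∧ U n x ≤ b + 1 ∧ ‖gradient (U n) x‖ ^ 2 ≤ (N + 1) ^ 2 := by
    filter_upwards [hκ2.eventually (gt_mem_nhds (half_pos ha0)), hκ2.eventually (gt_mem_nhds one_pos)] with n h1 h2 x hx
    obtain ⟨k1, k2⟩ := U3 n x hx
    have k3 := ha x hx
    have k4 := (le_abs_self _).trans (hb x hx)
    have k5 := abs_le.1 k1
    refine ⟨by linarith, by linarith, ?_⟩
    have : ‖gradient (U n) x‖ ≤ N + 1 := by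
      have := norm_le_norm_add_norm_sub' (gradient (U n) x) (gradient u x)
      linarith [hN x hx]
    gcongr
  have hchi : ∀ᶠ n in atTop, ∀ x ∈ tsupport η, τ < ‖gradient (U n) x‖ ^ 2 → χ x = 1 := by
    have : Tendsto (fun n => κ n ^ 2 * (2 * |N| + 1)) atTop (𝓝 0) := by simpa using hκ2.mul_const (2 * |N| + 1)
    filter_upwards [this.eventually (gt_mem_nhds (half_pos hτ)), hκ2.eventually (gt_mem_nhds one_pos)] with n h1 h2 x hx hlt
    apply c4
    refine ⟨hx, ?_⟩
    obtain ⟨-, k2⟩ := U3 n x hx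
    have h3 : ‖gradient (U n) x‖ ≤ ‖gradient u x‖ + κ n ^ 2 := by
      have := norm_le_norm_add_norm_sub' (gradient (U n) x) (gradient u x)
      linarith
    have h4 : ‖gradient u x‖ ≤ |N| := (hN x hx).trans (le_abs_self N)
    have h5 : 0 ≤ κ n ^ 2 := by positivity
    have h6 : ‖gradient (U n) x‖ ^ 2 ≤ (‖gradient u x‖ + κ n ^ 2) ^ 2 := by gcongr
    have h7 : (‖gradient u x‖ + κ n ^ 2) ^ 2 ≤ ‖gradient u x‖ ^ 2 + κ n ^ 2 * (2 * |N| + 1) := by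
      have : κ n ^ 2 * ‖gradient u x‖ ≤ κ n ^ 2 * |N| := by gcongr
      have : κ n ^ 2 * κ n ^ 2 ≤ κ n ^ 2 * 1 := by gcongr
      nlinarith
    simp only [mem_setOf_eq]
    linarith
  let F : ℕ → Eu d → ℝ := fun n x => LB p d q α m lam θ τ (U n x) (‖gradient (U n) x‖ ^ 2) (η x) (‖gradient η x‖ ^ 2)
  have hFc : ∀ n, Continuous (F n) := fun n => by
    have hc1 : Continuous (fun x => ((U n x, ‖gradient (U n) x‖ ^ 2, η x, ‖gradient η x‖ ^ 2) : ℝ × ℝ × ℝ × ℝ)) :=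
      (U1 n).continuous.prodMk (((grad_cont ((U1 n).of_le (by simp))).norm.pow 2).prodMk (hη.continuous.prodMk ((grad_cont hη).norm.pow 2)))
    exact hLBc.comp_continuous hc1 fun x => U2 n x
  have hF0 : ∀ n, ∀ x ∉ tsupport η, F n x = 0 := fun n x hx => by
    simp only [F]
    rw [image_eq_zero_of_notMem_tsupport hx, grad_zero_off hx, norm_zero, zero_pow two_ne_zero, LB_zero]
  have hFi : ∀ n, Integrable (F n) := fun n => by
    refine (hFc n).integrable_of_hasCompactSupport ?_
    refine HasCompactSupport.intro hB (hF0 n)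
  have hlim : Tendsto (fun n => ∫ x, F n x) atTop (𝓝 (∫ x, LB p d q α m lam θ τ (u x) (‖gradient u x‖ ^ 2) (η x) (‖gradient η x‖ ^ 2))) := by
    refine tendsto_integral_filter_of_dominated_convergence ((tsupport η).indicator fun _ => CL) (Eventually.of_forall fun n => (hFc n).aestronglyMeasurable) ?_ ?_ ?_
    · filter_upwards [hin] with n hn
      refine Eventually.of_forall fun x => ?_
      by_cases hx : x ∈ tsupport η
      · rw [indicator_of_mem hx]
        obtain ⟨k1, k2, k3⟩ := hn x hx
        have hE2' := hE2 x hx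
        exact hCL (U n x, ‖gradient (U n) x‖ ^ 2, η x, ‖gradient η x‖ ^ 2) ⟨⟨k1, k2⟩, ⟨by positivity, k3⟩, abs_le.1 (hE x hx), ⟨by positivity, by simp only; gcongr⟩⟩
      · rw [indicator_of_notMem hx, hF0 n x hx, norm_zero]
    · exact (integrable_indicator_iff hB.measurableSet).2 (integrableOn_const hB.measure_lt_top.ne)
    · refine Eventually.of_forall fun x => ?_
      by_cases hx : x ∈ tsupport η
      · have t1 : Tendsto (fun n => U n x) atTop (𝓝 (u x)) := by
          rw [tendsto_iff_norm_sub_tendsto_zero]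
          exact squeeze_zero (fun n => norm_nonneg _) (fun n => (U3 n x hx).1) hκ2
        have t2 : Tendsto (fun n => gradient (U n) x) atTop (𝓝 (gradient u x)) := by
          rw [tendsto_iff_norm_sub_tendsto_zero]
          exact squeeze_zero (fun n => norm_nonneg _) (fun n => (U3 n x hx).2) hκ2
        have t3 : Tendsto (fun n => ((U n x, ‖gradient (U n) x‖ ^ 2, η x, ‖gradient η x‖ ^ 2) : ℝ × ℝ × ℝ × ℝ)) atTop (𝓝 (u x, ‖gradient u x‖ ^ 2, η x, ‖gradient η x‖ ^ 2)) :=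
          t1.prodMk_nhds ((t2.norm.pow 2).prodMk_nhds (tendsto_const_nhds.prodMk_nhds tendsto_const_nhds))
        have t4 : ContinuousAt (fun v : ℝ × ℝ × ℝ × ℝ => LB p d q α m lam θ τ v.1 v.2.1 v.2.2.1 v.2.2.2) (u x, ‖gradient u x‖ ^ 2, η x, ‖gradient η x‖ ^ 2) :=
          hLBc.continuousAt ((isOpen_lt continuous_const continuous_fst).mem_nhds (hpos x))
        exact t4.tendsto.comp t3
      · simp_rw [hF0 _ x hx]
        rw [image_eq_zero_of_notMem_tsupport hx, grad_zero_off hx, norm_zero, zero_pow two_ne_zero, LB_zero]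
        exact tendsto_const_nhds
  have hr0 : Tendsto (fun n => M * (κ n * (∫ x, χ x ^ 2) + κ n + κ n ^ 2)) atTop (𝓝 0) := by
    have := (((hκlim.mul_const (∫ x, χ x ^ 2)).add hκlim).add hκ2).const_mul M
    simpa using this
  refine le_of_tendsto_of_tendsto hlim hr0 ?_
  filter_upwards [hin, hchi] with n h1 h2
  refine step9 hp hd hm hθ hτ (U1 n) (U2 n) hη hc (hκ n) hM0 c1.continuous c2 (fun x hx r => ?_) h2 (U4 n) (U5 n) (hFi n)
  obtain ⟨k1, k2, k3⟩ := h1 x hx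
  exact hM _ _ _ _ k1 k2 (by positivity) k3 (hE x hx)
end part14

section part15
open scoped RealInnerProductSpace ContDiff Convolution Topology
open MeasureTheory Filter Set Metric
variable {d : ℕ}

noncomputable def LG (p D q α m lam θ G γ g y t η c2 : ℝ) : ℝ :=
  y^α*(η^2*(((α+2*lam/D-(D-1)/D*(α+q))*G*t^(p/2) + m*((p-1)/p)*(t^(p/2)*γ))*y^q/y + (-((D-1)/D*lam^2+θ)*G*(t^(p/2))^2 + (m*((p-1)/p)*(1-α)-θ)*(t^(p/2)*γ)*t^(p/2))/y^2) - η^2*(p/(p-1)*g*(y^q)^2) - (2+1/(2*(p-1))+lam^2/θ+m^2/θ)*(t^(p-1)*c2))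

theorem LB_eq {p D q α m lam θ τ y t η c2 : ℝ} : LB p D q α m lam θ τ y t η c2 = LG p D q α m lam θ (GG p τ t) (gam p τ t) (gg p τ t) y t η c2 := by
  unfold LB LG; ring

theorem LG_cont {p D q α m lam θ : ℝ} (hp : 1 < p) :
    ContinuousOn (fun v : ℝ × ℝ × ℝ × ℝ × ℝ × ℝ × ℝ => LG p D q α m lam θ v.1 v.2.1 v.2.2.1 v.2.2.2.1 v.2.2.2.2.1 v.2.2.2.2.2.1 v.2.2.2.2.2.2) {v | 0 < v.2.2.2.1} := by
  have h4 : Continuous fun t : ℝ => t ^ (p / 2) := Real.continuous_rpow_const (by linarith)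
  have h5 : Continuous fun t : ℝ => t ^ (p - 1) := Real.continuous_rpow_const (by linarith)
  have h6 : ∀ e : ℝ, ContinuousOn (fun v : ℝ × ℝ × ℝ × ℝ × ℝ × ℝ × ℝ => v.2.2.2.1 ^ e) {v | 0 < v.2.2.2.1} := fun e =>
    ContinuousOn.rpow_const (by fun_prop) fun v hv => Or.inl (ne_of_gt hv)
  have h6α := h6 α
  have h6q := h6 q
  have k1 : Continuous fun v : ℝ × ℝ × ℝ × ℝ × ℝ × ℝ × ℝ => v.2.2.2.2.1 ^ (p / 2) := h4.comp (by fun_prop)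
  have k2 : Continuous fun v : ℝ × ℝ × ℝ × ℝ × ℝ × ℝ × ℝ => v.2.2.2.2.1 ^ (p - 1) := h5.comp (by fun_prop)
  unfold LG
  refine ContinuousOn.mul h6α (ContinuousOn.sub (ContinuousOn.sub (ContinuousOn.mul (by fun_prop) (ContinuousOn.add (ContinuousOn.div ?_ (by fun_prop) fun v hv => ne_of_gt hv) (ContinuousOn.div (by fun_prop) (by fun_prop) fun v hv => pow_ne_zero _ (ne_of_gt hv)))) ?_) (by fun_prop))
  · exact ContinuousOn.mul (by fun_prop) h6q
  · exact ContinuousOn.mul (by fun_prop) (ContinuousOn.mul (by fun_prop) (h6q.pow 2))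

theorem LG_zero {p D q α m lam θ G γ g y t : ℝ} : LG p D q α m lam θ G γ g y t 0 0 = 0 := by unfold LG; simp

theorem xx_lim {p t : ℝ} (hp : 1 < p) (ht : 0 < t) : Tendsto (fun n : ℕ => xx p (1 / ((n:ℝ) + 1)) t) atTop (𝓝 0) := by
  unfold xx
  have h1 : Tendsto (fun n : ℕ => 1 / ((n:ℝ) + 1)) atTop (𝓝 0) := tendsto_one_div_add_atTop_nhds_zero_nat
  have h2 := (h1.div (tendsto_const_nhds.max h1) (by rw [max_eq_left ht.le]; exact ht.ne') : Tendsto (fun n : ℕ => (1 / ((n:ℝ) + 1)) / max t (1 / ((n:ℝ) + 1))) atTop (𝓝 (0 / max t 0)))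
  have h3 := h2.rpow_const (p := p / 2) (Or.inr (by linarith))
  rwa [zero_div, Real.zero_rpow (by linarith)] at h3

theorem lim10 {p q α m lam θ : ℝ} (hp : 1 < p) (hd : (1:ℝ) < d) (hm : m = α + 2 * lam) (hθ : 0 < θ)
    {u η : Eu d → ℝ} (hu : ContDiff ℝ 1 u) (hpos : ∀ x, 0 < u x) (hw : Weak1 p q u) (hη : ContDiff ℝ 1 η) (hc : HasCompactSupport η) :
    ∫ x, LG p d q α m lam θ 1 1 0 (u x) (‖gradient u x‖ ^ 2) (η x) (‖gradient η x‖ ^ 2) ≤ 0 := by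
  have hB : IsCompact (tsupport η) := hc
  have hgu := grad_cont hu
  obtain ⟨a, ha0, ha⟩ := hB.exists_forall_le' hu.continuous.continuousOn (a := 0) (fun x _ => hpos x)
  obtain ⟨b, hb⟩ := hB.exists_bound_of_continuousOn hu.continuous.continuousOn
  obtain ⟨N, hN⟩ := hB.exists_bound_of_continuousOn hgu.continuousOn
  obtain ⟨E, hE⟩ := hB.exists_bound_of_continuousOn hη.continuous.continuousOn
  obtain ⟨E2, hE2⟩ := hB.exists_bound_of_continuousOn (grad_cont hη).continuousOn
  let S : Set (ℝ × ℝ × ℝ × ℝ × ℝ × ℝ × ℝ) := Icc 0 1 ×ˢ Icc 0 1 ×ˢ Icc 0 1 ×ˢ Icc a b ×ˢ Icc 0 (N ^ 2) ×ˢ Icc (-E) E ×ˢ Icc 0 (E2 ^ 2)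
  have hS : IsCompact S := isCompact_Icc.prod (isCompact_Icc.prod (isCompact_Icc.prod (isCompact_Icc.prod (isCompact_Icc.prod (isCompact_Icc.prod isCompact_Icc)))))
  have hLGc := LG_cont (D := d) (q := q) (α := α) (m := m) (lam := lam) (θ := θ) hp
  obtain ⟨CL, hCL⟩ := hS.exists_bound_of_continuousOn (hLGc.mono fun v hv => lt_of_lt_of_le ha0 hv.2.2.2.1.1)
  let τ : ℕ → ℝ := fun n => 1 / ((n:ℝ) + 1)
  have hτ : ∀ n, 0 < τ n := fun n => by positivity
  let F : ℕ → Eu d → ℝ := fun n x => LB p d q α m lam θ (τ n) (u x) (‖gradient u x‖ ^ 2) (η x) (‖gradient η x‖ ^ 2)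
  have hFc : ∀ n, Continuous (F n) := fun n => by
    have hc1 : Continuous (fun x => ((u x, ‖gradient u x‖ ^ 2, η x, ‖gradient η x‖ ^ 2) : ℝ × ℝ × ℝ × ℝ)) :=
      hu.continuous.prodMk ((hgu.norm.pow 2).prodMk (hη.continuous.prodMk ((grad_cont hη).norm.pow 2)))
    exact (LB_cont hp (hτ n)).comp_continuous hc1 fun x => hpos x
  have hF0 : ∀ n, ∀ x ∉ tsupport η, F n x = 0 := fun n x hx => by
    simp only [F]
    rw [image_eq_zero_of_notMem_tsupport hx, grad_zero_off hx, norm_zero, zero_pow two_ne_zero, LB_zero]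
  have hlim : Tendsto (fun n => ∫ x, F n x) atTop (𝓝 (∫ x, LG p d q α m lam θ 1 1 0 (u x) (‖gradient u x‖ ^ 2) (η x) (‖gradient η x‖ ^ 2))) := by
    refine tendsto_integral_filter_of_dominated_convergence ((tsupport η).indicator fun _ => CL) (Eventually.of_forall fun n => (hFc n).aestronglyMeasurable) ?_ ?_ ?_
    · refine Eventually.of_forall fun n => Eventually.of_forall fun x => ?_
      by_cases hx : x ∈ tsupport η
      · rw [indicator_of_mem hx]
        have hE2' := hE2 x hx
        have hN' := hN x hx
        obtain ⟨b1, b2, b3, b4, b5, b6⟩ := cut_bounds hp (hτ n) (‖gradient u x‖ ^ 2)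
        simp only [F]
        rw [LB_eq]
        exact hCL (_, _, _, u x, ‖gradient u x‖ ^ 2, η x, ‖gradient η x‖ ^ 2) ⟨⟨b1, b2⟩, ⟨b3, b4⟩, ⟨b5, b6⟩, ⟨ha x hx, (le_abs_self _).trans (hb x hx)⟩, ⟨by positivity, by simp only; gcongr⟩, abs_le.1 (hE x hx), ⟨by positivity, by simp only; gcongr⟩⟩
      · rw [indicator_of_notMem hx, hF0 n x hx, norm_zero]
    · exact (integrable_indicator_iff hB.measurableSet).2 (integrableOn_const hB.measure_lt_top.ne)
    · refine Eventually.of_forall fun x => ?_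
      rcases eq_or_ne (gradient u x) 0 with h0 | h0
      · refine tendsto_const_nhds.congr fun n => ?_
        simp only [F, h0, norm_zero]
        rw [LB_eq]
        have e := cut_zero (p := p) (hτ n) (t := 0 ^ 2) (by have := hτ n; norm_num; exact this.le)
        rw [e.1, e.2.1, e.2.2.1]
        unfold LG
        rw [zero_pow two_ne_zero, Real.zero_rpow (by linarith : p / 2 ≠ 0)]
        ring
      · have ht : 0 < ‖gradient u x‖ ^ 2 := by have := norm_pos_iff.2 h0; positivity
        have hx := xx_lim hp ht
        have t1 : Tendsto (fun n => GG p (τ n) (‖gradient u x‖ ^ 2)) atTop (𝓝 1) := by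
          have := ((hx.const_sub 1).pow 2).mul ((hx.const_mul 2).const_add 1)
          simpa [GG, τ] using this
        have t2 : Tendsto (fun n => gam p (τ n) (‖gradient u x‖ ^ 2)) atTop (𝓝 1) := by
          have := ((hx.const_sub 1).pow 3)
          simpa [gam, τ] using this
        have t3 : Tendsto (fun n => gg p (τ n) (‖gradient u x‖ ^ 2)) atTop (𝓝 0) := by
          have := ((hx.pow 2).const_mul 6).mul (hx.const_sub 1)
          simpa [gg, τ] using this
        have t4 : ContinuousAt (fun v : ℝ × ℝ × ℝ × ℝ × ℝ × ℝ × ℝ => LG p d q α m lam θ v.1 v.2.1 v.2.2.1 v.2.2.2.1 v.2.2.2.2.1 v.2.2.2.2.2.1 v.2.2.2.2.2.2) (1, 1, 0, u x, ‖gradient u x‖ ^ 2, η x, ‖gradient η x‖ ^ 2) :=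
          hLGc.continuousAt ((isOpen_lt continuous_const (by fun_prop)).mem_nhds (hpos x))
        have t5 := t4.tendsto.comp (t1.prodMk_nhds (t2.prodMk_nhds (t3.prodMk_nhds (tendsto_const_nhds (x := ((u x, ‖gradient u x‖ ^ 2, η x, ‖gradient η x‖ ^ 2) : ℝ × ℝ × ℝ × ℝ))))))
        refine t5.congr fun n => ?_
        simp only [F, LB_eq, Function.comp]
  exact le_of_tendsto' hlim fun n => lim9 hp hd hm hθ (hτ n) hu hpos hw hη hc

/-- the integral estimate (F'), for `n`-independent constants -/
theorem Fprime {p q α m lam : ℝ} (hp : 1 < p) (hd : (1:ℝ) < d) (hm : m = α + 2 * lam)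
    (hL : 0 < α+2*lam/d-((d:ℝ)-1)/d*(α+q) + m*((p-1)/p)) (hK : 0 < -(((d:ℝ)-1)/d*lam^2) + m*((p-1)/p)*(1-α))
    {u : Eu d → ℝ} (hu : ContDiff ℝ 1 u) (hpos : ∀ x, 0 < u x) (hw : Weak1 p q u) :
    ∃ c C : ℝ, 0 < c ∧ 0 < C ∧ ∀ η : Eu d → ℝ, ContDiff ℝ 1 η → HasCompactSupport η →
     c * (∫ x, η x ^ 2 * (u x ^ (α + q - 1) * ‖gradient u x‖ ^ p + u x ^ (α - 2) * ‖gradient u x‖ ^ (2 * p)))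
       ≤ C * ∫ x, u x ^ α * ‖gradient u x‖ ^ (2 * p - 2) * ‖gradient η x‖ ^ 2 := by
  set L0 := α+2*lam/d-((d:ℝ)-1)/d*(α+q) + m*((p-1)/p) with hL0
  set K0 := -(((d:ℝ)-1)/d*lam^2) + m*((p-1)/p)*(1-α) with hK0
  have hθ : 0 < K0 / 4 := by linarith
  have hp1 : 0 < p - 1 := by linarith
  refine ⟨min L0 (K0 / 2), 2+1/(2*(p-1))+lam^2/(K0/4)+m^2/(K0/4), lt_min hL (by linarith), by positivity, fun η hη hc => ?_⟩
  have h := lim10 (q := q) hp hd hm hθ hu hpos hw hη hc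
  have hgu := grad_cont hu
  have hge := grad_cont hη
  have hcu : ∀ e : ℝ, Continuous fun x => u x ^ e := fun e => hu.continuous.rpow_const fun x => Or.inl (hpos x).ne'
  have hcw : ∀ e : ℝ, 0 ≤ e → Continuous fun x => ‖gradient u x‖ ^ e := fun e he => hgu.norm.rpow_const fun x => Or.inr he
  have u1 := hcu (α + q - 1)
  have u2 := hcu (α - 2)
  have u3 := hcu α
  have w1 := hcw p (by linarith)
  have w2 := hcw (2 * p) (by linarith)
  have w3 := hcw (2 * p - 2) (by linarith)
  have i1 : Integrable (fun x => η x ^ 2 * (u x ^ (α + q - 1) * ‖gradient u x‖ ^ p + u x ^ (α - 2) * ‖gradient u x‖ ^ (2 * p))) :=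
    cs_int (by have := hη.continuous; fun_prop) hc (fun x h => by simp [h])
  have i2 : Integrable (fun x => u x ^ α * ‖gradient u x‖ ^ (2 * p - 2) * ‖gradient η x‖ ^ 2) := by
    refine Continuous.integrable_of_hasCompactSupport (by fun_prop) (HasCompactSupport.intro hc fun x hx => ?_)
    rw [grad_zero_off hx]; simp
  have hpt : ∀ x, LG p d q α m lam (K0/4) 1 1 0 (u x) (‖gradient u x‖ ^ 2) (η x) (‖gradient η x‖ ^ 2) =
     L0 * (η x ^ 2 * (u x ^ (α + q - 1) * ‖gradient u x‖ ^ p)) + K0 / 2 * (η x ^ 2 * (u x ^ (α - 2) * ‖gradient u x‖ ^ (2 * p))) - (2+1/(2*(p-1))+lam^2/(K0/4)+m^2/(K0/4)) * (u x ^ α * ‖gradient u x‖ ^ (2 * p - 2) * ‖gradient η x‖ ^ 2) := by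
    intro x
    have hx := hpos x
    have e1 : (‖gradient u x‖ ^ 2) ^ (p / 2) = ‖gradient u x‖ ^ p := by
      rw [← Real.rpow_natCast, ← Real.rpow_mul (norm_nonneg _)]; congr 1; push_cast; ring
    have e2 : (‖gradient u x‖ ^ 2) ^ (p - 1) = ‖gradient u x‖ ^ (2 * p - 2) := by
      rw [← Real.rpow_natCast, ← Real.rpow_mul (norm_nonneg _)]; congr 1; push_cast; ring
    have e3 : ‖gradient u x‖ ^ (2 * p) = (‖gradient u x‖ ^ p) ^ 2 := by
      rw [← Real.rpow_natCast, ← Real.rpow_mul (norm_nonneg _)]; congr 1; push_cast; ring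
    have e4 : u x ^ (α + q - 1) = u x ^ α * u x ^ q / u x := by
      rw [Real.rpow_sub_one hx.ne', Real.rpow_add hx]
    have e5 : u x ^ (α - 2) = u x ^ α / u x ^ 2 := by
      rw [Real.rpow_sub hx]; norm_num
    unfold LG
    rw [e1, e2, e3, e4, e5]
    simp only [hL0]
    have : (m*((p-1)/p)*(1-α)) = K0 + (((d:ℝ)-1)/d*lam^2) := by rw [hK0]; ring
    rw [this]
    ring
  have hpt2 : ∀ x, min L0 (K0 / 2) * (η x ^ 2 * (u x ^ (α + q - 1) * ‖gradient u x‖ ^ p + u x ^ (α - 2) * ‖gradient u x‖ ^ (2 * p))) - (2+1/(2*(p-1))+lam^2/(K0/4)+m^2/(K0/4)) * (u x ^ α * ‖gradient u x‖ ^ (2 * p - 2) * ‖gradient η x‖ ^ 2) ≤ LG p d q α m lam (K0/4) 1 1 0 (u x) (‖gradient u x‖ ^ 2) (η x) (‖gradient η x‖ ^ 2) := by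
    intro x
    rw [hpt x]
    have hx := hpos x
    have a1 : min L0 (K0 / 2) * (η x ^ 2 * (u x ^ (α + q - 1) * ‖gradient u x‖ ^ p)) ≤ L0 * (η x ^ 2 * (u x ^ (α + q - 1) * ‖gradient u x‖ ^ p)) := by
      gcongr; exact min_le_left _ _
    have a2 : min L0 (K0 / 2) * (η x ^ 2 * (u x ^ (α - 2) * ‖gradient u x‖ ^ (2 * p))) ≤ (K0 / 2) * (η x ^ 2 * (u x ^ (α - 2) * ‖gradient u x‖ ^ (2 * p))) := by
      gcongr; exact min_le_right _ _
    linarith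
  have i3 : Integrable (fun x => LG p d q α m lam (K0/4) 1 1 0 (u x) (‖gradient u x‖ ^ 2) (η x) (‖gradient η x‖ ^ 2)) := by
    simp_rw [hpt]
    refine Integrable.sub (Integrable.add ?_ ?_) (i2.const_mul _)
    · exact (cs_int (by have := hη.continuous; fun_prop) hc (fun x h => by simp [h])).const_mul _
    · exact (cs_int (by have := hη.continuous; fun_prop) hc (fun x h => by simp [h])).const_mul _
  have h3 := integral_mono ((i1.const_mul _).sub (i2.const_mul _)) i3 hpt2
  rw [integral_sub' (i1.const_mul _) (i2.const_mul _), integral_const_mul, integral_const_mul] at h3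
  linarith
end part15

section part16
open scoped RealInnerProductSpace ContDiff Convolution Topology
open MeasureTheory Filter Set Metric
variable {d : ℕ}

theorem euler_int {ψ : Eu d → ℝ} (h : ContDiff ℝ 1 ψ) (hc : HasCompactSupport ψ) :
    ∫ x, (fderiv ℝ ψ x x + d * ψ x) = 0 := by
  have hfc := h.continuous_fderiv one_ne_zero
  have hco : ∀ i : Fin d, ContDiff ℝ 1 (fun x : Eu d => x i) := fun i => by fun_prop
  have h1 : ∀ i : Fin d, ∫ x, fderiv ℝ (fun x : Eu d => ψ x * x i) x (EuclideanSpace.single i 1) = 0 := fun i =>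
    int_fderiv_zero (h.mul (hco i)) (hc.mul_right) _
  have h2 : ∀ (i : Fin d) (x : Eu d), fderiv ℝ (fun x : Eu d => ψ x * x i) x (EuclideanSpace.single i 1) = fderiv ℝ ψ x (EuclideanSpace.single i 1) * x i + ψ x := by
    intro i x
    have e : fderiv ℝ (fun x : Eu d => x i) x = EuclideanSpace.proj i := (EuclideanSpace.proj (𝕜 := ℝ) i).hasFDerivAt.fderiv
    rw [fderiv_fun_mul (h.differentiable one_ne_zero x) ((hco i).differentiable one_ne_zero x), e]
    simp
    ring
  have h3 : ∀ x : Eu d, fderiv ℝ ψ x x + d * ψ x = ∑ i, fderiv ℝ (fun x : Eu d => ψ x * x i) x (EuclideanSpace.single i 1) := by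
    intro x
    simp_rw [h2]
    rw [Finset.sum_add_distrib, sum_single]; simp
  simp_rw [h3]
  rw [integral_finsetSum]
  · simp [h1]
  · intro i _
    simp_rw [h2]
    have i1 : Integrable (fun x => fderiv ℝ ψ x (EuclideanSpace.single i 1) * x i) := by
      refine Continuous.integrable_of_hasCompactSupport (by fun_prop) (HasCompactSupport.intro hc fun x hx => ?_)
      have : fderiv ℝ ψ x = 0 := by
        by_contra h0
        exact hx (support_fderiv_subset ℝ h0)
      rw [this]; simp
    exact i1.add (h.continuous.integrable_of_hasCompactSupport hc)

theorem nsq_rpow_deriv (e : ℝ) {x : Eu d} (hx : x ≠ 0) :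
    HasFDerivAt (fun y : Eu d => (‖y‖ ^ 2) ^ e) ((2 * e * (‖x‖ ^ 2) ^ (e - 1)) • innerSL ℝ x) x := by
  have h0 : 0 < ‖x‖ ^ 2 := by have := norm_pos_iff.2 hx; positivity
  have h1 := (hasStrictFDerivAt_norm_sq x).hasFDerivAt
  have h2 := (Real.hasDerivAt_rpow_const (x := ‖x‖ ^ 2) (p := e) (Or.inl h0.ne')).comp_hasFDerivAt x h1
  refine h2.congr_fderiv ?_
  ext v
  simp
  ring

theorem nsq_rpow_contDiffAt (e : ℝ) {x : Eu d} (hx : x ≠ 0) : ContDiffAt ℝ 1 (fun y : Eu d => (‖y‖ ^ 2) ^ e) x := by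
  have h0 : 0 < ‖x‖ ^ 2 := by have := norm_pos_iff.2 hx; positivity
  exact (contDiff_norm_sq ℝ).contDiffAt.rpow_const_of_ne h0.ne'

theorem radial_free {φ : Eu d → ℝ} (h : ContDiff ℝ 1 φ) (hc : HasCompactSupport φ) (h0 : φ =ᶠ[𝓝 0] 0) :
    ∫ x, (‖x‖ ^ 2) ^ (-(d:ℝ) / 2) * fderiv ℝ φ x x = 0 := by
  have hd : ContDiff ℝ 1 (fun x => φ x * (‖x‖ ^ 2) ^ (-(d:ℝ) / 2)) := by
    rw [contDiff_iff_contDiffAt]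
    intro x
    rcases eq_or_ne x 0 with rfl | hx
    · have : (fun x => φ x * (‖x‖ ^ 2) ^ (-(d:ℝ) / 2)) =ᶠ[𝓝 0] fun _ => 0 := by
        filter_upwards [h0] with x hx
        rw [hx]; simp
      exact contDiffAt_const.congr_of_eventuallyEq this
    · exact h.contDiffAt.mul (nsq_rpow_contDiffAt _ hx)
  have := euler_int hd hc.mul_right
  rw [← this]
  congr 1
  funext x
  rcases eq_or_ne x 0 with rfl | hx
  · simp [h0.self_of_nhds]
  · have hn : 0 < ‖x‖ ^ 2 := by have := norm_pos_iff.2 hx; positivity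
    rw [((h.differentiable one_ne_zero x).hasFDerivAt.fun_mul (nsq_rpow_deriv _ hx)).fderiv]
    simp only [ContinuousLinearMap.add_apply, ContinuousLinearMap.smul_apply, innerSL_apply_apply, real_inner_self_eq_norm_sq, smul_eq_mul]
    rw [Real.rpow_sub_one hn.ne']
    field_simp
    ring

/-- the fundamental-solution profile -/
theorem grad_vv {c e : ℝ} {x : Eu d} (hx : x ≠ 0) : HasGradientAt (fun y : Eu d => c * (‖y‖ ^ 2) ^ e) ((2 * c * e * (‖x‖ ^ 2) ^ (e - 1)) • x) x := by
  rw [hasGradientAt_iff_hasFDerivAt]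
  refine ((nsq_rpow_deriv e hx).const_mul c).congr_fderiv ?_
  ext v
  simp [inner_smul_left]
  ring

theorem Fp_vv {p c k : ℝ} (hp : 1 < p) (hc : 0 < c) (hk : 0 < k) (hkd : (k + 1) * (p - 1) = d - 1) {x : Eu d} (hx : x ≠ 0) :
    Fp p ((2 * c * (-k / 2) * (‖x‖ ^ 2) ^ (-k / 2 - 1)) • x) = (-(c * k) ^ (p - 1) * (‖x‖ ^ 2) ^ (-(d:ℝ) / 2)) • x := by
  have hn : 0 < ‖x‖ := norm_pos_iff.2 hx
  have e : ∀ s : ℝ, (‖x‖ ^ 2) ^ s = ‖x‖ ^ (2 * s) := fun s => by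
    rw [← Real.rpow_natCast, ← Real.rpow_mul (norm_nonneg _)]; congr 1
  unfold Fp
  rw [smul_smul, norm_smul, e, e]
  congr 1
  have h1 : ‖2 * c * (-k / 2) * ‖x‖ ^ (2 * (-k / 2 - 1))‖ * ‖x‖ = (c * k) * ‖x‖ ^ (-(k + 1)) := by
    rw [show 2 * c * (-k / 2) * ‖x‖ ^ (2 * (-k / 2 - 1)) = -((c * k) * ‖x‖ ^ (2 * (-k / 2 - 1))) by ring, norm_neg, Real.norm_of_nonneg (by positivity), mul_assoc, ← Real.rpow_add_one hn.ne']
    congr 2; ring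
  rw [h1, Real.mul_rpow (by positivity) (by positivity), ← Real.rpow_mul hn.le]
  rw [show p - 1 = (p - 2) + 1 by ring, Real.rpow_add_one (by positivity : c * k ≠ 0)]
  have h2 : ‖x‖ ^ (2 * (-(d:ℝ) / 2)) = ‖x‖ ^ (-(k + 1) * (p - 2)) * ‖x‖ ^ (2 * (-k / 2 - 1)) := by
    rw [← Real.rpow_add hn]; congr 1; linarith
  rw [h2]; ring

theorem possq_deriv (t : ℝ) : HasDerivAt (fun s : ℝ => (max s 0) ^ 2) (2 * max t 0) t := by
  refine deriv_glue (τ := 0) (f := fun s : ℝ => (max s 0) ^ 2) (g := fun t => 2 * max t 0) (by fun_prop) (by fun_prop) ?_ ?_ t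
  · intro t ht
    have e : (fun s : ℝ => (max s 0) ^ 2) =ᶠ[𝓝 t] fun s => s ^ 2 := by
      filter_upwards [lt_mem_nhds ht] with s hs
      rw [max_eq_left (le_of_lt hs)]
    refine ((hasDerivAt_pow 2 t).congr_of_eventuallyEq e).congr_deriv ?_
    rw [max_eq_left ht.le]; simp
  · intro t ht
    have e : (fun s : ℝ => (max s 0) ^ 2) =ᶠ[𝓝 t] fun s => 0 := by
      filter_upwards [gt_mem_nhds ht] with s hs
      rw [max_eq_right (le_of_lt hs)]; norm_num
    refine ((hasDerivAt_const t (0:ℝ)).congr_of_eventuallyEq e).congr_deriv ?_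
    rw [max_eq_right ht.le]; simp

theorem possq_contDiff : ContDiff ℝ 1 (fun s : ℝ => (max s 0) ^ 2) := by
  rw [contDiff_one_iff_deriv]
  refine ⟨fun t => (possq_deriv t).differentiableAt, ?_⟩
  rw [show deriv (fun s : ℝ => (max s 0) ^ 2) = fun t => 2 * max t 0 from funext fun t => (possq_deriv t).deriv]
  fun_prop

theorem compare {p q c k : ℝ} (hp : 1 < p) (hc : 0 < c) (hk : 0 < k) (hkd : (k + 1) * (p - 1) = d - 1)
    {u : Eu d → ℝ} (hu : ContDiff ℝ 1 u) (hpos : ∀ x, 0 < u x) (hw : Weak1 p q u) (hcu : ∀ x, ‖x‖ ≤ 1 → c ≤ u x) {κ : ℝ} (hκ : 0 < κ)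
    (x : Eu d) (hx : 1 < ‖x‖) : c * (‖x‖ ^ 2) ^ (-k / 2) - κ ≤ u x := by
  let g : Eu d → ℝ := fun x => c * (‖x‖ ^ 2) ^ (-k / 2) - κ - u x
  let φ : Eu d → ℝ := fun x => if 1 < ‖x‖ then (max (g x) 0) ^ 2 else 0
  have hne : ∀ x : Eu d, 1 ≤ ‖x‖ → x ≠ 0 := fun x hx h => by rw [h, norm_zero] at hx; linarith
  have hgc : ∀ x, 1 ≤ ‖x‖ → ContDiffAt ℝ 1 g x := fun x hx =>
    ((contDiffAt_const.mul (nsq_rpow_contDiffAt _ (hne x hx))).sub contDiffAt_const).sub hu.contDiffAt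
  have hopen : IsOpen {x : Eu d | 1 < ‖x‖} := isOpen_lt continuous_const continuous_norm
  have hin : ∀ x, 1 < ‖x‖ → φ =ᶠ[𝓝 x] fun y => (max (g y) 0) ^ 2 := fun x hx => by
    filter_upwards [hopen.mem_nhds hx] with y hy
    simp only [φ]; rw [if_pos hy]
  have hout : ∀ x, ‖x‖ ≤ 1 → φ =ᶠ[𝓝 x] fun _ => 0 := fun x hx => by
    rcases lt_or_eq_of_le hx with h | h
    · filter_upwards [(isOpen_lt continuous_norm continuous_const).mem_nhds h] with y hy
      simp only [φ]; rw [if_neg (not_lt.2 (le_of_lt hy))]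
    · have h1 : g x < 0 := by
        simp only [g, h]
        have := hcu x hx
        norm_num
        linarith
      filter_upwards [(hgc x h.ge).continuousAt.eventually (gt_mem_nhds h1)] with y hy
      simp only [φ]
      split_ifs
      · rw [max_eq_right hy.le]; norm_num
      · rfl
  have hφ : ContDiff ℝ 1 φ := by
    rw [contDiff_iff_contDiffAt]
    intro x
    rcases lt_or_ge 1 ‖x‖ with h | h
    · exact (possq_contDiff.contDiffAt.comp x (hgc x h.le)).congr_of_eventuallyEq (hin x h)
    · exact contDiffAt_const.congr_of_eventuallyEq (hout x h)
  have hlim : Tendsto (fun r : ℝ => c * r ^ (-(k / 2))) atTop (𝓝 0) := by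
    simpa using (tendsto_rpow_neg_atTop (half_pos hk)).const_mul c
  obtain ⟨R, hR⟩ := (hlim.eventually (gt_mem_nhds hκ)).exists_forall_of_atTop
  have hφc : HasCompactSupport φ := by
    refine HasCompactSupport.intro (isCompact_closedBall (0 : Eu d) (max R 1)) fun x hx => ?_
    have hx' : max R 1 < ‖x‖ := by simpa using hx
    have h1 : 1 < ‖x‖ := lt_of_le_of_lt (le_max_right _ _) hx'
    have h2 := hR (‖x‖ ^ 2) (by have := lt_of_le_of_lt (le_max_left _ _) hx'; nlinarith)
    simp only [φ, g]
    rw [if_pos h1, max_eq_right]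
    · norm_num
    · have := hpos x
      rw [show -k / 2 = -(k / 2) by ring]
      linarith
  have hφ0 : ∀ x, 0 ≤ φ x := fun x => by
    simp only [φ]; split_ifs <;> positivity
  have hz := radial_free hφ hφc (hout 0 (by simp))
  have hwk := hw φ hφ hφc
  have hgradφ : ∀ x, ⟪Fp p (gradient u x), gradient φ x⟫ ≤ -(c * k) ^ (p - 1) * ((‖x‖ ^ 2) ^ (-(d:ℝ) / 2) * fderiv ℝ φ x x) := by
    intro x
    rcases lt_or_ge 1 ‖x‖ with h | h
    · have hx0 := hne x h.le
      have hgg : HasGradientAt g ((2 * c * (-k / 2) * (‖x‖ ^ 2) ^ (-k / 2 - 1)) • x - gradient u x) x := by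
        have h1 := grad_vv (c := c) (e := -k / 2) hx0
        have h2 := ((hu.differentiable one_ne_zero) x).hasGradientAt
        rw [hasGradientAt_iff_hasFDerivAt] at *
        exact ((h1.sub_const κ).sub h2).congr_fderiv (by simp)
      set b := (2 * c * (-k / 2) * (‖x‖ ^ 2) ^ (-k / 2 - 1)) • x with hb
      have hFb := Fp_vv hp hc hk hkd hx0
      rw [← hb] at hFb
      have hgφ : gradient φ x = (2 * max (g x) 0) • (b - gradient u x) := by
        apply HasGradientAt.gradient
        rw [hasGradientAt_iff_hasFDerivAt] at *
        exact (((possq_deriv (g x)).comp_hasFDerivAt x hgg).congr_of_eventuallyEq (hin x h)).congr_fderiv (by simp)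
      have e : -(c * k) ^ (p - 1) * ((‖x‖ ^ 2) ^ (-(d:ℝ) / 2) * fderiv ℝ φ x x) = ⟪Fp p b, gradient φ x⟫ := by
        rw [hFb, real_inner_smul_left, inner_grad]; ring
      rw [e, ← sub_nonneg, ← inner_sub_left, hgφ, real_inner_smul_right]
      exact mul_nonneg (by positivity) (Fp_mono hp _ _)
    · have h1 := hout x h
      have : fderiv ℝ φ x = 0 := by rw [h1.fderiv_eq]; simp
      have h3 : gradient φ x = 0 := by rw [← norm_eq_zero, norm_grad, this, norm_zero]
      rw [h3, this]; simp
  have hgφc : Continuous (fun x => gradient φ x) := grad_cont hφ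
  have hI1 : Integrable (fun x => ⟪Fp p (gradient u x), gradient φ x⟫) := by
    refine Continuous.integrable_of_hasCompactSupport (((Fp_cont hp).comp (grad_cont hu)).inner hgφc) (HasCompactSupport.intro hφc fun x hx => ?_)
    rw [grad_zero_off hx]; simp
  have hI2 : Integrable (fun x => -(c * k) ^ (p - 1) * ((‖x‖ ^ 2) ^ (-(d:ℝ) / 2) * fderiv ℝ φ x x)) := by
    refine Integrable.const_mul ?_ _
    refine Continuous.integrable_of_hasCompactSupport ?_ (HasCompactSupport.intro hφc fun x hx => ?_)
    · rw [continuous_iff_continuousAt]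
      intro x
      have hfc : Continuous (fun x => fderiv ℝ φ x x) := (hφ.continuous_fderiv one_ne_zero).clm_apply continuous_id
      rcases eq_or_ne x 0 with rfl | hx
      · have h1 := (hout 0 (by simp)).fderiv (𝕜 := ℝ)
        have : (fun x => (‖x‖ ^ 2) ^ (-(d:ℝ) / 2) * fderiv ℝ φ x x) =ᶠ[𝓝 0] fun _ => 0 := by
          filter_upwards [h1] with y hy
          rw [hy]; simp
        exact continuousAt_const.congr this.symm
      · exact (nsq_rpow_contDiffAt _ hx).continuousAt.mul hfc.continuousAt
    · have := grad_zero_off hx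
      have : fderiv ℝ φ x = 0 := by rw [← norm_eq_zero, ← norm_grad, this, norm_zero]
      rw [this]; simp
  have hle := integral_mono hI1 hI2 hgradφ
  rw [integral_const_mul, hz, mul_zero, hwk] at hle
  have hcont : Continuous (fun x => u x ^ q * φ x) := (hu.continuous.rpow_const fun x => Or.inl (hpos x).ne').mul hφ.continuous
  have hnn : 0 ≤ fun x => u x ^ q * φ x := fun x => mul_nonneg (by have := hpos x; positivity) (hφ0 x)
  have hzero : ∫ x, u x ^ q * φ x = 0 := le_antisymm hle (integral_nonneg hnn)
  have hint : Integrable (fun x => u x ^ q * φ x) := cs_int hcont hφc (fun x h => by simp [h])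
  have hae := (integral_eq_zero_iff_of_nonneg hnn hint).1 hzero
  have hall := Measure.eq_of_ae_eq hae hcont continuous_const
  have hxx : u x ^ q * φ x = 0 := congrFun hall x
  have : φ x = 0 := by
    have h1 : u x ^ q ≠ 0 := by have := hpos x; positivity
    exact (mul_eq_zero.1 hxx).resolve_left h1
  simp only [φ] at this
  rw [if_pos hx] at this
  have h1 : max (g x) 0 = 0 := by simpa using this
  have h2 : g x ≤ 0 := by rw [← h1]; exact le_max_left _ _
  simp only [g] at h2
  linarith

theorem lower {p q : ℝ} (hp : 1 < p) (hpd : p < d)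
    {u : Eu d → ℝ} (hu : ContDiff ℝ 1 u) (hpos : ∀ x, 0 < u x) (hw : Weak1 p q u) :
    ∃ c, 0 < c ∧ ∀ R ≥ 1, ∀ x : Eu d, ‖x‖ ≤ R → c * R ^ (-((d - p) / (p - 1))) ≤ u x := by
  obtain ⟨c, hc0, hc⟩ := (isCompact_closedBall (0 : Eu d) 1).exists_forall_le' hu.continuous.continuousOn (a := 0) (fun x _ => hpos x)
  have hp1 : 0 < p - 1 := by linarith
  have hk : 0 < ((d:ℝ) - p) / (p - 1) := div_pos (by linarith) hp1
  refine ⟨c, hc0, fun R hR x hx => ?_⟩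
  have hR0 : 0 < R := by linarith
  rcases le_or_gt ‖x‖ 1 with h | h
  · have h1 : R ^ (-(((d:ℝ) - p) / (p - 1))) ≤ 1 := Real.rpow_le_one_of_one_le_of_nonpos hR (by linarith)
    have := hc x (by simpa using h)
    nlinarith
  · have h2 : c * (‖x‖ ^ 2) ^ (-(((d:ℝ) - p) / (p - 1)) / 2) ≤ u x := by
      refine le_of_forall_pos_le_add fun κ hκ => ?_
      have := compare hp hc0 hk (by field_simp; ring) hu hpos hw (fun y hy => hc y (by simpa using hy)) hκ x h
      linarith
    refine le_trans ?_ h2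
    have e : (‖x‖ ^ 2) ^ (-(((d:ℝ) - p) / (p - 1)) / 2) = ‖x‖ ^ (-(((d:ℝ) - p) / (p - 1))) := by
      rw [← Real.rpow_natCast, ← Real.rpow_mul (norm_nonneg _)]; congr 1; push_cast; ring
    rw [e]
    exact mul_le_mul_of_nonneg_left (Real.rpow_le_rpow_of_nonpos (one_pos.trans h) hx (neg_nonpos.2 hk.le)) hc0.le
end part16

section part17
open scoped RealInnerProductSpace ContDiff Convolution Topology
open MeasureTheory Filter Set Metric

theorem S1 {p ε : ℝ} (hp : 1 < p) (hε : 0 < ε) : ∃ C : ℝ, 0 ≤ C ∧ ∀ X Y : ℝ, 0 ≤ X → 0 ≤ Y → X ^ (p - 1) * Y ≤ ε * X ^ p + C * Y ^ p := by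
  have hpow : ∀ X : ℝ, 0 ≤ X → X ^ p = X ^ (p - 1) * X := fun X hX => by
    rw [← Real.rpow_add_one' hX (by linarith)]; ring_nf
  refine ⟨(1 / ε) ^ (p - 1), by positivity, fun X Y hX hY => ?_⟩
  rcases le_total Y (ε * X) with h | h
  · have h1 : X ^ (p - 1) * Y ≤ X ^ (p - 1) * (ε * X) := by gcongr
    have h2 : 0 ≤ (1 / ε) ^ (p - 1) * Y ^ p := by positivity
    rw [hpow X hX]; linarith
  · have h0 : X ≤ 1 / ε * Y := by rw [one_div, inv_mul_eq_div, le_div_iff₀ hε]; linarith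
    have h1 : X ^ (p - 1) ≤ (1 / ε * Y) ^ (p - 1) := Real.rpow_le_rpow hX h0 (by linarith)
    rw [Real.mul_rpow (by positivity) hY] at h1
    have h2 : X ^ (p - 1) * Y ≤ (1 / ε) ^ (p - 1) * Y ^ (p - 1) * Y := by gcongr
    have h3 : 0 ≤ ε * X ^ p := by positivity
    rw [hpow Y hY]; linarith

theorem S1' {p q ε : ℝ} (hp : 1 < p) (hε : 0 < ε) : ∃ C : ℝ, 0 ≤ C ∧ ∀ y w h : ℝ, 0 < y → 0 ≤ w → 0 ≤ h →
    y ^ (-q) * w ^ (p - 1) * h ≤ ε * (w ^ p * y ^ (-1 - q)) + C * (h ^ p * y ^ (-(q - p + 1))) := by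
  obtain ⟨C, h0, hC⟩ := S1 hp hε
  refine ⟨C, h0, fun y w h hy hw hh => ?_⟩
  have h1 := mul_le_mul_of_nonneg_right (hC (w / y) h (by positivity) hh) (by positivity : 0 ≤ y ^ (-(q - p + 1)))
  rw [Real.div_rpow hw hy.le, Real.div_rpow hw hy.le] at h1
  have e1 : y ^ (-q) = y ^ (-(q - p + 1)) / y ^ (p - 1) := by rw [← Real.rpow_sub hy]; congr 1; ring
  have e2 : y ^ (-1 - q) = y ^ (-(q - p + 1)) / y ^ p := by rw [← Real.rpow_sub hy]; congr 1; ring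
  rw [e1, e2]
  calc _ = w ^ (p - 1) / y ^ (p - 1) * h * y ^ (-(q - p + 1)) := by ring
    _ ≤ _ := h1
    _ = _ := by ring

theorem S2 {r ε : ℝ} {j : ℕ} (hj : 1 ≤ j) (hr : (j:ℝ) ≤ r) (hε : 0 < ε) : ∃ C : ℝ, 0 ≤ C ∧ ∀ a : ℝ, 0 ≤ a → a ^ j ≤ ε + C * a ^ r := by
  set t := min ε 1 with ht
  have ht0 : 0 < t := lt_min hε one_pos
  refine ⟨t ^ ((j:ℝ) - r), by positivity, fun a ha => ?_⟩
  rcases le_or_gt a t with h | h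
  · have h1 : a ^ j ≤ t ^ j := by gcongr
    have h2 : t ^ j ≤ t := by
      calc t ^ j ≤ t ^ 1 := pow_le_pow_of_le_one ht0.le (min_le_right _ _) hj
        _ = t := pow_one t
    have h3 : t ≤ ε := min_le_left _ _
    have h4 : 0 ≤ t ^ ((j:ℝ) - r) * a ^ r := by positivity
    linarith
  · have ha0 : 0 < a := ht0.trans h
    have h1 : a ^ j = a ^ ((j:ℝ) - r) * a ^ r := by
      rw [← Real.rpow_add ha0, ← Real.rpow_natCast]; congr 1; ring
    have h2 : a ^ ((j:ℝ) - r) ≤ t ^ ((j:ℝ) - r) := Real.rpow_le_rpow_of_nonpos ht0 h.le (by linarith)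
    rw [h1]
    have : a ^ ((j:ℝ) - r) * a ^ r ≤ t ^ ((j:ℝ) - r) * a ^ r := by gcongr
    linarith

/-- abbreviation: the error bound at order `j` -/
def EB (p q P : ℝ) (n j : ℕ) (E : ℝ → ℝ → ℝ) : Prop :=
  ∀ ε : ℝ, 0 < ε → ∃ C : ℝ, 0 ≤ C ∧ ∀ y g z : ℝ, 0 < y → 0 ≤ g → 0 < z → z ≤ 1 →
    z ^ (2 * n) * y ^ P * ((g / z) ^ p * y ^ (-(q - p + 1))) ^ j ≤ ε * (z ^ (2 * n) * y ^ P) + C * E y g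

theorem EB_A {p q P r : ℝ} {n j : ℕ} (hp : 1 < p) (hj : 1 ≤ j) (hr : (j:ℝ) ≤ r) (hP : (q - p + 1) * r = P) (hn : p * r ≤ 2 * n) :
    EB p q P n j (fun _ g => g ^ (p * r)) := by
  intro ε hε
  obtain ⟨C, C0, hC⟩ := S2 hj hr hε
  refine ⟨C, C0, fun y g z hy hg hz hz1 => ?_⟩
  have h1 := mul_le_mul_of_nonneg_left (hC ((g / z) ^ p * y ^ (-(q - p + 1))) (by positivity)) (by positivity : 0 ≤ z ^ (2 * n) * y ^ P)
  have h2 : z ^ (2 * n) * y ^ P * ((g / z) ^ p * y ^ (-(q - p + 1))) ^ r ≤ g ^ (p * r) := by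
    rw [Real.mul_rpow (by positivity) (by positivity), ← Real.rpow_mul (by positivity), ← Real.rpow_mul hy.le, Real.div_rpow hg hz.le]
    have e1 : y ^ (-(q - p + 1) * r) = (y ^ P)⁻¹ := by rw [← Real.rpow_neg hy.le]; congr 1; linarith
    have e2 : z ^ (2 * n) ≤ z ^ (p * r) := by
      rw [← Real.rpow_natCast]
      exact Real.rpow_le_rpow_of_exponent_ge hz hz1 (by push_cast; exact hn)
    rw [e1]
    have hyP : y ^ P ≠ 0 := by positivity
    calc _ = z ^ (2 * n) * (g ^ (p * r) / z ^ (p * r)) := by field_simp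
      _ ≤ z ^ (p * r) * (g ^ (p * r) / z ^ (p * r)) := by gcongr
      _ = _ := by field_simp
  have h3 := mul_le_mul_of_nonneg_left h2 C0
  simp only
  linarith

theorem EB_B {p q P : ℝ} {n : ℕ} (hp : 1 < p) (hn : p ≤ n) :
    EB p q P n 2 (fun y g => y ^ (P - 2 * (q - p + 1)) * g ^ (2 * p)) := by
  intro ε hε
  refine ⟨1, zero_le_one, fun y g z hy hg hz hz1 => ?_⟩
  have h0 : 0 ≤ ε * (z ^ (2 * n) * y ^ P) := by positivity
  have h2 : z ^ (2 * n) * y ^ P * ((g / z) ^ p * y ^ (-(q - p + 1))) ^ 2 ≤ y ^ (P - 2 * (q - p + 1)) * g ^ (2 * p) := by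
    have e0 : y ^ (P - 2 * (q - p + 1)) = y ^ P * (y ^ (-(q - p + 1))) ^ 2 := by
      rw [← Real.rpow_natCast (y ^ (-(q - p + 1))), ← Real.rpow_mul hy.le, ← Real.rpow_add hy]; congr 1; push_cast; ring
    have e3 : ((g / z) ^ p) ^ 2 = g ^ (2 * p) / z ^ (2 * p) := by
      rw [← Real.div_rpow hg hz.le, ← Real.rpow_natCast, ← Real.rpow_mul (by positivity)]; congr 1; push_cast; ring
    have e2 : z ^ (2 * n) ≤ z ^ (2 * p) := by
      rw [← Real.rpow_natCast]
      exact Real.rpow_le_rpow_of_exponent_ge hz hz1 (by push_cast; linarith)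
    rw [mul_pow, e0, e3]
    have hzp : z ^ (2 * p) ≠ 0 := by positivity
    calc _ = z ^ (2 * n) * (g ^ (2 * p) / z ^ (2 * p)) * (y ^ P * (y ^ (-(q - p + 1))) ^ 2) := by ring
      _ ≤ z ^ (2 * p) * (g ^ (2 * p) / z ^ (2 * p)) * (y ^ P * (y ^ (-(q - p + 1))) ^ 2) := by gcongr
      _ = _ := by field_simp
  simp only
  linarith

theorem EB_one {p q P : ℝ} {n : ℕ} {E : ℝ → ℝ → ℝ} (h : EB p q P n 2 E) : EB p q P n 1 E := by
  intro ε hε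
  obtain ⟨C, C0, hC⟩ := h (ε ^ 2 / 2) (by positivity)
  refine ⟨C / ε, by positivity, fun y g z hy hg hz hz1 => ?_⟩
  have h1 := hC y g z hy hg hz hz1
  have hW : 0 ≤ z ^ (2 * n) * y ^ P := by positivity
  generalize (g / z) ^ p * y ^ (-(q - p + 1)) = a at *
  generalize z ^ (2 * n) * y ^ P = W at *
  generalize E y g = e at *
  rw [pow_one]
  have h2 : a ≤ (ε ^ 2 / 2 + a ^ 2) / ε := by rw [le_div_iff₀ hε]; nlinarith [sq_nonneg (a - ε / 2), sq_nonneg ε]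
  have h3 := mul_le_mul_of_nonneg_left h2 hW
  have h4 : W * ((ε ^ 2 / 2 + a ^ 2) / ε) = (W * (ε ^ 2 / 2) + W * a ^ 2) / ε := by ring
  have h5 : (W * (ε ^ 2 / 2) + W * a ^ 2) / ε ≤ (W * (ε ^ 2 / 2) + (ε ^ 2 / 2 * W + C * e)) / ε := by gcongr
  have h6 : (W * (ε ^ 2 / 2) + (ε ^ 2 / 2 * W + C * e)) / ε = ε * W + C / ε * e := by field_simp; ring
  linarith

theorem P1 {p q β : ℝ} {n : ℕ} {E : ℝ → ℝ → ℝ} (hp : 1 < p) (hn : 2 ≤ n) (hE0 : ∀ y g, 0 < y → 0 ≤ g → 0 ≤ E y g) (hE : EB p q (β + q) n 1 E) {ε : ℝ} (hε : 0 < ε) :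
    ∃ C : ℝ, 0 ≤ C ∧ ∀ y w g z : ℝ, 0 < y → 0 ≤ w → 0 ≤ g → 0 ≤ z → z ≤ 1 →
      y ^ β * w ^ (p - 1) * (z ^ (2 * n - 1) * g) ≤ ε * (z ^ (2 * n) * (y ^ (β - 1) * w ^ p)) + ε * (z ^ (2 * n) * y ^ (β + q)) + C * E y g := by
  obtain ⟨C1, C10, hC1⟩ := S1' (q := q) hp hε
  obtain ⟨C2, C20, hC2⟩ := hE (ε / (C1 + 1)) (by positivity)
  refine ⟨C1 * C2, by positivity, fun y w g z hy hw hg hz hz1 => ?_⟩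
  have hE' := hE0 y g hy hg
  rcases hz.eq_or_lt with rfl | hz
  · rw [zero_pow (by omega : 2 * n - 1 ≠ 0), zero_mul, mul_zero]; positivity
  have h1 := mul_le_mul_of_nonneg_left (hC1 y w (g / z) hy hw (by positivity)) (by positivity : 0 ≤ z ^ (2 * n) * y ^ (β + q))
  have h2 := mul_le_mul_of_nonneg_left (hC2 y g z hy hg hz hz1) C10
  rw [pow_one] at h2
  have e1 : z ^ (2 * n) * y ^ (β + q) * (y ^ (-q) * w ^ (p - 1) * (g / z)) = y ^ β * w ^ (p - 1) * (z ^ (2 * n - 1) * g) := by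
    have a1 : y ^ β = y ^ (β + q) * y ^ (-q) := by rw [← Real.rpow_add hy]; congr 1; ring
    have a2 : z ^ (2 * n) = z ^ (2 * n - 1) * z := by rw [← pow_succ]; congr 1; omega
    rw [a1, a2]; field_simp
  have e2 : y ^ (β - 1) = y ^ (β + q) * y ^ (-1 - q) := by rw [← Real.rpow_add hy]; congr 1; ring
  have h3 : C1 * (ε / (C1 + 1)) ≤ ε := by
    rw [mul_div_assoc', div_le_iff₀ (by positivity)]; nlinarith
  have h4 : C1 * (ε / (C1 + 1)) * (z ^ (2 * n) * y ^ (β + q)) ≤ ε * (z ^ (2 * n) * y ^ (β + q)) := by gcongr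
  rw [e1] at h1
  rw [e2]
  linarith

theorem P2 {p q α : ℝ} {n : ℕ} {E : ℝ → ℝ → ℝ} (hp : 1 < p) (hn : 2 ≤ n) (hE0 : ∀ y g, 0 < y → 0 ≤ g → 0 ≤ E y g) (hE : EB p q (α + q + q) n 2 E) {ε : ℝ} (hε : 0 < ε) :
    ∃ C : ℝ, 0 ≤ C ∧ ∀ y w g z : ℝ, 0 < y → 0 ≤ w → 0 ≤ g → 0 ≤ z → z ≤ 1 →
      y ^ α * w ^ (2 * p - 2) * (z ^ (n - 1) * g) ^ 2 ≤ ε * (z ^ (2 * n) * (y ^ (α - 2) * w ^ (2 * p))) + ε * (z ^ (2 * n) * y ^ (α + q + q)) + C * E y g := by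
  obtain ⟨C1, C10, hC1⟩ := S1' (q := q) hp (ε := min 1 (ε / 2)) (lt_min one_pos (by positivity))
  obtain ⟨C2, C20, hC2⟩ := hE (ε / (2 * C1 ^ 2 + 1)) (by positivity)
  refine ⟨2 * C1 ^ 2 * C2, by positivity, fun y w g z hy hw hg hz hz1 => ?_⟩
  have hE' := hE0 y g hy hg
  rcases hz.eq_or_lt with rfl | hz
  · rw [zero_pow (by omega : n - 1 ≠ 0), zero_mul, zero_pow two_ne_zero, mul_zero]; positivity
  have h1 := hC1 y w (g / z) hy hw (by positivity)
  have h2 := mul_le_mul_of_nonneg_left (hC2 y g z hy hg hz hz1) (by positivity : 0 ≤ 2 * C1 ^ 2)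
  have e1 : z ^ (2 * n) * y ^ (α + q + q) * (y ^ (-q) * w ^ (p - 1) * (g / z)) ^ 2 = y ^ α * w ^ (2 * p - 2) * (z ^ (n - 1) * g) ^ 2 := by
    have a1 : y ^ α = y ^ (α + q + q) * (y ^ (-q) * y ^ (-q)) := by rw [← Real.rpow_add hy, ← Real.rpow_add hy]; congr 1; ring
    have a2 : z ^ (2 * n) = (z ^ (n - 1) * z) ^ 2 := by rw [← pow_succ, ← pow_mul]; congr 1; omega
    have a3 : w ^ (2 * p - 2) = (w ^ (p - 1)) ^ 2 := by rw [← Real.rpow_natCast, ← Real.rpow_mul hw]; congr 1; push_cast; ring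
    rw [a1, a2, a3]; field_simp
  have e2 : y ^ (α - 2) * w ^ (2 * p) = y ^ (α + q + q) * (w ^ p * y ^ (-1 - q)) ^ 2 := by
    have a1 : y ^ (α - 2) = y ^ (α + q + q) * (y ^ (-1 - q) * y ^ (-1 - q)) := by rw [← Real.rpow_add hy, ← Real.rpow_add hy]; congr 1; ring
    have a3 : w ^ (2 * p) = (w ^ p) ^ 2 := by rw [← Real.rpow_natCast, ← Real.rpow_mul hw]; congr 1; push_cast; ring
    rw [a1, a3]; ring
  have hB : 0 ≤ y ^ (-q) * w ^ (p - 1) * (g / z) := by positivity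
  have hl : 0 ≤ w ^ p * y ^ (-1 - q) := by positivity
  have hW : 0 ≤ z ^ (2 * n) * y ^ (α + q + q) := by positivity
  rw [← e1, e2]
  generalize y ^ (-q) * w ^ (p - 1) * (g / z) = B at *
  generalize w ^ p * y ^ (-1 - q) = l at *
  generalize (g / z) ^ p * y ^ (-(q - p + 1)) = a at *
  have h3 : B ^ 2 ≤ ε * l ^ 2 + 2 * C1 ^ 2 * a ^ 2 := by
    have k1 : min 1 (ε / 2) * l ≤ 1 * l := by gcongr; exact min_le_left _ _
    have k0 : 0 < min 1 (ε / 2) := lt_min one_pos (by positivity)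
    have k2 : (min 1 (ε / 2)) ^ 2 ≤ ε / 2 := by
      calc (min 1 (ε / 2)) ^ 2 = min 1 (ε / 2) * min 1 (ε / 2) := sq _
        _ ≤ 1 * (ε / 2) := mul_le_mul (min_le_left _ _) (min_le_right _ _) k0.le one_pos.le
        _ = _ := one_mul _
    have k3 : B ^ 2 ≤ (min 1 (ε / 2) * l + C1 * a) ^ 2 := by gcongr
    have k4 : (min 1 (ε / 2)) ^ 2 * l ^ 2 ≤ ε / 2 * l ^ 2 := by gcongr
    nlinarith [sq_nonneg (min 1 (ε / 2) * l - C1 * a)]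
  have h4 := mul_le_mul_of_nonneg_left h3 hW
  have h5 : 2 * C1 ^ 2 * (ε / (2 * C1 ^ 2 + 1)) ≤ ε := by
    rw [mul_div_assoc', div_le_iff₀ (by positivity)]; nlinarith
  have h6 : 2 * C1 ^ 2 * (ε / (2 * C1 ^ 2 + 1)) * (z ^ (2 * n) * y ^ (α + q + q)) ≤ ε * (z ^ (2 * n) * y ^ (α + q + q)) := by gcongr
  generalize y ^ (α + q + q) = Y at *
  linarith
end part17

section part18
open scoped RealInnerProductSpace ContDiff Convolution Topology
open MeasureTheory Filter Set Metric
variable {d : ℕ}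

theorem testN {p q β : ℝ} (hp : 1 < p) {u ψ : Eu d → ℝ} (hu : ContDiff ℝ 1 u) (hpos : ∀ x, 0 < u x) (hw : Weak1 p q u) (hψ : ContDiff ℝ 1 ψ) (hc : HasCompactSupport ψ) :
    ∫ x, ψ x * u x ^ (β + q) = β * (∫ x, ψ x * (u x ^ (β - 1) * ‖gradient u x‖ ^ p)) + ∫ x, u x ^ β * ⟪Fp p (gradient u x), gradient ψ x⟫ := by
  have hφ : ContDiff ℝ 1 (fun x => ψ x * u x ^ β) := hψ.mul (contDiff_iff_contDiffAt.2 fun x => hu.contDiffAt.rpow_const_of_ne (hpos x).ne')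
  have h := hw _ hφ hc.mul_right
  have hcu : ∀ e : ℝ, Continuous fun x => u x ^ e := fun e => hu.continuous.rpow_const fun x => Or.inl (hpos x).ne'
  have hgr : ∀ x, gradient (fun x => ψ x * u x ^ β) x = u x ^ β • gradient ψ x + (ψ x * (β * u x ^ (β - 1))) • gradient u x := by
    intro x
    apply HasGradientAt.gradient
    have h1 := (hψ.differentiable one_ne_zero x).hasGradientAt
    have h2 := (hu.differentiable one_ne_zero x).hasGradientAt
    rw [hasGradientAt_iff_hasFDerivAt] at *
    have h3 := (Real.hasDerivAt_rpow_const (x := u x) (p := β) (Or.inl (hpos x).ne')).comp_hasFDerivAt x h2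
    refine (h1.mul h3).congr_fderiv ?_
    ext v
    simp
    ring
  have e1 : ∀ x, ⟪Fp p (gradient u x), gradient (fun x => ψ x * u x ^ β) x⟫ = β * (ψ x * (u x ^ (β - 1) * ‖gradient u x‖ ^ p)) + u x ^ β * ⟪Fp p (gradient u x), gradient ψ x⟫ := by
    intro x
    rw [hgr, inner_add_right, real_inner_smul_right, real_inner_smul_right, Fp_inner hp]; ring
  have e2 : ∀ x, ψ x * u x ^ (β + q) = u x ^ q * (ψ x * u x ^ β) := fun x => by rw [Real.rpow_add (hpos x)]; ring
  simp_rw [e1] at h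
  simp_rw [e2]
  rw [← h, integral_add, integral_const_mul]
  · refine Integrable.const_mul (cs_int (hψ.continuous.mul ((hcu _).mul ((grad_cont hu).norm.rpow_const fun x => Or.inr (by linarith)))) hc fun x h => by simp [h]) _
  · refine Continuous.integrable_of_hasCompactSupport ((hcu _).mul (((Fp_cont hp).comp (grad_cont hu)).inner (grad_cont hψ))) (HasCompactSupport.intro hc fun x hx => ?_)
    rw [grad_zero_off hx]; simp

theorem grad_pow {ζ : Eu d → ℝ} (hζ : ContDiff ℝ 1 ζ) (k : ℕ) (x : Eu d) : gradient (fun x => ζ x ^ k) x = (k * ζ x ^ (k - 1)) • gradient ζ x := by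
  apply HasGradientAt.gradient
  have h1 := (hζ.differentiable one_ne_zero x).hasGradientAt
  rw [hasGradientAt_iff_hasFDerivAt] at *
  refine ((hasDerivAt_pow k (ζ x)).comp_hasFDerivAt x h1).congr_fderiv ?_
  ext v
  simp

theorem hcs_pow {ζ : Eu d → ℝ} (hc : HasCompactSupport ζ) {k : ℕ} (hk : k ≠ 0) : HasCompactSupport (fun x => ζ x ^ k) :=
  hc.mono fun x hx h => hx (by simp only [h]; exact zero_pow hk)

/-- admissible cutoff with error control -/
structure Adm (u : Eu d → ℝ) (E : ℝ → ℝ → ℝ) (ζ : Eu d → ℝ) (S : Set (Eu d)) (F : ℝ) : Prop where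
  cd : ContDiff ℝ 1 ζ
  cs : HasCompactSupport ζ
  nn : ∀ x, 0 ≤ ζ x
  le1 : ∀ x, ζ x ≤ 1
  comp : IsCompact S
  err : ∀ x, E (u x) ‖gradient ζ x‖ ≤ S.indicator (fun _ => F) x

theorem int_le_of_pt {A f g h : Eu d → ℝ} {S : Set (Eu d)} {F a b C : ℝ} (hA : Integrable A) (hf : Integrable f) (hg : Integrable g) (hS : IsCompact S)
    (hC : 0 ≤ C) (he : ∀ x, h x ≤ S.indicator (fun _ => F) x) (hpt : ∀ x, A x ≤ a * f x + b * g x + C * h x) :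
    ∫ x, A x ≤ a * (∫ x, f x) + b * (∫ x, g x) + C * (F * volume.real S) := by
  have hi : Integrable (S.indicator fun _ : Eu d => F) := (integrable_indicator_iff hS.measurableSet).2 (integrableOn_const hS.measure_lt_top.ne)
  have h2 := integral_mono hA (((hf.const_mul a).fun_add (hg.const_mul b)).fun_add (hi.const_mul C)) (fun x => (hpt x).trans (add_le_add_right (mul_le_mul_of_nonneg_left (he x) hC) _))
  rw [integral_add ((hf.const_mul a).fun_add (hg.const_mul b)) (hi.const_mul C), integral_add (hf.const_mul a) (hg.const_mul b), integral_const_mul, integral_const_mul, integral_const_mul,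
    integral_indicator hS.measurableSet, setIntegral_const, smul_eq_mul] at h2
  rw [mul_comm F]; exact h2

theorem N_est {p q β : ℝ} {n : ℕ} {E : ℝ → ℝ → ℝ} (hp : 1 < p) (hn : 2 ≤ n) (hE0 : ∀ y g, 0 < y → 0 ≤ g → 0 ≤ E y g) (hE : EB p q (β + q) n 1 E)
    {u : Eu d → ℝ} (hu : ContDiff ℝ 1 u) (hpos : ∀ x, 0 < u x) (hw : Weak1 p q u) {ε : ℝ} (hε : 0 < ε) :
    ∃ C, 0 ≤ C ∧ ∀ ζ S F, Adm u E ζ S F →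
      ∫ x, ζ x ^ (2 * n) * u x ^ (β + q) ≤ (β + ε) * (∫ x, ζ x ^ (2 * n) * (u x ^ (β - 1) * ‖gradient u x‖ ^ p)) + ε * (∫ x, ζ x ^ (2 * n) * u x ^ (β + q)) + C * (F * volume.real S) := by
  have hn0 : (0:ℝ) < 2 * n := by have : 0 < n := by omega
                                 positivity
  obtain ⟨C, C0, hC⟩ := P1 hp hn hE0 hE (ε := ε / (2 * n)) (by positivity)
  refine ⟨2 * n * C, by positivity, fun ζ S F hA => ?_⟩
  have hcs : HasCompactSupport (fun x => ζ x ^ (2 * n)) := hcs_pow hA.cs (by omega)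
  have hcd : ContDiff ℝ 1 (fun x => ζ x ^ (2 * n)) := hA.cd.pow _
  have hT := testN (β := β) hp hu hpos hw hcd hcs
  have hcu : ∀ e : ℝ, Continuous fun x => u x ^ e := fun e => hu.continuous.rpow_const fun x => Or.inl (hpos x).ne'
  have hI := int_le_of_pt (A := fun x => u x ^ β * ⟪Fp p (gradient u x), gradient (fun x => ζ x ^ (2 * n)) x⟫)
    (f := fun x => ζ x ^ (2 * n) * (u x ^ (β - 1) * ‖gradient u x‖ ^ p)) (g := fun x => ζ x ^ (2 * n) * u x ^ (β + q)) (h := fun x => E (u x) ‖gradient ζ x‖)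
    (S := S) (F := F) (a := ε) (b := ε) (C := 2 * n * C) ?_ ?_ ?_ hA.comp (by positivity) hA.err ?_
  · linarith
  · refine Continuous.integrable_of_hasCompactSupport ((hcu _).mul (((Fp_cont hp).comp (grad_cont hu)).inner (grad_cont hcd))) (HasCompactSupport.intro hcs fun x hx => ?_)
    rw [grad_zero_off hx]; simp
  · exact cs_int (hcd.continuous.mul ((hcu _).mul ((grad_cont hu).norm.rpow_const fun x => Or.inr (by linarith)))) hcs fun x h => by simp only [h, zero_mul]
  · exact cs_int (hcd.continuous.mul (hcu _)) hcs fun x h => by simp only [h, zero_mul]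
  · intro x
    have h1 := mul_le_mul_of_nonneg_left (hC (u x) ‖gradient u x‖ ‖gradient ζ x‖ (ζ x) (hpos x) (norm_nonneg _) (norm_nonneg _) (hA.nn x) (hA.le1 x)) hn0.le
    have h2 : ⟪Fp p (gradient u x), gradient (fun x => ζ x ^ (2 * n)) x⟫ ≤ ‖gradient u x‖ ^ (p - 1) * (2 * n * ζ x ^ (2 * n - 1) * ‖gradient ζ x‖) := by
      refine (real_inner_le_norm _ _).trans ?_
      have := hA.nn x
      rw [norm_Fp hp, grad_pow hA.cd, norm_smul, Real.norm_of_nonneg (by positivity)]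
      push_cast
      exact le_rfl
    have hux : 0 ≤ u x ^ β := by have := hpos x; positivity
    have h3 := mul_le_mul_of_nonneg_left h2 hux
    have e1 : 2 * (n:ℝ) * (ε / (2 * n) * (ζ x ^ (2 * n) * (u x ^ (β - 1) * ‖gradient u x‖ ^ p)) + ε / (2 * n) * (ζ x ^ (2 * n) * u x ^ (β + q)) + C * E (u x) ‖gradient ζ x‖)
      = ε * (ζ x ^ (2 * n) * (u x ^ (β - 1) * ‖gradient u x‖ ^ p)) + ε * (ζ x ^ (2 * n) * u x ^ (β + q)) + 2 * n * C * E (u x) ‖gradient ζ x‖ := by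
      field_simp
    rw [e1] at h1
    linarith

theorem K_est {p q α c C0 : ℝ} {n : ℕ} {E : ℝ → ℝ → ℝ} (hp : 1 < p) (hn : 2 ≤ n) (hE0 : ∀ y g, 0 < y → 0 ≤ g → 0 ≤ E y g) (hE : EB p q (α + q + q) n 2 E)
    {u : Eu d → ℝ} (hu : ContDiff ℝ 1 u) (hpos : ∀ x, 0 < u x) (hC0 : 0 < C0)
    (hF : ∀ η : Eu d → ℝ, ContDiff ℝ 1 η → HasCompactSupport η →
     c * (∫ x, η x ^ 2 * (u x ^ (α + q - 1) * ‖gradient u x‖ ^ p + u x ^ (α - 2) * ‖gradient u x‖ ^ (2 * p)))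
       ≤ C0 * ∫ x, u x ^ α * ‖gradient u x‖ ^ (2 * p - 2) * ‖gradient η x‖ ^ 2) {ε : ℝ} (hε : 0 < ε) :
    ∃ C, 0 ≤ C ∧ ∀ ζ S F, Adm u E ζ S F →
      c * ((∫ x, ζ x ^ (2 * n) * (u x ^ (α + q - 1) * ‖gradient u x‖ ^ p)) + ∫ x, ζ x ^ (2 * n) * (u x ^ (α - 2) * ‖gradient u x‖ ^ (2 * p))) ≤
        ε * (∫ x, ζ x ^ (2 * n) * (u x ^ (α - 2) * ‖gradient u x‖ ^ (2 * p))) + ε * (∫ x, ζ x ^ (2 * n) * u x ^ (α + q + q)) + C * (F * volume.real S) := by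
  have hn0 : (0:ℝ) < n := by have : 0 < n := by omega
                             positivity
  have hnn : 0 < C0 * (n:ℝ) ^ 2 := by positivity
  obtain ⟨C, C00, hC⟩ := P2 hp hn hE0 hE (ε := ε / (C0 * (n:ℝ) ^ 2)) (by positivity)
  refine ⟨C0 * (n:ℝ) ^ 2 * C, by positivity, fun ζ S F hA => ?_⟩
  have hcs : HasCompactSupport (fun x => ζ x ^ (2 * n)) := hcs_pow hA.cs (by omega)
  have hcs1 : HasCompactSupport (fun x => ζ x ^ n) := hcs_pow hA.cs (by omega)
  have hcd : ContDiff ℝ 1 (fun x => ζ x ^ (2 * n)) := hA.cd.pow _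
  have hcd1 : ContDiff ℝ 1 (fun x => ζ x ^ n) := hA.cd.pow _
  have hcu : ∀ e : ℝ, Continuous fun x => u x ^ e := fun e => hu.continuous.rpow_const fun x => Or.inl (hpos x).ne'
  have hcw : ∀ e : ℝ, 0 ≤ e → Continuous fun x => ‖gradient u x‖ ^ e := fun e he => (grad_cont hu).norm.rpow_const fun x => Or.inr he
  have hT := hF _ hcd1 hcs1
  have iL : Integrable fun x => ζ x ^ (2 * n) * (u x ^ (α + q - 1) * ‖gradient u x‖ ^ p) :=
    cs_int (hcd.continuous.mul ((hcu _).mul (hcw _ (by linarith)))) hcs fun x h => by simp only [h, zero_mul]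
  have iK : Integrable fun x => ζ x ^ (2 * n) * (u x ^ (α - 2) * ‖gradient u x‖ ^ (2 * p)) :=
    cs_int (hcd.continuous.mul ((hcu _).mul (hcw _ (by linarith)))) hcs fun x h => by simp only [h, zero_mul]
  have iN : Integrable fun x => ζ x ^ (2 * n) * u x ^ (α + q + q) := cs_int (hcd.continuous.mul (hcu _)) hcs fun x h => by simp only [h, zero_mul]
  have e0 : ∀ x, (ζ x ^ n) ^ 2 * (u x ^ (α + q - 1) * ‖gradient u x‖ ^ p + u x ^ (α - 2) * ‖gradient u x‖ ^ (2 * p)) = ζ x ^ (2 * n) * (u x ^ (α + q - 1) * ‖gradient u x‖ ^ p) + ζ x ^ (2 * n) * (u x ^ (α - 2) * ‖gradient u x‖ ^ (2 * p)) := by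
    intro x; rw [mul_comm 2 n, pow_mul]; ring
  simp_rw [e0] at hT
  rw [integral_add iL iK] at hT
  have hI := int_le_of_pt (A := fun x => u x ^ α * ‖gradient u x‖ ^ (2 * p - 2) * ‖gradient (fun x => ζ x ^ n) x‖ ^ 2)
    (h := fun x => E (u x) ‖gradient ζ x‖)
    (S := S) (F := F) (a := ε / C0) (b := ε / C0) (C := (n:ℝ) ^ 2 * C) ?_ iK iN hA.comp (by positivity) hA.err ?_
  · refine hT.trans ((mul_le_mul_of_nonneg_left hI hC0.le).trans (le_of_eq ?_))
    field_simp
  · refine Continuous.integrable_of_hasCompactSupport (((hcu _).mul (hcw _ (by linarith))).mul ((grad_cont hcd1).norm.pow 2)) (HasCompactSupport.intro hcs1 fun x hx => ?_)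
    rw [grad_zero_off hx]; simp
  · intro x
    have h1 := mul_le_mul_of_nonneg_left (hC (u x) ‖gradient u x‖ ‖gradient ζ x‖ (ζ x) (hpos x) (norm_nonneg _) (norm_nonneg _) (hA.nn x) (hA.le1 x)) (sq_nonneg (n:ℝ))
    have h2 : ‖gradient (fun x => ζ x ^ n) x‖ = n * (ζ x ^ (n - 1) * ‖gradient ζ x‖) := by
      have := hA.nn x
      rw [grad_pow hA.cd, norm_smul, Real.norm_of_nonneg (by positivity)]; ring
    rw [h2]
    refine le_trans (le_of_eq ?_) (h1.trans (le_of_eq ?_))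
    · ring
    · field_simp

theorem fin1 {p q b : ℝ} {n : ℕ} {E : ℝ → ℝ → ℝ} (hp : 1 < p) (hn : 2 ≤ n) (hb : 0 < b) (hE0 : ∀ y g, 0 < y → 0 ≤ g → 0 ≤ E y g) (hE : EB p q (-b + q) n 1 E)
    {u : Eu d → ℝ} (hu : ContDiff ℝ 1 u) (hpos : ∀ x, 0 < u x) (hw : Weak1 p q u) :
    ∃ C, 0 ≤ C ∧ ∀ ζ S F, Adm u E ζ S F → ∫ x, ζ x ^ (2 * n) * u x ^ (-b + q) ≤ C * (F * volume.real S) := by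
  obtain ⟨C, C0, hC⟩ := N_est hp hn hE0 hE hu hpos hw (ε := min b (1 / 2)) (lt_min hb (by norm_num))
  refine ⟨2 * C, by positivity, fun ζ S F hA => ?_⟩
  have h := hC ζ S F hA
  have hN : 0 ≤ ∫ x, ζ x ^ (2 * n) * u x ^ (-b + q) := integral_nonneg fun x => by have := hA.nn x; have := hpos x; simp only; positivity
  have hL : 0 ≤ ∫ x, ζ x ^ (2 * n) * (u x ^ (-b - 1) * ‖gradient u x‖ ^ p) := integral_nonneg fun x => by have := hA.nn x; have := hpos x; simp only; positivity
  have h1 : (-b + min b (1 / 2)) * (∫ x, ζ x ^ (2 * n) * (u x ^ (-b - 1) * ‖gradient u x‖ ^ p)) ≤ 0 :=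
    mul_nonpos_of_nonpos_of_nonneg (by linarith [min_le_left b (1 / 2)]) hL
  have h2 : min b (1 / 2) * (∫ x, ζ x ^ (2 * n) * u x ^ (-b + q)) ≤ 1 / 2 * (∫ x, ζ x ^ (2 * n) * u x ^ (-b + q)) := by
    gcongr; exact min_le_right _ _
  linarith

theorem fin2_arith {c N L K X β C1 C2 ε : ℝ} (hc : 0 < c) (hL : 0 ≤ L) (hK : 0 ≤ K) (hN : 0 ≤ N) (h1 : N ≤ (β + 1 / 2) * L + 1 / 2 * N + C1 * X)
    (hε : ε = c / (4 * (|β| + 1))) (h2 : c * (L + K) ≤ ε * K + ε * N + C2 * X) :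
    N ≤ (2 * C1 + 2 * (|β| + 1) * ((2 / c) * (C2 + c / 2 * C1 * (1 / (|β| + 1))))) * X := by
  have hβ := le_abs_self β
  have hb : 0 ≤ |β| := abs_nonneg β
  have h3 : N ≤ 2 * (|β| + 1) * L + 2 * C1 * X := by
    have : (β + 1 / 2) * L ≤ (|β| + 1) * L := by gcongr; linarith
    linarith
  have hε0 : 0 < ε := by rw [hε]; positivity
  have hεc : ε ≤ c := by
    rw [hε, div_le_iff₀ (by positivity)]; nlinarith
  have h4 : ε * K ≤ c * K := by gcongr
  have h5 : ε * N ≤ c / 2 * L + c / 2 * C1 * (1 / (|β| + 1)) * X := by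
    have := mul_le_mul_of_nonneg_left h3 hε0.le
    refine this.trans (le_of_eq ?_)
    rw [hε]; field_simp; ring
  have h6 : c / 2 * L ≤ (C2 + c / 2 * C1 * (1 / (|β| + 1))) * X := by linarith
  have h7 : L ≤ (2 / c) * ((C2 + c / 2 * C1 * (1 / (|β| + 1))) * X) := by
    have := mul_le_mul_of_nonneg_left h6 (by positivity : 0 ≤ 2 / c)
    refine le_trans (le_of_eq ?_) this
    field_simp
  have h8 := mul_le_mul_of_nonneg_left h7 (by positivity : 0 ≤ 2 * (|β| + 1))
  linarith

theorem fin2 {p q α c C0 : ℝ} {n : ℕ} {E : ℝ → ℝ → ℝ} (hp : 1 < p) (hn : 2 ≤ n) (hE0 : ∀ y g, 0 < y → 0 ≤ g → 0 ≤ E y g) (hE : EB p q (α + q + q) n 2 E)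
    {u : Eu d → ℝ} (hu : ContDiff ℝ 1 u) (hpos : ∀ x, 0 < u x) (hw : Weak1 p q u) (hc : 0 < c) (hC0 : 0 < C0)
    (hF : ∀ η : Eu d → ℝ, ContDiff ℝ 1 η → HasCompactSupport η →
     c * (∫ x, η x ^ 2 * (u x ^ (α + q - 1) * ‖gradient u x‖ ^ p + u x ^ (α - 2) * ‖gradient u x‖ ^ (2 * p)))
       ≤ C0 * ∫ x, u x ^ α * ‖gradient u x‖ ^ (2 * p - 2) * ‖gradient η x‖ ^ 2) :
    ∃ C, 0 ≤ C ∧ ∀ ζ S F, Adm u E ζ S F → ∫ x, ζ x ^ (2 * n) * u x ^ (α + q + q) ≤ C * (F * volume.real S) := by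
  obtain ⟨C1, C10, hC1⟩ := N_est (β := α + q) hp hn hE0 (EB_one hE) hu hpos hw (ε := 1 / 2) (by norm_num)
  obtain ⟨C2, C20, hC2⟩ := K_est hp hn hE0 hE hu hpos hC0 hF (ε := c / (4 * (|α + q| + 1))) (by positivity)
  refine ⟨_, ?_, fun ζ S F hA => fin2_arith hc ?_ ?_ ?_ (hC1 ζ S F hA) rfl (hC2 ζ S F hA)⟩
  · positivity
  all_goals exact integral_nonneg fun x => by have := hA.nn x; have := hpos x; simp only; positivity

theorem cutoffs (d : ℕ) : ∃ C0 : ℝ, 0 < C0 ∧ ∀ R : ℝ, 1 ≤ R → ∃ ζ : Eu d → ℝ, ContDiff ℝ 1 ζ ∧ HasCompactSupport ζ ∧ (∀ x, 0 ≤ ζ x ∧ ζ x ≤ 1) ∧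
    (∀ x, ‖x‖ ≤ 1 → ζ x = 1) ∧ (∀ x, ‖gradient ζ x‖ ≤ C0 / R) ∧ ∀ x, x ∉ closedBall (0 : Eu d) (2 * R) → gradient ζ x = 0 := by
  obtain ⟨χ, c1, c2, c3, c4, c5⟩ := cutoff_exists (isCompact_closedBall (0 : Eu d) 1) (isOpen_ball (x := (0 : Eu d)) (ε := 2)) (closedBall_subset_ball (by norm_num))
  have c1' : ContDiff ℝ 1 χ := c1.of_le (by simp)
  have hfc := c1'.continuous_fderiv one_ne_zero
  obtain ⟨B, hB⟩ := hfc.norm.bounded_above_of_compact_support (c2.fderiv ℝ).norm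
  refine ⟨max B 1, lt_max_of_lt_right one_pos, fun R hR => ⟨fun x => χ (R⁻¹ • x), c1'.comp (contDiff_const_smul _), ?_, fun x => c5 _, ?_, ?_⟩⟩
  · exact c2.comp_smul (inv_ne_zero (by positivity))
  · intro x hx
    apply c4
    rw [mem_closedBall_zero_iff, norm_smul, norm_inv, Real.norm_of_nonneg (by linarith)]
    rw [inv_mul_le_iff₀ (by linarith)]; linarith
  · have hfd : ∀ x, fderiv ℝ (fun x => χ (R⁻¹ • x)) x = R⁻¹ • fderiv ℝ χ (R⁻¹ • x) := by
      intro x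
      have h1 : HasFDerivAt (fun x : Eu d => R⁻¹ • x) (R⁻¹ • ContinuousLinearMap.id ℝ (Eu d)) x := (hasFDerivAt_id x).const_smul R⁻¹
      have h2 := ((c1'.differentiable one_ne_zero (R⁻¹ • x)).hasFDerivAt.comp x h1).fderiv
      rw [show (fun x => χ (R⁻¹ • x)) = χ ∘ (fun x => R⁻¹ • x) from rfl, h2]
      ext v; simp
    constructor
    · intro x
      rw [norm_grad, hfd, norm_smul, norm_inv, Real.norm_of_nonneg (by linarith), inv_mul_eq_div]
      have := hB (R⁻¹ • x)
      rw [norm_norm] at this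
      gcongr
      exact this.trans (le_max_left _ _)
    · intro x hx
      have h0 : R⁻¹ • x ∉ tsupport χ := fun h => by
        have h1 := c3 h
        rw [mem_ball_zero_iff, norm_smul, norm_inv, Real.norm_of_nonneg (by linarith), inv_mul_lt_iff₀ (by linarith)] at h1
        apply hx
        rw [mem_closedBall_zero_iff]; linarith
      rw [← norm_eq_zero, norm_grad, hfd]
      have : fderiv ℝ χ (R⁻¹ • x) = 0 := by
        by_contra h
        exact h0 (support_fderiv_subset ℝ h)
      rw [this]; simp

theorem vol_ball (d : ℕ) (R : ℝ) (hR : 0 ≤ R) : volume.real (closedBall (0 : Eu d) R) = R ^ d * volume.real (closedBall (0 : Eu d) 1) := by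
  have := Measure.addHaar_closedBall' (volume : Measure (Eu d)) 0 hR
  rw [finrank_euclideanSpace_fin] at this
  rw [measureReal_def, this, ENNReal.toReal_mul, ENNReal.toReal_ofReal (by positivity), measureReal_def]

/-- conclusion: an error decaying faster than `R^{-d}` is contradictory -/
theorem contra {P s : ℝ} {n : ℕ} {E : ℝ → ℝ → ℝ} {u : Eu d → ℝ} (hu : ContDiff ℝ 1 u) (hpos : ∀ x, 0 < u x) (hE00 : ∀ y, 0 < y → E y 0 = 0)
    (hs : s + d < 0) (hn : n ≠ 0)
    (hM : ∀ C0 : ℝ, 0 < C0 → ∃ M, ∀ R : ℝ, 1 ≤ R → ∀ x : Eu d, ‖x‖ ≤ 2 * R → ∀ g, 0 ≤ g → g ≤ C0 / R → E (u x) g ≤ M * R ^ s)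
    (hmain : ∃ C, 0 ≤ C ∧ ∀ ζ S F, Adm u E ζ S F → ∫ x, ζ x ^ (2 * n) * u x ^ P ≤ C * (F * volume.real S)) : False := by
  obtain ⟨C, hC0, hC⟩ := hmain
  obtain ⟨C0, C00, hcut⟩ := cutoffs d
  obtain ⟨M, hM⟩ := hM C0 C00
  have hcu : Continuous fun x => u x ^ P := hu.continuous.rpow_const fun x => Or.inl (hpos x).ne'
  have hlow : 0 < ∫ x in closedBall (0 : Eu d) 1, u x ^ P := by
    rw [setIntegral_pos_iff_support_of_nonneg_ae]
    · have : Function.support (fun x => u x ^ P) = univ := by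
        ext x; have := hpos x; simp; positivity
      rw [this, univ_inter]
      exact measure_closedBall_pos _ _ one_pos
    · exact Eventually.of_forall fun x => by have := hpos x; simp only [Pi.zero_apply]; positivity
    · exact hcu.continuousOn.integrableOn_compact (isCompact_closedBall _ _)
  have hb : ∀ R : ℝ, 1 ≤ R → ∫ x in closedBall (0 : Eu d) 1, u x ^ P ≤ C * M * 2 ^ d * volume.real (closedBall (0 : Eu d) 1) * R ^ (s + d) := by
    intro R hR
    have hR0 : 0 < R := by linarith
    obtain ⟨ζ, z1, z2, z3, z4, z5, z6⟩ := hcut R hR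
    have hA : Adm u E ζ (closedBall 0 (2 * R)) (M * R ^ s) := by
      refine ⟨z1, z2, fun x => (z3 x).1, fun x => (z3 x).2, isCompact_closedBall _ _, fun x => ?_⟩
      by_cases hx : x ∈ closedBall (0 : Eu d) (2 * R)
      · rw [indicator_of_mem hx]
        exact hM R hR x (by simpa using hx) _ (norm_nonneg _) (z5 x)
      · rw [indicator_of_notMem hx, z6 x hx, norm_zero, hE00 _ (hpos x)]
    have h1 := hC _ _ _ hA
    rw [vol_ball d _ (by linarith)] at h1
    have hi : Integrable (fun x => ζ x ^ (2 * n) * u x ^ P) := cs_int ((z1.continuous.pow _).mul hcu) z2 fun x h => by rw [h, zero_pow (by omega), zero_mul]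
    have h2 : ∫ x in closedBall (0 : Eu d) 1, u x ^ P ≤ ∫ x, ζ x ^ (2 * n) * u x ^ P := by
      rw [← integral_indicator measurableSet_closedBall]
      refine integral_mono ((integrable_indicator_iff measurableSet_closedBall).2 (hcu.continuousOn.integrableOn_compact (isCompact_closedBall _ _))) hi fun x => ?_
      by_cases hx : x ∈ closedBall (0 : Eu d) 1
      · rw [indicator_of_mem hx, z4 x (by simpa using hx)]; simp
      · rw [indicator_of_notMem hx]
        have := (z3 x).1; have := hpos x
        positivity
    refine h2.trans (h1.trans (le_of_eq ?_))
    rw [Real.rpow_add hR0, Real.rpow_natCast, mul_pow]; ring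
  have ht : Tendsto (fun R : ℝ => C * M * 2 ^ d * volume.real (closedBall (0 : Eu d) 1) * R ^ (s + d)) atTop (𝓝 0) := by
    have := (tendsto_rpow_neg_atTop (neg_pos.2 hs)).const_mul (C * M * 2 ^ d * volume.real (closedBall (0 : Eu d) 1))
    simpa using this
  have := ge_of_tendsto ht ((eventually_ge_atTop (1:ℝ)).mono hb)
  linarith
end part18

section part19
open scoped RealInnerProductSpace ContDiff Convolution Topology
open MeasureTheory Filter Set Metric
variable {d : ℕ}

theorem powM {r : ℝ} (hr : 0 < r) {u : Eu d → ℝ} (C0 : ℝ) (hC : 0 < C0) :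
    ∃ M, ∀ R : ℝ, 1 ≤ R → ∀ x : Eu d, ‖x‖ ≤ 2 * R → ∀ g, 0 ≤ g → g ≤ C0 / R → (fun _ g => g ^ r : ℝ → ℝ → ℝ) (u x) g ≤ M * R ^ (-r) := by
  refine ⟨C0 ^ r, fun R hR x _ g hg hgC => ?_⟩
  have h := Real.rpow_le_rpow hg hgC hr.le
  rw [Real.div_rpow hC.le (by linarith)] at h
  rw [Real.rpow_neg (by linarith), ← div_eq_mul_inv]
  exact h

theorem case1 {p q : ℝ} (hp : 1 < p) (hpd : p < d) (hq1 : p - 1 < q) (hqs : q * (d - p) < d * (p - 1))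
    {u : Eu d → ℝ} (hu : ContDiff ℝ 1 u) (hpos : ∀ x, 0 < u x) (hw : Weak1 p q u) : False := by
  obtain ⟨b, hb0, hb1, hb2⟩ : ∃ b : ℝ, 0 < b ∧ b ≤ p - 1 ∧ (d:ℝ) * (q - p + 1) < p * (q - b) := by
    refine ⟨min (p - 1) ((p * q - d * (q - p + 1)) / (2 * p)), lt_min (by linarith) (div_pos (by nlinarith) (by linarith)), min_le_left _ _, ?_⟩
    have h : min (p - 1) ((p * q - d * (q - p + 1)) / (2 * p)) ≤ (p * q - d * (q - p + 1)) / (2 * p) := min_le_right _ _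
    rw [le_div_iff₀ (by linarith)] at h
    have : 0 < p * q - d * (q - p + 1) := by nlinarith
    nlinarith
  have hδ : 0 < q - p + 1 := by linarith
  set r := (q - b) / (q - p + 1) with hr
  have hr1 : 1 ≤ r := by rw [hr, one_le_div hδ]; linarith
  have hpr : (d:ℝ) < p * r := by rw [hr, ← mul_div_assoc, lt_div_iff₀ hδ]; exact hb2
  have hpr0 : 0 < p * r := by positivity
  obtain ⟨n, hn⟩ := exists_nat_ge (p * r)
  have hn2 : p * r ≤ 2 * ((n + 2 : ℕ) : ℝ) := by push_cast; linarith [(Nat.cast_nonneg n : (0:ℝ) ≤ n)]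
  have hE := EB_A (q := q) (P := -b + q) (n := n + 2) (j := 1) hp le_rfl (r := r) (by simpa using hr1) (by rw [hr]; field_simp; ring) hn2
  exact contra (E := fun _ g => g ^ (p * r)) (s := -(p * r)) (n := n + 2) hu hpos (fun y hy => Real.zero_rpow hpr0.ne') (by linarith) (by omega) (powM (u := u) hpr0)
    (fin1 hp (by omega) hb0 (fun y g _ hg => Real.rpow_nonneg hg _) hE hu hpos hw)

theorem exps {p q D : ℝ} (hp : 1 < p) (hpd : p < D) (hq1 : p - 1 < q) (hq2 : q * (D - p) < p * D - (D - p)) (hqs : D * (p - 1) ≤ q * (D - p)) :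
    ∃ m α lam : ℝ, m = α + 2 * lam ∧ 0 < α + 2 * lam / D - (D - 1) / D * (α + q) + m * ((p - 1) / p) ∧
      0 < -((D - 1) / D * lam ^ 2) + m * ((p - 1) / p) * (1 - α) ∧ D * (q - p + 1) < p * (α + q + q) ∧ -(D * (p - 1)) < α * (D - p) := by
  have hD1 : 0 < D - 1 := by linarith
  have hDp : 0 < D - p := by linarith
  have hD : 0 < D := by linarith
  have hp0 : 0 < p := by linarith
  -- `m = t * m1`
  obtain ⟨t, ht0, ht1, h1, h2, h3⟩ : ∃ t : ℝ, 0 < t ∧ t < 1 ∧ q * (D - p) < t * (p * D - (D - p)) ∧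
      D * (q - p + 1) * (D - p) < p * (t * (2 * D - p - p * D) + 2 * q * (D - p)) ∧ -(D * (p - 1)) < t * (2 * D - p - p * D) := by
    have e1 : ∀ᶠ t in 𝓝[<] (1:ℝ), 0 < t := by
      apply eventually_nhdsWithin_of_eventually_nhds; exact lt_mem_nhds one_pos
    have e2 : ∀ᶠ t in 𝓝[<] (1:ℝ), t < 1 := eventually_mem_nhdsWithin
    have e3 : ∀ᶠ t in 𝓝[<] (1:ℝ), q * (D - p) < t * (p * D - (D - p)) := by
      apply eventually_nhdsWithin_of_eventually_nhds
      exact (Continuous.continuousAt (by fun_prop)).eventually_const_lt (by linarith)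
    have e4 : ∀ᶠ t in 𝓝[<] (1:ℝ), D * (q - p + 1) * (D - p) < p * (t * (2 * D - p - p * D) + 2 * q * (D - p)) := by
      apply eventually_nhdsWithin_of_eventually_nhds
      refine (Continuous.continuousAt (by fun_prop)).eventually_const_lt ?_
      rcases le_total (2 * p) D with h | h
      · nlinarith [mul_le_mul_of_nonneg_left hq2.le (sub_nonneg.2 h), mul_pos hp0 hp0]
      · nlinarith [mul_le_mul_of_nonneg_left hqs (sub_nonneg.2 h), mul_pos hp0 hDp]
    have e5 : ∀ᶠ t in 𝓝[<] (1:ℝ), -(D * (p - 1)) < t * (2 * D - p - p * D) := by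
      apply eventually_nhdsWithin_of_eventually_nhds
      exact (Continuous.continuousAt (by fun_prop)).eventually_const_lt (by linarith)
    obtain ⟨t, h⟩ := (e1.and (e2.and (e3.and (e4.and e5)))).exists
    exact ⟨t, h⟩
  refine ⟨t * (p * (D - 1) / (D - p)), t * (2 * D - p - p * D) / (D - p), t * (D * (p - 1)) / (D - p), ?_, ?_, ?_, ?_, ?_⟩
  · field_simp; ring
  · have : t * (2 * D - p - p * D) / (D - p) + 2 * (t * (D * (p - 1)) / (D - p)) / D - (D - 1) / D * (t * (2 * D - p - p * D) / (D - p) + q) + t * (p * (D - 1) / (D - p)) * ((p - 1) / p)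
      = (D - 1) / (D * (D - p)) * (t * (p * D - (D - p)) - q * (D - p)) := by
      field_simp; ring
    rw [this]
    exact mul_pos (by positivity) (by linarith)
  · have : -((D - 1) / D * (t * (D * (p - 1)) / (D - p)) ^ 2) + t * (p * (D - 1) / (D - p)) * ((p - 1) / p) * (1 - t * (2 * D - p - p * D) / (D - p))
      = t * (D - 1) * (p - 1) / (D - p) * (1 - t) := by
      field_simp; ring
    rw [this]
    exact mul_pos (div_pos (mul_pos (mul_pos ht0 hD1) (by linarith)) hDp) (by linarith)
  · have : p * (t * (2 * D - p - p * D) / (D - p) + q + q) = p * (t * (2 * D - p - p * D) + 2 * q * (D - p)) / (D - p) := by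
      field_simp; ring
    rw [this, lt_div_iff₀ hDp]; exact h2
  · rw [div_mul_cancel₀ _ hDp.ne']; exact h3

theorem case2 {p q : ℝ} (hp : 1 < p) (hpd : p < d) (hq1 : p - 1 < q) (hq2 : q * (d - p) < p * d - (d - p)) (hqs : d * (p - 1) ≤ q * (d - p))
    {u : Eu d → ℝ} (hu : ContDiff ℝ 1 u) (hpos : ∀ x, 0 < u x) (hw : Weak1 p q u) : False := by
  obtain ⟨m, α, lam, hm, hL, hK, hA, hB⟩ := exps hp hpd hq1 hq2 hqs
  obtain ⟨c, C0, hc, hC0, hF⟩ := Fprime hp (by linarith) hm hL hK hu hpos hw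
  have hδ : 0 < q - p + 1 := by linarith
  have hp0 : 0 < p := by linarith
  rcases le_or_gt 0 (α + 2 * p - 2) with he | he
  · set r := (α + q + q) / (q - p + 1) with hr
    have hr1 : 2 ≤ r := by rw [hr, le_div_iff₀ hδ]; linarith
    have hpr : (d:ℝ) < p * r := by rw [hr, ← mul_div_assoc, lt_div_iff₀ hδ]; exact hA
    have hpr0 : 0 < p * r := by positivity
    obtain ⟨n, hn⟩ := exists_nat_ge (p * r)
    have hn2 : p * r ≤ 2 * ((n + 2 : ℕ) : ℝ) := by push_cast; linarith [(Nat.cast_nonneg n : (0:ℝ) ≤ n)]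
    have hE := EB_A (q := q) (P := α + q + q) (n := n + 2) (j := 2) hp (by norm_num) (r := r) (by simpa using hr1) (by rw [hr]; field_simp) hn2
    exact contra (E := fun _ g => g ^ (p * r)) (s := -(p * r)) (n := n + 2) hu hpos (fun y hy => Real.zero_rpow hpr0.ne') (by linarith) (by omega) (powM (u := u) hpr0)
      (fin2 hp (by omega) (fun y g _ hg => Real.rpow_nonneg hg _) hE hu hpos hw hc hC0 hF)
  · obtain ⟨n, hn⟩ := exists_nat_ge p
    have hn2 : p ≤ ((n + 2 : ℕ) : ℝ) := by push_cast; linarith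
    have hE := EB_B (q := q) (P := α + q + q) (n := n + 2) hp hn2
    have ee : α + q + q - 2 * (q - p + 1) = α + 2 * p - 2 := by ring
    rw [ee] at hE
    set e := α + 2 * p - 2 with hedef
    set k := ((d:ℝ) - p) / (p - 1) with hk
    have hp1 : 0 < p - 1 := by linarith
    refine contra (E := fun y g => y ^ e * g ^ (2 * p)) (s := -(2 * p) - k * e) (n := n + 2) hu hpos (fun y hy => by beta_reduce; rw [Real.zero_rpow (by linarith), mul_zero]) ?_ (by omega) ?_
      (fin2 hp (by omega) (fun y g hy hg => mul_nonneg (Real.rpow_nonneg hy.le _) (Real.rpow_nonneg hg _)) hE hu hpos hw hc hC0 hF)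
    · have : -(2 * p) - k * e + d = -((α * (d - p) + d * (p - 1)) / (p - 1)) := by
        rw [hk, hedef]; field_simp; ring
      rw [this, neg_neg_iff_pos]
      exact div_pos (by linarith) hp1
    · intro B hB0
      obtain ⟨c1, hc1, hlow⟩ := lower hp hpd hu hpos hw
      refine ⟨(c1 * 2 ^ (-k)) ^ e * B ^ (2 * p), fun R hR x hx g hg hgB => ?_⟩
      have hR0 : 0 < R := by linarith
      have h1 := hlow (2 * R) (by linarith) x hx
      rw [← hk, Real.mul_rpow (by norm_num) hR0.le, ← mul_assoc] at h1
      have h2 := Real.rpow_le_rpow_of_nonpos (by positivity) h1 he.le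
      rw [Real.mul_rpow (by positivity) (by positivity), ← Real.rpow_mul hR0.le] at h2
      have h3 := Real.rpow_le_rpow hg hgB (by linarith : 0 ≤ 2 * p)
      rw [Real.div_rpow hB0.le hR0.le] at h3
      refine (mul_le_mul h2 h3 (by positivity) (by positivity)).trans (le_of_eq ?_)
      rw [sub_eq_add_neg, Real.rpow_add hR0, Real.rpow_neg hR0.le, show -k * e = -(k * e) by ring]
      field_simp
end part19

open scoped RealInnerProductSpace

/-- Serrin–Zou Liouville theorem: for 1 < p < d and
p-1 < q < q_c = pd/(d-p) - 1, there is no positive C¹ weak solution of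
-Δ_p u = u^q in all of ℝ^d. -/
theorem stmt13 (d : ℕ) (p q : ℝ) (hp : 1 < p) (hpd : p < (d : ℝ))
    (hq1 : p - 1 < q) (hq2 : q < p * d / ((d : ℝ) - p) - 1) :
    ¬ ∃ u : EuclideanSpace ℝ (Fin d) → ℝ,
        ContDiff ℝ 1 u ∧ (∀ x, 0 < u x) ∧
        ∀ φ : EuclideanSpace ℝ (Fin d) → ℝ, ContDiff ℝ (⊤ : ℕ∞) φ → HasCompactSupport φ →
          ∫ x, ‖gradient u x‖ ^ (p - 2) * ⟪gradient u x, gradient φ x⟫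
            = ∫ x, u x ^ q * φ x := by
  rintro ⟨u, hu, hpos, hw0⟩
  have hw : Weak1 p q u := weak_ext hp hu hpos hw0
  have hDp : 0 < (d:ℝ) - p := by linarith
  have hq2' : q * (d - p) < p * d - (d - p) := by
    rw [lt_sub_iff_add_lt, lt_div_iff₀ hDp] at hq2; linarith
  rcases lt_or_ge (q * (d - p)) (d * (p - 1)) with h | h
  · exact case1 hp hpd hq1 h hu hpos hw
  · exact case2 hp hpd hq1 hq2' h hu hpos hw
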